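/- Let 𝒜 ⊆ ℝ be a countable subring containing an element that is algebraic over ℚ and does not belong to ℤ, let F be a subgroup of the group of units of 𝒜, and let n ≥ 3. Let Γ = {A ∈ GL(n,ℝ) : all entries of A lie in 𝒜 and det A ∈ F}, and let the semidirect product group G = Γ ⋉ 𝒜ⁿ act on ℝⁿ (with Lebesgue measure) by (A,a)·x = A(a+x). Then this action is cocycle superrigid with countable targets: for every countable group Λ, every measurable 1-cocycle Ω : G × ℝⁿ → Λ is cohomologous to a group homomorphism. -/

import Mathlib

open MeasureTheory
open scoped symmDiff

namespace OESuperrigidity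

/-- A map into a (typically countable) discrete space is measurable iff all fibers are
measurable sets. -/
def MeasurableDiscrete {X Λ : Type*} [MeasurableSpace X] (f : X → Λ) : Prop :=
  ∀ l : Λ, MeasurableSet {x | f x = l}

/-- `a` defines an action of the group `G`. -/
def IsAction {G X : Type*} [Group G] (a : G → X → X) : Prop :=
  (∀ x, a 1 x = x) ∧ ∀ g h x, a (g * h) x = a g (a h x)

/-- `f` defines an action of the additive group `ℝ` (a flow). -/
def IsFlow {Y : Type*} (f : ℝ → Y → Y) : Prop :=
  (∀ y, f 0 y = y) ∧ ∀ s t y, f (s + t) y = f s (f t y)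

/-- Each map `a g` is measurable and the pushforward of `μ` under it is equivalent to `μ`. -/
def Nonsingular {ι X : Type*} [MeasurableSpace X] (μ : Measure X) (a : ι → X → X) : Prop :=
  ∀ g, Measurable (a g) ∧ μ.map (a g) ≪ μ ∧ μ ≪ μ.map (a g)

/-- Every a.e. invariant measurable set is null or conull. -/
def ErgodicAction {ι X : Type*} [MeasurableSpace X] (μ : Measure X) (a : ι → X → X) : Prop :=
  ∀ S : Set X, MeasurableSet S → (∀ g, μ ((a g '' S) ∆ S) = 0) → μ S = 0 ∨ μ Sᶜ = 0

/-- The action is essentially free. -/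
def EssentiallyFree {G X : Type*} [Group G] [MeasurableSpace X]
    (μ : Measure X) (a : G → X → X) : Prop :=
  ∀ g : G, g ≠ 1 → μ {x | a g x = x} = 0

/-- The action is induced from a proper subgroup `G₀` acting on a positive-measure
`G₀`-invariant set `X₀` such that the translates of `X₀` over a set `R` of representatives of
the left cosets of `G₀` are pairwise disjoint up to null sets and cover `X` up to a null set. -/
def IsInduced {G X : Type*} [Group G] [MeasurableSpace X]
    (μ : Measure X) (a : G → X → X) : Prop :=
  ∃ G₀ : Subgroup G, G₀ ≠ ⊤ ∧ ∃ X₀ : Set X, MeasurableSet X₀ ∧ 0 < μ X₀ ∧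
    (∀ g ∈ G₀, μ ((a g '' X₀) ∆ X₀) = 0) ∧
    ∃ R : Set G, (∀ g : G, ∃! r, r ∈ R ∧ g⁻¹ * r ∈ G₀) ∧
      (R.Pairwise fun r s => μ (a r '' X₀ ∩ a s '' X₀) = 0) ∧
      μ (⋃ r ∈ R, a r '' X₀)ᶜ = 0

/-- The subgroup `H` admits a measurable fundamental domain for its action. -/
def HasFundamentalDomain {G X : Type*} [Group G] [MeasurableSpace X]
    (μ : Measure X) (a : G → X → X) (H : Subgroup G) : Prop :=
  ∃ U : Set X, MeasurableSet U ∧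
    ((H : Set G).Pairwise fun g h => μ (a g '' U ∩ a h '' U) = 0) ∧
    μ (⋃ g ∈ H, a g '' U)ᶜ = 0

/-- A measurable `1`-cocycle for the action `a` with values in the group `Λ`. -/
def IsCocycle {G X Λ : Type*} [Group G] [Group Λ] [MeasurableSpace X]
    (μ : Measure X) (a : G → X → X) (Ω : G → X → Λ) : Prop :=
  (∀ g, MeasurableDiscrete (Ω g)) ∧
    ∀ g h : G, ∀ᵐ x ∂μ, Ω (g * h) x = Ω g (a h x) * Ω h x

/-- The cocycle `Ω` is cohomologous to a group homomorphism. -/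
def CohomologousToHom {G X Λ : Type*} [Group G] [Group Λ] [MeasurableSpace X]
    (μ : Measure X) (a : G → X → X) (Ω : G → X → Λ) : Prop :=
  ∃ δ : G →* Λ, ∃ φ : X → Λ, MeasurableDiscrete φ ∧
    ∀ g : G, ∀ᵐ x ∂μ, Ω g x = (φ (a g x))⁻¹ * δ g * φ x

/-- The action is cocycle superrigid with countable targets. -/
def CocycleSuperrigid {G X : Type*} [Group G] [MeasurableSpace X]
    (μ : Measure X) (a : G → X → X) : Prop :=
  ∀ (Λ : Type) [Group Λ] [Countable Λ], ∀ Ω : G → X → Λ,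
    IsCocycle μ a Ω → CohomologousToHom μ a Ω

/-- `ω` is (a strict version of) the logarithm of the Radon–Nikodym cocycle of the action. -/
def IsLogRNCocycle {G X : Type*} [Group G] [MeasurableSpace X]
    (μ : Measure X) (a : G → X → X) (ω : G → X → ℝ) : Prop :=
  (∀ g, Measurable (ω g)) ∧
    (∀ g h : G, ∀ᵐ x ∂μ, ω (g * h) x = ω g (a h x) + ω h x) ∧
    ∀ g : G, (fun x => ENNReal.ofReal (Real.exp (ω g x))) =ᵐ[μ] (μ.map (a g⁻¹)).rnDeriv μ

/-- The `G`-invariant σ-finite measure `dμ(x) e^{-s} ds` on `X × ℝ` used for the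
Maharam extension. -/
noncomputable def maharamMeasure {X : Type*} [MeasurableSpace X] (μ : Measure X) :
    Measure (X × ℝ) :=
  μ.prod (volume.withDensity fun s => ENNReal.ofReal (Real.exp (-s)))

/-- The Maharam extension `g · (x, s) = (g · x, ω(g, x) + s)`. -/
def maharamAct {G X : Type*} (a : G → X → X) (ω : G → X → ℝ) : G → X × ℝ → X × ℝ :=
  fun g p => (a g p.1, ω g p.1 + p.2)



open MeasureTheory

variable (n : ℕ) (A : Subring ℝ)

/-- `Γ = {A ∈ GL(n,𝒜) : det A ∈ F}`, realized as the subgroup of the group of invertible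
`n × n` matrices over the ring `𝒜` whose determinant lies in the subgroup `F ⊆ 𝒜ˣ`. -/
def GammaF (F : Subgroup (↥A)ˣ) : Subgroup (Matrix.GeneralLinearGroup (Fin n) ↥A) :=
  F.comap Matrix.GeneralLinearGroup.det

/-- An invertible matrix over `𝒜` acting on `𝒜ⁿ` as an additive automorphism. -/
def mulVecAut (M : Matrix.GeneralLinearGroup (Fin n) ↥A) : AddAut (Fin n → ↥A) where
  toFun v := (M : Matrix (Fin n) (Fin n) ↥A).mulVec v
  invFun v := ((M⁻¹ : Matrix.GeneralLinearGroup (Fin n) ↥A) :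
    Matrix (Fin n) (Fin n) ↥A).mulVec v
  left_inv v := by
    show ((M⁻¹ : Matrix.GeneralLinearGroup (Fin n) ↥A) : Matrix (Fin n) (Fin n) ↥A).mulVec
      ((M : Matrix (Fin n) (Fin n) ↥A).mulVec v) = v
    rw [Matrix.mulVec_mulVec]
    rw [show ((M⁻¹ : Matrix.GeneralLinearGroup (Fin n) ↥A) : Matrix (Fin n) (Fin n) ↥A) *
      (M : Matrix (Fin n) (Fin n) ↥A) = 1 from M.inv_mul]
    exact Matrix.one_mulVec v
  right_inv v := by
    show (M : Matrix (Fin n) (Fin n) ↥A).mulVec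
      (((M⁻¹ : Matrix.GeneralLinearGroup (Fin n) ↥A) : Matrix (Fin n) (Fin n) ↥A).mulVec v) = v
    rw [Matrix.mulVec_mulVec]
    rw [show (M : Matrix (Fin n) (Fin n) ↥A) *
      ((M⁻¹ : Matrix.GeneralLinearGroup (Fin n) ↥A) : Matrix (Fin n) (Fin n) ↥A) = 1
      from M.mul_inv]
    exact Matrix.one_mulVec v
  map_add' v w := Matrix.mulVec_add _ v w

/-- The action of `Γ` on `𝒜ⁿ` (written multiplicatively), needed to form `Γ ⋉ 𝒜ⁿ`. -/
def gammaAut (F : Subgroup (↥A)ˣ) :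
    GammaF n A F →* MulAut (Multiplicative (Fin n → ↥A)) where
  toFun M :=
    { toFun := fun v => Multiplicative.ofAdd (mulVecAut n A (M : Matrix.GeneralLinearGroup (Fin n) ↥A) v.toAdd)
      invFun := fun v => Multiplicative.ofAdd ((mulVecAut n A (M : Matrix.GeneralLinearGroup (Fin n) ↥A)).symm v.toAdd)
      left_inv := fun v => by simp
      right_inv := fun v => by simp
      map_mul' := fun v w => by
        exact congrArg Multiplicative.ofAdd
          (map_add (mulVecAut n A (M : Matrix.GeneralLinearGroup (Fin n) ↥A)) v.toAdd w.toAdd) }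
  map_one' := by
    ext v
    simp [mulVecAut, Matrix.one_mulVec]
  map_mul' M N := by
    ext v
    simp [mulVecAut, Matrix.mulVec_mulVec]

/-- The group `G = Γ ⋉ 𝒜ⁿ`. -/
abbrev AffGroup (F : Subgroup (↥A)ˣ) :=
  SemidirectProduct (Multiplicative (Fin n → ↥A)) (GammaF n A F) (gammaAut n A F)

/-- The affine action of `G = Γ ⋉ 𝒜ⁿ` on `ℝⁿ`: the subgroup `𝒜ⁿ` acts by translations and
`Γ` acts linearly, so that the transformations of `ℝⁿ` arising from `G` are exactly the maps
`x ↦ A(a + x)` with `A ∈ Γ`, `a ∈ 𝒜ⁿ`. -/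
noncomputable def affAct (F : Subgroup (↥A)ˣ) (g : AffGroup n A F) (x : Fin n → ℝ) :
    Fin n → ℝ :=
  (fun i => ((Multiplicative.toAdd g.left) i : ℝ)) +
    (((g.right : Matrix.GeneralLinearGroup (Fin n) ↥A) :
        Matrix (Fin n) (Fin n) ↥A).map (fun r : ↥A => (r : ℝ))).mulVec x


open MeasureTheory

section A1
open UnitAddTorus Filter Topology

lemma integral_fourier_haar (m : ℤ) :
    ∫ x : UnitAddCircle, fourier m x ∂AddCircle.haarAddCircle = if m = 0 then 1 else 0 := by
  split_ifs with h
  · simp [h]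
  · exact integral_eq_zero_of_add_right_eq_neg (μ := AddCircle.haarAddCircle)
      (fourier_add_half_inv_index h one_pos)

/-- The Haar probability measure on the 2-torus. -/
noncomputable def haarT2 : Measure (UnitAddTorus (Fin 2)) :=
  Measure.pi fun _ => AddCircle.haarAddCircle

instance : IsProbabilityMeasure haarT2 := by unfold haarT2; infer_instance

lemma integral_mFourier_haar (m : Fin 2 → ℤ) :
    ∫ x, mFourier m x ∂haarT2 = if m = 0 then 1 else 0 := by
  have h1 : ∫ x, mFourier m x ∂haarT2 = ∏ i, ∫ x : UnitAddCircle, fourier (m i) x ∂AddCircle.haarAddCircle := by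
    exact integral_fintype_prod_eq_prod (𝕜 := ℂ) (fun i x => fourier (m i) x)
  rw [h1]
  simp_rw [integral_fourier_haar]
  rw [Finset.prod_ite_zero]
  simp [funext_iff]

variable {H : Type*} [NormedAddCommGroup H] [InnerProductSpace ℂ H]

/-- the box -/
abbrev box2 (N : ℕ) : Finset (Fin 2 → ℕ) := Fintype.piFinset fun _ => Finset.range N

/-- cast -/
def zc (p : Fin 2 → ℕ) : Fin 2 → ℤ := fun i => (p i : ℤ)

/-- the trigonometric polynomial with vector coefficients -/
noncomputable def trigV (v : (Fin 2 → ℕ) → H) (N : ℕ) (x : UnitAddTorus (Fin 2)) : H :=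
  ∑ k ∈ box2 N, mFourier (-(zc k)) x • v k

lemma trigV_cont (v : (Fin 2 → ℕ) → H) (N : ℕ) : Continuous (trigV v N) := by
  unfold trigV; fun_prop

lemma trigV_normsq (v : (Fin 2 → ℕ) → H) (N : ℕ) (x : UnitAddTorus (Fin 2)) :
    ((‖trigV v N x‖ ^ 2 : ℝ) : ℂ) =
      ∑ k ∈ box2 N, ∑ l ∈ box2 N, mFourier (zc k - zc l) x * inner ℂ (v k) (v l) := by
  have := inner_self_eq_norm_sq_to_K (𝕜 := ℂ) (trigV v N x)
  refine Eq.trans (by push_cast; rfl) (this.symm.trans ?_)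
  unfold trigV
  rw [sum_inner]
  refine Finset.sum_congr rfl fun k _ => ?_
  rw [inner_sum]
  refine Finset.sum_congr rfl fun l _ => ?_
  rw [inner_smul_left, inner_smul_right, ← mul_assoc, sub_eq_add_neg, mFourier_add, mFourier_neg]
  simp

lemma trigV_integral (v : (Fin 2 → ℕ) → H)
    (hv : ∀ p q r, inner ℂ (v (p + r)) (v (q + r)) = inner ℂ (v p) (v q))
    (N : ℕ) (p q : Fin 2 → ℕ) :
    ∫ x, mFourier (zc q - zc p) x * ((‖trigV v N x‖ ^ 2 : ℝ) : ℂ) ∂haarT2 =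
      (((box2 N ×ˢ box2 N).filter fun kl => kl.2 + p = kl.1 + q).card : ℂ) * inner ℂ (v p) (v q) := by
  have h1 : ∀ x, mFourier (zc q - zc p) x * ((‖trigV v N x‖ ^ 2 : ℝ) : ℂ) =
      ∑ kl ∈ box2 N ×ˢ box2 N, mFourier (zc q - zc p + (zc kl.1 - zc kl.2)) x * inner ℂ (v kl.1) (v kl.2) := by
    intro x
    rw [trigV_normsq, Finset.sum_product, Finset.mul_sum]
    refine Finset.sum_congr rfl fun k _ => ?_
    rw [Finset.mul_sum]
    refine Finset.sum_congr rfl fun l _ => ?_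
    rw [mFourier_add]; ring
  simp_rw [h1]
  rw [integral_finsetSum]
  · simp_rw [integral_mul_const, integral_mFourier_haar]
    rw [Finset.card_filter]
    push_cast
    rw [Finset.sum_mul]
    refine Finset.sum_congr rfl fun kl _ => ?_
    by_cases h : kl.2 + p = kl.1 + q
    · have h2 : zc q - zc p + (zc kl.1 - zc kl.2) = 0 := by
        funext i
        have := congrFun h i
        simp only [Pi.add_apply] at this
        simp only [zc, Pi.add_apply, Pi.sub_apply, Pi.zero_apply]; omega
      rw [if_pos h2, if_pos h, ← hv kl.1 kl.2 p, h, add_comm kl.1 q, add_comm kl.1 p, hv]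
    · have h2 : zc q - zc p + (zc kl.1 - zc kl.2) ≠ 0 := by
        intro h3; apply h
        funext i
        have := congrFun h3 i
        simp only [zc, Pi.add_apply, Pi.sub_apply, Pi.zero_apply] at this
        simp only [Pi.add_apply]; omega
      rw [if_neg h2, if_neg h, zero_mul, zero_mul]
  · intro kl _
    apply Continuous.integrable_of_hasCompactSupport
    · fun_prop
    · exact HasCompactSupport.of_compactSpace _

lemma count_upper (N : ℕ) (p q : Fin 2 → ℕ) :
    ((box2 N ×ˢ box2 N).filter fun kl => kl.2 + p = kl.1 + q).card ≤ N ^ 2 := by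
  calc _ ≤ (box2 N).card := by
        apply Finset.card_le_card_of_injOn Prod.fst
        · intro x hx; simp at hx ⊢; exact hx.1.1
        · intro x hx y hy hxy
          simp only [Finset.coe_filter, Set.mem_ofPred_eq] at hx hy
          have : x.2 + p = y.2 + p := by rw [hx.2, hy.2, hxy]
          exact Prod.ext hxy (add_right_cancel this)
    _ = N ^ 2 := by simp [Fintype.card_piFinset]

lemma count_lower (N : ℕ) (p q : Fin 2 → ℕ) (P : ℕ) (hp : ∀ i, p i ≤ P) (hq : ∀ i, q i ≤ P) :
    (N - P) ^ 2 ≤ ((box2 N ×ˢ box2 N).filter fun kl => kl.2 + p = kl.1 + q).card := by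
  calc (N - P) ^ 2 = (box2 (N - P)).card := by simp [Fintype.card_piFinset]
    _ ≤ _ := by
        apply Finset.card_le_card_of_injOn (fun k => (k + p, k + q))
        · intro k hk
          simp only [Finset.mem_coe, Fintype.mem_piFinset, Finset.mem_range] at hk
          simp only [Finset.coe_filter, Set.mem_ofPred_eq, Finset.mem_product, Fintype.mem_piFinset, Finset.mem_range, Pi.add_apply]
          refine ⟨⟨fun i => ?_, fun i => ?_⟩, by abel⟩
          · have := hk i; have := hp i; omega
          · have := hk i; have := hq i; omega
        · intro x _ y _ hxy
          simp only [Prod.mk.injEq] at hxy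
          exact add_right_cancel hxy.1

lemma count_tendsto (p q : Fin 2 → ℕ) :
    Tendsto (fun N : ℕ => (((box2 N ×ˢ box2 N).filter fun kl => kl.2 + p = kl.1 + q).card : ℝ) / (N:ℝ) ^ 2)
      atTop (𝓝 1) := by
  set P := (∑ i, p i) + ∑ i, q i
  have hp : ∀ i, p i ≤ P := fun i => (Finset.single_le_sum (f := p) (fun _ _ => Nat.zero_le _) (Finset.mem_univ i)).trans (Nat.le_add_right _ _)
  have hq : ∀ i, q i ≤ P := fun i => (Finset.single_le_sum (f := q) (fun _ _ => Nat.zero_le _) (Finset.mem_univ i)).trans (Nat.le_add_left _ _)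
  have h0 : Tendsto (fun N : ℕ => (1 - (P : ℝ) / N) ^ 2) atTop (𝓝 1) := by
    have := ((tendsto_const_div_atTop_nhds_zero_nat (P:ℝ)).const_sub 1).pow 2
    simpa using this
  refine tendsto_of_tendsto_of_tendsto_of_le_of_le' h0 tendsto_const_nhds ?_ ?_
  · filter_upwards [eventually_ge_atTop (P + 1)] with N hN
    have hN0 : (0:ℝ) < N := by exact_mod_cast (by omega : 0 < N)
    rw [le_div_iff₀ (by positivity)]
    have := count_lower N p q P hp hq
    have h2 : ((N - P : ℕ) : ℝ) ^ 2 ≤ (((box2 N ×ˢ box2 N).filter fun kl => kl.2 + p = kl.1 + q).card : ℝ) := by exact_mod_cast this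
    rw [Nat.cast_sub (by omega)] at h2
    refine le_trans (le_of_eq ?_) h2
    field_simp
  · filter_upwards [eventually_ge_atTop 1] with N hN
    have hN0 : (0:ℝ) < N := by exact_mod_cast (by omega : 0 < N)
    rw [div_le_one (by positivity)]
    exact_mod_cast count_upper N p q

lemma bochner_exists (v : (Fin 2 → ℕ) → H)
    (hv : ∀ p q r, inner ℂ (v (p + r)) (v (q + r)) = inner ℂ (v p) (v q)) :
    ∃ ν : Measure (UnitAddTorus (Fin 2)), IsFiniteMeasure ν ∧
      ∀ p q, ∫ x, mFourier (zc q - zc p) x ∂ν = inner ℂ (v p) (v q) := by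
  let d : ℕ → UnitAddTorus (Fin 2) → ℝ := fun N x => ‖trigV v N x‖ ^ 2 / (N:ℝ)^2
  have dc : ∀ N, Continuous (d N) := fun N => ((trigV_cont v N).norm.pow 2).div_const _
  have d0 : ∀ N x, 0 ≤ d N x := fun N x => by positivity
  have di : ∀ N, Integrable (d N) haarT2 := fun N =>
    (dc N).integrable_of_hasCompactSupport (HasCompactSupport.of_compactSpace _)
  let ν : ℕ → Measure (UnitAddTorus (Fin 2)) := fun N => haarT2.withDensity fun x => ENNReal.ofReal (d N x)
  have νfin : ∀ N, IsFiniteMeasure (ν N) := fun N =>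
    isFiniteMeasure_withDensity_ofReal (di N).2
  have νint : ∀ N p q, ∫ x, mFourier (zc q - zc p) x ∂(ν N) =
      (((((box2 N ×ˢ box2 N).filter fun kl => kl.2 + p = kl.1 + q).card : ℝ) / (N:ℝ) ^ 2 : ℝ) : ℂ) * inner ℂ (v p) (v q) := by
    intro N p q
    have h1 := integral_withDensity_eq_integral_toReal_smul (μ := haarT2)
      (f := fun x => ENNReal.ofReal (d N x)) ((dc N).measurable.ennreal_ofReal) (by simp)
      (fun x => mFourier (zc q - zc p) x)
    rw [h1]
    have h2 := trigV_integral v hv N p q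
    have h3 : ∀ x, (ENNReal.ofReal (d N x)).toReal • mFourier (zc q - zc p) x =
       (mFourier (zc q - zc p) x * ((‖trigV v N x‖ ^ 2 : ℝ) : ℂ)) * ((N:ℂ)^2)⁻¹ := by
      intro x
      rw [ENNReal.toReal_ofReal (d0 N x)]
      simp only [d, Complex.real_smul]
      push_cast
      ring
    simp_rw [h3]
    rw [integral_mul_const, h2]
    push_cast
    ring
  let νF : ℕ → FiniteMeasure (UnitAddTorus (Fin 2)) := fun N => ⟨ν N, νfin N⟩
  have hmass : ∀ N, (νF N).mass ≤ ‖v 0‖₊ ^ 2 := by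
    intro N
    have h1 := νint N 0 0
    have h2 : zc 0 - zc 0 = 0 := sub_self _
    rw [h2] at h1
    simp only [mFourier_zero, ContinuousMap.one_apply, integral_const] at h1
    have h3 : inner ℂ (v 0) (v 0) = ((‖v 0‖ ^ 2 : ℝ) : ℂ) := by
      rw [inner_self_eq_norm_sq_to_K]; simp
    rw [h3, Complex.real_smul, mul_one, ← Complex.ofReal_mul] at h1
    have h4 := Complex.ofReal_injective h1
    rw [← NNReal.coe_le_coe]
    have h5 : ((νF N).mass : ℝ) = (ν N).real Set.univ := rfl
    rw [h5, h4]
    have h6 := count_upper N 0 0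
    have h7 : (((box2 N ×ˢ box2 N).filter fun kl => kl.2 + 0 = kl.1 + 0).card : ℝ) / (N:ℝ) ^ 2 ≤ 1 := by
      apply div_le_one_of_le₀ _ (by positivity)
      exact_mod_cast h6
    calc _ ≤ 1 * ‖v 0‖ ^ 2 := mul_le_mul_of_nonneg_right h7 (by positivity)
      _ = _ := by simp
  have hK := isCompact_setOfPred_finiteMeasure_le_of_compactSpace (UnitAddTorus (Fin 2)) (‖v 0‖₊ ^ 2)
  obtain ⟨μ, -, hμ⟩ := hK.ultrafilter_le_nhds ((hyperfilter ℕ).map νF) (by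
    rw [Filter.le_principal_iff]
    exact Filter.mem_map.2 (Filter.univ_mem' hmass))
  have hμ' : Tendsto νF (hyperfilter ℕ) (𝓝 μ) := hμ
  rw [FiniteMeasure.tendsto_iff_forall_integral_rclike_tendsto ℂ] at hμ'
  refine ⟨μ, inferInstance, fun p q => ?_⟩
  have h1 := hμ' (BoundedContinuousFunction.mkOfCompact (mFourier (zc q - zc p)))
  have h2 : Tendsto (fun N : ℕ => (((((box2 N ×ˢ box2 N).filter fun kl => kl.2 + p = kl.1 + q).card : ℝ) / (N:ℝ) ^ 2 : ℝ) : ℂ) * inner ℂ (v p) (v q)) (hyperfilter ℕ) (𝓝 (((1:ℝ):ℂ) * inner ℂ (v p) (v q))) := by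
    have := ((Complex.continuous_ofReal.tendsto 1).comp (count_tendsto p q)).mul_const (inner ℂ (v p) (v q))
    refine this.mono_left ?_
    rw [← Nat.cofinite_eq_atTop]
    exact hyperfilter_le_cofinite
  have h3 := tendsto_nhds_unique h1 (h2.congr fun N => by
    rw [← νint]; rfl)
  simpa using h3

lemma measure_ext_mFourier {P P' : Measure (UnitAddTorus (Fin 2))} [IsFiniteMeasure P] [IsFiniteMeasure P']
    (h : ∀ p q, ∫ x, mFourier (zc q - zc p) x ∂P = ∫ x, mFourier (zc q - zc p) x ∂P') : P = P' := by
  have h' : ∀ m, ∫ x, mFourier m x ∂P = ∫ x, mFourier m x ∂P' := by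
    intro m
    have : m = zc (fun i => (m i).toNat) - zc (fun i => (-m i).toNat) := by
      funext i; simp only [zc, Pi.sub_apply]; omega
    rw [this]; exact h _ _
  refine ext_of_forall_mem_subalgebra_integral_eq_of_polish (𝕜 := ℂ)
    (A := (mFourierSubalgebra (Fin 2)).comap (BoundedContinuousFunction.toContinuousMapStarₐ ℂ)) ?_ ?_
  · intro x y hxy
    obtain ⟨f, ⟨g, hg, rfl⟩, hf⟩ := mFourierSubalgebra_separatesPoints hxy
    exact ⟨g, ⟨g, ⟨BoundedContinuousFunction.mkOfCompact g, hg, rfl⟩, rfl⟩, hf⟩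
  · intro g hg
    have hg' : (g : C(UnitAddTorus (Fin 2), ℂ)) ∈ (mFourierSubalgebra (Fin 2)) := hg
    have hg2 : (g : C(UnitAddTorus (Fin 2), ℂ)) ∈ Submodule.span ℂ (Set.range (mFourier (d := Fin 2))) := by
      rw [← mFourierSubalgebra_coe]; exact hg'
    have key : ∀ f : C(UnitAddTorus (Fin 2), ℂ), f ∈ Submodule.span ℂ (Set.range (mFourier (d := Fin 2))) →
        ∫ x, f x ∂P = ∫ x, f x ∂P' := by
      intro f hf
      have hi : ∀ (Q : Measure (UnitAddTorus (Fin 2))) [IsFiniteMeasure Q] (f : C(UnitAddTorus (Fin 2), ℂ)), Integrable f Q :=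
        fun Q _ f => f.continuous.integrable_of_hasCompactSupport (HasCompactSupport.of_compactSpace _)
      induction hf using Submodule.span_induction with
      | mem x hx => obtain ⟨m, rfl⟩ := hx; exact h' m
      | zero => simp
      | add x y _ _ hx hy =>
        simp only [ContinuousMap.add_apply]
        rw [integral_add (hi P x) (hi P y), integral_add (hi P' x) (hi P' y), hx, hy]
      | smul a x _ hx =>
        simp only [ContinuousMap.smul_apply, integral_smul, hx]
    exact key _ hg2

end A1

section A2
open UnitAddTorus Filter Topology

variable {H : Type*} [NormedAddCommGroup H] [InnerProductSpace ℂ H]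

/-- monomial -/
def TT (A B : H →ₗᵢ[ℂ] H) (p : Fin 2 → ℕ) : H →ₗᵢ[ℂ] H := A ^ p 0 * B ^ p 1

lemma TT_add {A B : H →ₗᵢ[ℂ] H} (h : Commute A B) (p r : Fin 2 → ℕ) :
    TT A B (p + r) = TT A B r * TT A B p := by
  unfold TT
  simp only [Pi.add_apply, pow_add]
  have h1 : A ^ p 0 * A ^ r 0 * (B ^ p 1 * B ^ r 1) = (A ^ r 0 * A ^ p 0) * (B ^ r 1 * B ^ p 1) := by
    rw [((Commute.refl A).pow_pow _ _).eq, ((Commute.refl B).pow_pow (p 1) _).eq]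
  rw [h1, mul_assoc, ← mul_assoc (A ^ p 0), (h.pow_pow (p 0) (r 1)).eq]
  simp only [mul_assoc]

/-- spectral measure of a vector -/
def IsSpec (A B : H →ₗᵢ[ℂ] H) (ξ : H) (ν : Measure (UnitAddTorus (Fin 2))) : Prop :=
  ∀ p q, ∫ x, mFourier (zc q - zc p) x ∂ν = inner ℂ (TT A B p ξ) (TT A B q ξ)

lemma exists_isSpec {A B : H →ₗᵢ[ℂ] H} (h : Commute A B) (ξ : H) :
    ∃ ν : Measure (UnitAddTorus (Fin 2)), IsFiniteMeasure ν ∧ IsSpec A B ξ ν := by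
  apply bochner_exists (fun p => TT A B p ξ)
  intro p q r
  simp only [TT_add h]
  exact (TT A B r).inner_map_map _ _

lemma integrable_mF (ν : Measure (UnitAddTorus (Fin 2))) [IsFiniteMeasure ν] (m : Fin 2 → ℤ) :
    Integrable (fun x => mFourier m x) ν :=
  (mFourier m).continuous.integrable_of_hasCompactSupport (HasCompactSupport.of_compactSpace _)

lemma IsSpec.mass {A B : H →ₗᵢ[ℂ] H} {ξ : H} {ν : Measure (UnitAddTorus (Fin 2))} (hs : IsSpec A B ξ ν) :
    ν.real Set.univ = ‖ξ‖ ^ 2 := by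
  have h1 := hs 0 0
  rw [sub_self] at h1
  simp only [mFourier_zero, ContinuousMap.one_apply, integral_const, LinearIsometry.inner_map_map] at h1
  rw [inner_self_eq_norm_sq_to_K, Complex.real_smul, mul_one] at h1
  have h2 : ((ν.real Set.univ : ℝ) : ℂ) = ((‖ξ‖ ^ 2 : ℝ) : ℂ) := by rw [h1]; push_cast; rfl
  exact Complex.ofReal_injective h2

lemma spec_le {A B : H →ₗᵢ[ℂ] H} (h : Commute A B) {x y : H} {νxy νx : Measure (UnitAddTorus (Fin 2))}
    [IsFiniteMeasure νxy] [IsFiniteMeasure νx] (hxy : IsSpec A B (x + y) νxy) (hx : IsSpec A B x νx)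
    (E : Set (UnitAddTorus (Fin 2))) :
    νxy.real E ≤ 5 / 4 * νx.real E + 5 * ‖y‖ ^ 2 := by
  obtain ⟨νy, _, hy⟩ := exists_isSpec h y
  obtain ⟨ν', _, h'⟩ := exists_isSpec h ((1/2 : ℂ) • x - (2:ℂ) • y)
  have key : νxy + ν' = (5/4 : NNReal) • νx + (5 : NNReal) • νy := by
    apply measure_ext_mFourier
    intro p q
    rw [integral_add_measure (integrable_mF _ _) (integrable_mF _ _),
      integral_add_measure (integrable_mF _ _) (integrable_mF _ _),
      integral_smul_nnreal_measure, integral_smul_nnreal_measure, hxy, h', hx, hy]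
    simp only [map_add, map_sub, map_smul, inner_add_left, inner_add_right, inner_sub_left, inner_sub_right, inner_smul_left, inner_smul_right]
    simp only [map_div₀, map_one, map_ofNat, NNReal.smul_def, Complex.real_smul]
    push_cast
    ring
  have h2 : νxy.real E ≤ (νxy + ν').real E := by
    rw [measureReal_add_apply]; linarith [measureReal_nonneg (μ := ν') (s := E)]
  rw [key, measureReal_add_apply] at h2
  have h3 : νy.real E ≤ ‖y‖ ^ 2 := by rw [← hy.mass]; exact measureReal_mono (Set.subset_univ _)
  have e1 : ((5/4 : NNReal) • νx).real E = 5/4 * νx.real E := by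
    rw [measureReal_nnreal_smul_apply]; norm_num
  have e2 : ((5 : NNReal) • νy).real E = 5 * νy.real E := by
    rw [measureReal_nnreal_smul_apply]; norm_num
  rw [e1, e2] at h2
  linarith

/-- representative in (-1/2,1/2] -/
noncomputable def rp (θ : UnitAddCircle) : ℝ := (AddCircle.equivIoc 1 (-1/2) θ : ℝ)

lemma rp_meas : Measurable rp :=
  measurable_subtype_coe.comp (AddCircle.measurableEquivIoc 1 (-1/2)).measurable

lemma rp_coe (θ : UnitAddCircle) : ((rp θ : ℝ) : UnitAddCircle) = θ :=
  (AddCircle.equivIoc (1:ℝ) (-1/2)).symm_apply_apply θ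

lemma rp_mem (θ : UnitAddCircle) : -1/2 < rp θ ∧ rp θ ≤ 1/2 := by
  have := (AddCircle.equivIoc (1:ℝ) (-1/2) θ).2
  refine ⟨this.1, this.2.trans (by norm_num)⟩

lemma rp_eq (a : ℝ) (h : -1/2 < a ∧ a ≤ 1/2) : rp (a : UnitAddCircle) = a := by
  unfold rp
  rw [AddCircle.equivIoc_coe_of_mem ⟨h.1, h.2.trans (by norm_num)⟩]

lemma rp_add (θ η : UnitAddCircle) (h : -1/2 < rp θ + rp η ∧ rp θ + rp η ≤ 1/2) :
    rp (θ + η) = rp θ + rp η := by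
  have := rp_eq _ h
  rwa [AddCircle.coe_add, rp_coe, rp_coe] at this

lemma rp_sub (θ η : UnitAddCircle) (h : -1/2 < rp θ - rp η ∧ rp θ - rp η ≤ 1/2) :
    rp (θ - η) = rp θ - rp η := by
  have := rp_eq _ h
  rwa [AddCircle.coe_sub, rp_coe, rp_coe] at this

lemma fourier_normSq (k : ℤ) (θ : UnitAddCircle) :
    ((‖1 - fourier k θ‖ ^ 2 : ℝ) : ℂ) = 2 - fourier k θ - fourier (-k) θ := by
  have h1 : (starRingEnd ℂ) (fourier k θ) * fourier k θ = 1 := by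
    rw [← fourier_neg, ← fourier_add]; simp
  push_cast
  rw [← Complex.conj_mul']
  simp only [map_sub, map_one]
  rw [fourier_neg]
  linear_combination h1

lemma fourier_one_big (θ : UnitAddCircle) (h : 1/4 ≤ |rp θ|) : 2 ≤ ‖1 - fourier 1 θ‖ ^ 2 := by
  have h1 := fourier_normSq 1 θ
  rw [fourier_neg] at h1
  have h2 := congrArg Complex.re h1
  rw [Complex.ofReal_re] at h2
  simp only [Complex.sub_re, Complex.conj_re] at h2
  have h3 : (fourier 1 θ).re = Real.cos (2 * Real.pi * rp θ) := by
    rw [← rp_coe θ, fourier_coe_apply, rp_coe]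
    rw [← Complex.exp_ofReal_mul_I_re]
    congr 2; push_cast; ring
  have h4 : Real.cos (2 * Real.pi * rp θ) ≤ 0 := by
    rw [← Real.cos_abs]
    have := rp_mem θ
    have hb : |rp θ| ≤ 1/2 := abs_le.2 ⟨by linarith, this.2⟩
    rw [abs_mul, abs_of_pos Real.two_pi_pos]
    apply Real.cos_nonpos_of_pi_div_two_le_of_le
    · nlinarith [Real.pi_pos]
    · nlinarith [Real.pi_pos]
  rw [h2, h3]
  have : (2:ℂ).re = 2 := rfl
  rw [this]; linarith

lemma IsSpec.normsq {A B : H →ₗᵢ[ℂ] H} {ξ : H} {ν : Measure (UnitAddTorus (Fin 2))}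
    [IsFiniteMeasure ν] (hs : IsSpec A B ξ ν) (p : Fin 2 → ℕ) :
    ∫ x, ‖1 - mFourier (zc p) x‖ ^ 2 ∂ν = ‖TT A B p ξ - ξ‖ ^ 2 := by
  have hp : ∀ x, ((‖1 - mFourier (zc p) x‖ ^ 2 : ℝ) : ℂ) = 2 - mFourier (zc p) x - mFourier (-(zc p)) x := by
    intro x
    have h1 : (starRingEnd ℂ) (mFourier (zc p) x) * mFourier (zc p) x = 1 := by
      rw [← mFourier_neg, ← mFourier_add, neg_add_cancel, mFourier_zero]; rfl
    push_cast
    rw [← Complex.conj_mul']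
    simp only [map_sub, map_one]
    rw [mFourier_neg]
    linear_combination h1
  apply Complex.ofReal_injective
  rw [← integral_complex_ofReal]
  simp_rw [hp]
  have i1 := hs 0 p
  have i2 := hs p 0
  have z0 : zc 0 = 0 := by funext i; simp [zc]
  have t0 : TT A B 0 = 1 := by simp [TT]
  rw [z0, t0] at i1 i2
  rw [sub_zero] at i1
  rw [zero_sub] at i2
  have hI : Integrable (fun x => 2 - mFourier (zc p) x) ν := (integrable_const _).sub (integrable_mF _ _)
  rw [integral_sub hI (integrable_mF _ _),
    integral_sub (integrable_const _) (integrable_mF _ _), i1, i2, integral_const, hs.mass]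
  have h3 : ((‖(TT A B p) ξ - ξ‖ ^ 2 : ℝ) : ℂ) = inner ℂ ((TT A B p) ξ - ξ) ((TT A B p) ξ - ξ) := by
    rw [inner_self_eq_norm_sq_to_K]; push_cast; rfl
  have h4 : ((‖ξ‖ ^ 2 : ℝ) : ℂ) = inner ℂ ξ ξ := by
    rw [inner_self_eq_norm_sq_to_K]; push_cast; rfl
  rw [h3, inner_sub_left, inner_sub_right, inner_sub_right, LinearIsometry.inner_map_map, Complex.real_smul, h4]
  simp only [LinearIsometry.coe_one, id]
  ring

end A2

section A3
open UnitAddTorus Filter Topology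

variable {H : Type*} [NormedAddCommGroup H] [InnerProductSpace ℂ H]

lemma IsSpec.map {A B L : H →ₗᵢ[ℂ] H} {ξ : H} {ν : Measure (UnitAddTorus (Fin 2))}
    (hs : IsSpec A B ξ ν) (σ : (Fin 2 → ℕ) → (Fin 2 → ℕ))
    (s : UnitAddTorus (Fin 2) → UnitAddTorus (Fin 2)) (hsm : Measurable s)
    (hσ : ∀ p, TT A B p * L = L * TT A B (σ p))
    (hF : ∀ p q x, mFourier (zc q - zc p) (s x) = mFourier (zc (σ q) - zc (σ p)) x) :
    IsSpec A B (L ξ) (ν.map s) := by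
  intro p q
  rw [integral_map hsm.aemeasurable (mFourier _).continuous.aestronglyMeasurable]
  simp_rw [hF]
  rw [hs]
  have h1 : ∀ p, TT A B p (L ξ) = L (TT A B (σ p) ξ) := fun p => congrArg (fun f : H →ₗᵢ[ℂ] H => f ξ) (hσ p)
  rw [h1, h1, LinearIsometry.inner_map_map]

lemma mF2 (m : Fin 2 → ℤ) (x : UnitAddTorus (Fin 2)) :
    mFourier m x = fourier (m 0) (x 0) * fourier (m 1) (x 1) := by
  simp [mFourier]

lemma fourier_add_arg (k : ℤ) (x y : UnitAddCircle) : fourier k (x + y) = fourier k x * fourier k y := by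
  simp [fourier_apply, smul_add, AddCircle.toCircle_add]

/-- shear -/
def shW (x : UnitAddTorus (Fin 2)) : UnitAddTorus (Fin 2) := ![x 0 + x 1, x 1]
/-- shear -/
def shU (x : UnitAddTorus (Fin 2)) : UnitAddTorus (Fin 2) := ![x 0, x 0 + x 1]

lemma shW_meas : Measurable shW := by
  unfold shW; refine measurable_pi_iff.2 fun i => ?_
  fin_cases i <;> simp <;> fun_prop
lemma shU_meas : Measurable shU := by
  unfold shU; refine measurable_pi_iff.2 fun i => ?_
  fin_cases i <;> simp <;> fun_prop

lemma shear_est {A B L : H →ₗᵢ[ℂ] H} (h : Commute A B) {ξ : H} {ν : Measure (UnitAddTorus (Fin 2))}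
    [IsFiniteMeasure ν] (hs : IsSpec A B ξ ν) (s : UnitAddTorus (Fin 2) → UnitAddTorus (Fin 2)) (hsm : Measurable s)
    (h2 : IsSpec A B (L ξ) (ν.map s)) {e : ℝ} (he : ‖L ξ - ξ‖ ^ 2 ≤ e) {E : Set (UnitAddTorus (Fin 2))}
    (hE : MeasurableSet E) :
    ν.real (s ⁻¹' E) ≤ 5 / 4 * ν.real E + 5 * e ∧ ν.real E ≤ 5 / 4 * ν.real (s ⁻¹' E) + 5 * e := by
  have e1 : (ν.map s).real E = ν.real (s ⁻¹' E) := map_measureReal_apply hsm hE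
  rw [← e1]
  constructor
  · have h3 : IsSpec A B (ξ + (L ξ - ξ)) (ν.map s) := by rwa [add_sub_cancel]
    have := spec_le h h3 hs E
    linarith
  · have h3 : IsSpec A B (L ξ + (ξ - L ξ)) ν := by rwa [add_sub_cancel]
    have := spec_le h h3 h2 E
    rw [norm_sub_rev] at this
    linarith

lemma tail_est {ν : Measure (UnitAddTorus (Fin 2))} [IsFiniteMeasure ν] (i : Fin 2) {e : ℝ}
    (h : ∫ x : UnitAddTorus (Fin 2), ‖1 - fourier 1 (x i)‖ ^ 2 ∂ν ≤ e) :
    ν.real {x | 1/4 ≤ |rp (x i)|} ≤ e / 2 := by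
  have hc : Continuous fun x : UnitAddTorus (Fin 2) => ‖1 - (fourier 1 (x i) : ℂ)‖ ^ 2 := by fun_prop
  have hi : Integrable (fun x : UnitAddTorus (Fin 2) => ‖1 - (fourier 1 (x i) : ℂ)‖ ^ 2) ν :=
    hc.integrable_of_hasCompactSupport (HasCompactSupport.of_compactSpace _)
  have h1 := mul_meas_ge_le_integral_of_nonneg (μ := ν) (Eventually.of_forall fun x => by positivity) hi 2
  have h2 : ν.real {x | 1/4 ≤ |rp (x i)|} ≤ ν.real {x : UnitAddTorus (Fin 2) | 2 ≤ ‖1 - (fourier 1 (x i) : ℂ)‖ ^ 2} :=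
    measureReal_mono fun x hx => fourier_one_big _ hx
  linarith

/-- Relative property (T) for the pair of shears, quantitative form. -/
theorem relT {A B U W : H →ₗᵢ[ℂ] H} (hAB : A * B = B * A)
    (hAU : A * U = U * (A * B)) (hBU : B * U = U * B)
    (hBW : B * W = W * (A * B)) (hAW : A * W = W * A) {ξ : H} {e : ℝ}
    (eA : ‖A ξ - ξ‖ ^ 2 ≤ e) (eB : ‖B ξ - ξ‖ ^ 2 ≤ e) (eU : ‖U ξ - ξ‖ ^ 2 ≤ e) (eW : ‖W ξ - ξ‖ ^ 2 ≤ e)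
    (k : ℕ) : ‖(A ^ k) ξ - ξ‖ ^ 2 ≤ 124 * e := by
  have hc : Commute A B := hAB
  obtain ⟨ν, _, hs⟩ := exists_isSpec hc ξ
  have sU : IsSpec A B (U ξ) (ν.map shW) := by
    refine hs.map (fun p => ![p 0, p 0 + p 1]) shW shW_meas ?_ ?_
    · intro p
      have c1 : SemiconjBy U (A * B) A := hAU.symm
      have c2 : SemiconjBy U B B := hBU.symm
      have c3 := (c1.pow_right (p 0)).mul_right (c2.pow_right (p 1))
      rw [SemiconjBy, hc.mul_pow] at c3
      simp only [TT]
      rw [← c3]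
      simp [pow_add, mul_assoc]
    · intro p q x
      rw [mF2, mF2]
      simp only [shW, zc, Pi.sub_apply, Matrix.cons_val_zero, Matrix.cons_val_one, fourier_add_arg]
      push_cast
      rw [show (q 0 : ℤ) + q 1 - (p 0 + p 1) = (q 0 - p 0) + (q 1 - p 1) by ring, fourier_add (m := (q 0 : ℤ) - p 0)]
      ring
  have sW : IsSpec A B (W ξ) (ν.map shU) := by
    refine hs.map (fun p => ![p 0 + p 1, p 1]) shU shU_meas ?_ ?_
    · intro p
      have c1 : SemiconjBy W (A * B) B := hBW.symm
      have c2 : SemiconjBy W A A := hAW.symm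
      have c3 := (c2.pow_right (p 0)).mul_right (c1.pow_right (p 1))
      rw [SemiconjBy, hc.mul_pow] at c3
      simp only [TT]
      rw [← c3]
      simp [pow_add, mul_assoc]
    · intro p q x
      rw [mF2, mF2]
      simp only [shU, zc, Pi.sub_apply, Matrix.cons_val_zero, Matrix.cons_val_one, fourier_add_arg]
      push_cast
      rw [show (q 0 : ℤ) + q 1 - (p 0 + p 1) = (q 0 - p 0) + (q 1 - p 1) by ring, fourier_add (m := (q 0 : ℤ) - p 0)]
      ring
  have tail0 : ν.real {x | 1/4 ≤ |rp (x 0)|} ≤ e / 2 := by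
    apply tail_est
    have := hs.normsq ![1, 0]
    simp only [mF2, zc, TT] at this
    simp at this
    simp only [fourier_one]
    rw [this]; exact eA
  have tail1 : ν.real {x | 1/4 ≤ |rp (x 1)|} ≤ e / 2 := by
    apply tail_est
    have := hs.normsq ![0, 1]
    simp only [mF2, zc, TT] at this
    simp at this
    simp only [fourier_one]
    rw [this]; exact eB
  -- measurable sets
  have m0 : Measurable fun x : UnitAddTorus (Fin 2) => rp (x 0) := rp_meas.comp (measurable_pi_apply 0)
  have m1 : Measurable fun x : UnitAddTorus (Fin 2) => rp (x 1) := rp_meas.comp (measurable_pi_apply 1)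
  let V : Set (UnitAddTorus (Fin 2)) := {x | |rp (x 0)| < 1/4} ∩ {x | |rp (x 1)| < 1/4}
  have mV : MeasurableSet V := (measurableSet_lt (by fun_prop) measurable_const).inter (measurableSet_lt (by fun_prop) measurable_const)
  have tV : ν.real Vᶜ ≤ e := by
    have : Vᶜ = {x | 1/4 ≤ |rp (x 0)|} ∪ {x | 1/4 ≤ |rp (x 1)|} := by
      ext x; simp [V, not_and_or, -not_and]
    rw [this]
    refine (measureReal_union_le _ _).trans (by linarith)
  let pos : Set (UnitAddTorus (Fin 2)) := {x | 0 < rp (x 0) ∧ 0 ≤ rp (x 1)}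
  let neg : Set (UnitAddTorus (Fin 2)) := {x | rp (x 0) < 0 ∧ rp (x 1) ≤ 0}
  let Q := pos ∪ neg
  let pos' : Set (UnitAddTorus (Fin 2)) := {x | 0 < rp (x 1) ∧ rp (x 0) ≤ 0}
  let neg' : Set (UnitAddTorus (Fin 2)) := {x | rp (x 1) < 0 ∧ 0 ≤ rp (x 0)}
  let Q' := pos' ∪ neg'
  let D : Set (UnitAddTorus (Fin 2)) := {x | |rp (x 0)| ≤ |rp (x 1)|}
  let Eq0 : Set (UnitAddTorus (Fin 2)) := {x | |rp (x 0)| = |rp (x 1)|}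
  have mD : MeasurableSet D := measurableSet_le (by fun_prop) (by fun_prop)
  have mQ : MeasurableSet Q := by
    refine ((measurableSet_lt measurable_const m0).inter (measurableSet_le measurable_const m1)).union
      ((measurableSet_lt m0 measurable_const).inter (measurableSet_le m1 measurable_const))
  have mQ' : MeasurableSet Q' := by
    refine ((measurableSet_lt measurable_const m1).inter (measurableSet_le m0 measurable_const)).union
      ((measurableSet_lt m1 measurable_const).inter (measurableSet_le measurable_const m0))
  have split : ∀ E : Set (UnitAddTorus (Fin 2)), MeasurableSet E → ν.real E = ν.real (E ∩ D) + ν.real (E \ D) :=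
    fun E hE => (measureReal_inter_add_sdiff (μ := ν) mD).symm
  have splitV : ∀ E : Set (UnitAddTorus (Fin 2)), ν.real E ≤ ν.real (E ∩ V) + e := by
    intro E
    rw [← measureReal_inter_add_sdiff (μ := ν) (s := E) mV]
    have : ν.real (E \ V) ≤ ν.real Vᶜ := measureReal_mono (fun x hx => hx.2)
    linarith
  -- first sector
  have sec1 : ν.real (Q ∩ V) ≤ 15 * e := by
    have a1 := (shear_est hc hs shU shU_meas sW eW (mQ.inter mD)).1
    have a2 := (shear_est hc hs shW shW_meas sU eU (mQ.diff mD)).1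
    have b1 : ν.real (Q ∩ V) ≤ ν.real (shU ⁻¹' (Q ∩ D)) := by
      refine measureReal_mono ?_ (measure_ne_top _ _)
      rintro x ⟨hQ, hV⟩
      have w0 := hV.1
      have w1 := hV.2
      simp only [Set.mem_ofPred_eq] at w0 w1
      have v0 := abs_lt.1 w0
      have v1 := abs_lt.1 w1
      have ha : rp (x 0 + x 1) = rp (x 0) + rp (x 1) := rp_add _ _ ⟨by linarith, by linarith⟩
      simp only [Set.mem_preimage, Set.mem_inter_iff, Q, D, pos, neg, Set.mem_union, Set.mem_ofPred_eq, shU,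
        Matrix.cons_val_zero, Matrix.cons_val_one, ha] at hQ ⊢
      rcases hQ with h | h
      · refine ⟨Or.inl ⟨h.1, by linarith⟩, ?_⟩
        rw [abs_of_pos h.1, abs_of_nonneg (by linarith)]; linarith
      · refine ⟨Or.inr ⟨h.1, by linarith⟩, ?_⟩
        rw [abs_of_neg h.1, abs_of_nonpos (by linarith)]; linarith
    have b2 : ν.real (Q ∩ V) ≤ ν.real (shW ⁻¹' (Q \ D)) := by
      refine measureReal_mono ?_ (measure_ne_top _ _)
      rintro x ⟨hQ, hV⟩
      have w0 := hV.1
      have w1 := hV.2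
      simp only [Set.mem_ofPred_eq] at w0 w1
      have v0 := abs_lt.1 w0
      have v1 := abs_lt.1 w1
      have ha : rp (x 0 + x 1) = rp (x 0) + rp (x 1) := rp_add _ _ ⟨by linarith, by linarith⟩
      simp only [Set.mem_preimage, Set.mem_sdiff, Q, D, pos, neg, Set.mem_union, Set.mem_ofPred_eq, shW,
        Matrix.cons_val_zero, Matrix.cons_val_one, ha, not_le] at hQ ⊢
      rcases hQ with h | h
      · refine ⟨Or.inl ⟨by linarith, h.2⟩, ?_⟩
        rw [abs_of_nonneg h.2, abs_of_nonneg (by linarith)]; linarith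
      · refine ⟨Or.inr ⟨by linarith, h.2⟩, ?_⟩
        rw [abs_of_nonpos h.2, abs_of_nonpos (by linarith)]; linarith
    have c1 := split Q mQ
    have c2 := splitV Q
    have e0 : 0 ≤ e := le_trans (by positivity) eA
    linarith
  have sec2 : ν.real (Q' ∩ V) ≤ 15 * e := by
    have a1 := (shear_est hc hs shU shU_meas sW eW (mQ'.inter mV)).2
    have a2 := (shear_est hc hs shW shW_meas sU eU (mQ'.inter mV)).2
    have b1 : ν.real (shU ⁻¹' (Q' ∩ V)) ≤ ν.real ((Q' ∩ D) \ Eq0) := by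
      refine measureReal_mono ?_ (measure_ne_top _ _)
      rintro x ⟨hQ, hV⟩
      have w0 := hV.1
      have w1 := hV.2
      simp only [Set.mem_ofPred_eq] at w0 w1
      have v0 := abs_lt.1 w0
      have v1 := abs_lt.1 w1
      simp only [shU, Matrix.cons_val_zero, Matrix.cons_val_one] at v0 v1
      have ha : rp (x 0 + x 1 - x 0) = rp (x 0 + x 1) - rp (x 0) := rp_sub _ _ ⟨by linarith, by linarith⟩
      rw [add_sub_cancel_left] at ha
      simp only [Set.mem_preimage, Set.mem_inter_iff, Set.mem_sdiff, Q', D, Eq0, pos', neg', Set.mem_union, Set.mem_ofPred_eq, shU,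
        Matrix.cons_val_zero, Matrix.cons_val_one] at hQ ⊢
      rw [ha]
      rcases hQ with h | h
      · refine ⟨⟨Or.inl ⟨by linarith, h.2⟩, ?_⟩, ?_⟩ <;>
        rw [abs_of_nonpos h.2, abs_of_nonneg (by linarith)] <;> intros <;> linarith
      · refine ⟨⟨Or.inr ⟨by linarith, h.2⟩, ?_⟩, ?_⟩ <;>
        rw [abs_of_nonneg h.2, abs_of_nonpos (by linarith)] <;> intros <;> linarith
    have b2 : ν.real (shW ⁻¹' (Q' ∩ V)) ≤ ν.real ((Q' \ D) ∪ (Q' ∩ Eq0)) := by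
      refine measureReal_mono ?_ (measure_ne_top _ _)
      rintro x ⟨hQ, hV⟩
      have w0 := hV.1
      have w1 := hV.2
      simp only [Set.mem_ofPred_eq] at w0 w1
      have v0 := abs_lt.1 w0
      have v1 := abs_lt.1 w1
      simp only [shW, Matrix.cons_val_zero, Matrix.cons_val_one] at v0 v1
      have ha : rp (x 0 + x 1 - x 1) = rp (x 0 + x 1) - rp (x 1) := rp_sub _ _ ⟨by linarith, by linarith⟩
      rw [add_sub_cancel_right] at ha
      simp only [Set.mem_preimage, Set.mem_inter_iff, Set.mem_sdiff, Q', D, Eq0, pos', neg', Set.mem_union, Set.mem_ofPred_eq, shW,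
        Matrix.cons_val_zero, Matrix.cons_val_one] at hQ ⊢
      rw [ha]
      have : |rp (x 1)| ≤ |rp (x 0 + x 1) - rp (x 1)| ∧ ((0 < rp (x 1) ∧ rp (x 0 + x 1) - rp (x 1) ≤ 0) ∨ (rp (x 1) < 0 ∧ 0 ≤ rp (x 0 + x 1) - rp (x 1))) := by
        rcases hQ with h | h
        · refine ⟨?_, Or.inl ⟨h.1, by linarith⟩⟩
          rw [abs_of_pos h.1, abs_of_nonpos (by linarith)]; linarith
        · refine ⟨?_, Or.inr ⟨h.1, by linarith⟩⟩
          rw [abs_of_neg h.1, abs_of_nonneg (by linarith)]; linarith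
      rcases this.1.lt_or_eq with h | h
      · exact Or.inl ⟨this.2, not_le.2 h⟩
      · exact Or.inr ⟨this.2, h.symm⟩
    have c1 : ν.real ((Q' ∩ D) \ Eq0) + ν.real ((Q' \ D) ∪ (Q' ∩ Eq0)) ≤ ν.real Q' := by
      have meq : MeasurableSet {x : UnitAddTorus (Fin 2) | |rp (x 0)| = |rp (x 1)|} := measurableSet_eq_fun (by fun_prop) (by fun_prop)
      rw [← measureReal_union (Set.disjoint_left.2 ?_) ((mQ'.diff mD).union (mQ'.inter meq))]
      · refine measureReal_mono ?_ (measure_ne_top _ _)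
        rintro x (h | h | h)
        exacts [h.1.1, h.1, h.1]
      · rintro x h (h' | h')
        exacts [h'.2 h.1.2, h.2 h'.2]
    have c2 := splitV Q'
    have e0 : 0 ≤ e := le_trans (by positivity) eA
    linarith
  have hz : ν.real {x | x ≠ 0} ≤ 31 * e := by
    have : {x : UnitAddTorus (Fin 2) | x ≠ 0} ⊆ (Q ∩ V) ∪ (Q' ∩ V) ∪ Vᶜ := by
      intro x hx
      by_cases hV : x ∈ V
      · left
        by_contra hcon
        apply hx
        have h1 : x ∉ Q := fun h => hcon (Or.inl ⟨h, hV⟩)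
        have h2 : x ∉ Q' := fun h => hcon (Or.inr ⟨h, hV⟩)
        simp only [Q, Q', pos, neg, pos', neg', Set.mem_union, Set.mem_ofPred_eq] at h1 h2
        push Not at h1 h2
        have z0 : rp (x 0) = 0 := by
          rcases lt_trichotomy (rp (x 0)) 0 with h | h | h
          · linarith [h1.2 h, (lt_or_ge 0 (rp (x 1))).elim (fun h' => h2.1 h') (fun h' => by linarith [h1.2 h])]
          · exact h
          · linarith [h1.1 h, (lt_or_ge (rp (x 1)) 0).elim (fun h' => h2.2 h') (fun h' => by linarith [h1.1 h])]
        have z1 : rp (x 1) = 0 := by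
          rcases lt_trichotomy (rp (x 1)) 0 with h | h | h
          · linarith [h2.2 h]
          · exact h
          · linarith [h2.1 h]
        funext i
        fin_cases i
        · have := rp_coe (x 0); rw [z0] at this; simpa using this.symm
        · have := rp_coe (x 1); rw [z1] at this; simpa using this.symm
      · exact Or.inr hV
    refine (measureReal_mono this).trans ?_
    refine (measureReal_union_le _ _).trans ?_
    have := measureReal_union_le (μ := ν) (Q ∩ V) (Q' ∩ V)
    linarith
  -- conclusion
  have hfin := hs.normsq ![k, 0]
  have hT : TT A B ![k, 0] = A ^ k := by simp [TT]
  rw [hT] at hfin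
  rw [← hfin]
  have mz : MeasurableSet {x : UnitAddTorus (Fin 2) | x ≠ 0} := (measurableSet_singleton _).compl
  have hle : ∀ x, ‖1 - mFourier (zc ![k, 0]) x‖ ^ 2 ≤ ({x : UnitAddTorus (Fin 2) | x ≠ 0}).indicator (fun _ => (4:ℝ)) x := by
    intro x
    by_cases hx : x = 0
    · subst hx
      have : ∀ m : Fin 2 → ℤ, mFourier m 0 = 1 := fun m => by simp [mFourier]
      simp [this]
    · rw [Set.indicator_of_mem (show x ∈ {x | x ≠ 0} from hx)]
      have h1 : ‖mFourier (zc ![k, 0]) x‖ ≤ 1 := by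
        exact (ContinuousMap.norm_coe_le_norm _ x).trans mFourier_norm.le
      have h2 : ‖1 - mFourier (zc ![k, 0]) x‖ ≤ 2 := by
        refine (norm_sub_le _ _).trans ?_
        rw [norm_one]; linarith
      have := norm_nonneg (1 - mFourier (zc ![k, 0]) x)
      nlinarith
  have hint : Integrable (fun x => ‖1 - mFourier (zc ![k, 0]) x‖ ^ 2) ν := by
    apply Continuous.integrable_of_hasCompactSupport (by fun_prop) (HasCompactSupport.of_compactSpace _)
  refine (integral_mono hint ((integrable_const (4:ℝ)).indicator mz) hle).trans ?_
  rw [integral_indicator_const _ mz, smul_eq_mul]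
  linarith

end A3

section B1
open Filter Topology
open scoped symmDiff ENNReal

/-- B2 : continuity in measure. -/
theorem cont_meas {X P Λ : Type*} [TopologicalSpace X] [MeasurableSpace X] [BorelSpace X] [R1Space X]
    [TopologicalSpace P] [FirstCountableTopology P]
    [MeasurableSpace Λ] [DiscreteMeasurableSpace Λ] [Countable Λ]
    (μ : Measure X) [μ.InnerRegularCompactLTTop] [IsLocallyFiniteMeasure μ]
    (f : P → X → X) (hf : Continuous (Function.uncurry f)) (hmp : ∀ p, MeasurePreserving (f p) μ μ)
    (p₀ : P) (h0 : ∀ x, f p₀ x = x)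
    {u : X → Λ} (hu : Measurable u) {K : Set X} (hK : MeasurableSet K) (hKf : μ K ≠ ∞) :
    Tendsto (fun p => μ (K ∩ {x | u (f p x) ≠ u x})) (𝓝 p₀) (𝓝 0) := by
  let E : Λ → Set X := fun l => K ∩ u ⁻¹' {l}
  have mE : ∀ l, MeasurableSet (E l) := fun l => hK.inter (hu (measurableSet_singleton l))
  have hle : ∀ p, μ (K ∩ {x | u (f p x) ≠ u x}) ≤ ∫⁻ l, μ (E l \ (f p) ⁻¹' (E l)) ∂(Measure.count : Measure Λ) := by
    intro p
    rw [lintegral_count]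
    refine le_trans (measure_mono ?_) (measure_iUnion_le _)
    intro x hx
    refine Set.mem_iUnion.2 ⟨u x, ⟨hx.1, rfl⟩, fun h => hx.2 h.2⟩
  have hsum : ∫⁻ l, μ (E l) ∂(Measure.count : Measure Λ) ≠ ∞ := by
    rw [lintegral_count, ← measure_iUnion _ mE]
    · refine ne_top_of_le_ne_top hKf (measure_mono ?_)
      exact Set.iUnion_subset fun l => Set.inter_subset_left
    · intro a b hab
      refine Set.disjoint_left.2 fun x hx hy => hab ?_
      exact hx.2.symm.trans hy.2
  have hlim : ∀ l, Tendsto (fun p => μ (E l \ (f p) ⁻¹' (E l))) (𝓝 p₀) (𝓝 0) := by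
    intro l
    have hc : ∀ p, Continuous (f p) := fun p => hf.comp (Continuous.prodMk_right p)
    let F : P → C(X, X) := fun p => ⟨f p, hc p⟩
    have hF : Continuous F := ContinuousMap.continuous_of_continuous_uncurry _ hf
    have := tendsto_measure_symmDiff_preimage_nhds_zero (μ := μ) (ν := μ) (f := F) (g := F p₀)
      (s := E l) (hF.tendsto p₀) (Eventually.of_forall hmp) (hmp p₀) (mE l).nullMeasurableSet
      (ne_top_of_le_ne_top hKf (measure_mono Set.inter_subset_left))
    refine tendsto_of_tendsto_of_tendsto_of_le_of_le tendsto_const_nhds this (fun _ => zero_le) ?_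
    intro p
    refine measure_mono ?_
    intro x hx
    refine Or.inr ⟨?_, hx.2⟩
    show F p₀ x ∈ E l
    show f p₀ x ∈ E l
    rw [h0]; exact hx.1
  have := tendsto_lintegral_filter_of_dominated_convergence (μ := (Measure.count : Measure Λ)) (l := 𝓝 p₀)
    (F := fun p l => μ (E l \ (f p) ⁻¹' (E l))) (f := fun _ => 0) (fun l => μ (E l))
    (Eventually.of_forall fun _ => Measurable.of_discrete)
    (Eventually.of_forall fun p => ae_of_all _ fun l => measure_mono Set.sdiff_subset) hsum
    (ae_of_all _ hlim)
  rw [lintegral_zero] at this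
  exact tendsto_of_tendsto_of_tendsto_of_le_of_le tendsto_const_nhds this (fun _ => zero_le) hle

/-- CL -/
theorem CL {X Λ : Type*} [TopologicalSpace X] [AddCommGroup X] [IsTopologicalAddGroup X]
    [MeasurableSpace X] [BorelSpace X] [FirstCountableTopology X] [SigmaCompactSpace X] [T2Space X] [SecondCountableTopology X]
    [MeasurableSpace Λ] [DiscreteMeasurableSpace Λ] [Countable Λ]
    (μ : Measure X) [μ.InnerRegularCompactLTTop] [IsFiniteMeasureOnCompacts μ] [IsLocallyFiniteMeasure μ] [μ.IsAddLeftInvariant]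
    {u : X → Λ} (hu : Measurable u) : IsClosed {v : X | ∀ᵐ x ∂μ, u (x + v) = u x} := by
  rw [isClosed_iff_frequently]
  intro v hv
  have key : ∀ K : Set X, IsCompact K → μ (K ∩ {x | u (x + v) ≠ u x}) = 0 := by
    intro K hK
    have hc := cont_meas μ (fun (p : X) x => x + p) (by fun_prop) (fun p => measurePreserving_add_right μ p)
      0 (by simp) hu (K := (fun x => x + v) '' K) (hK.image (by fun_prop)).measurableSet
      ((hK.image (by fun_prop)).measure_lt_top.ne)
    have h2 : Tendsto (fun w => w - v) (𝓝 v) (𝓝 0) := by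
      have : Continuous (fun w : X => w - v) := by fun_prop
      simpa using this.tendsto v
    have h3 := hc.comp h2
    by_contra hne
    have := h3.eventually (gt_mem_nhds (pos_iff_ne_zero.2 hne))
    obtain ⟨w, hw, hlt⟩ := (hv.and_eventually this).exists
    refine absurd hlt (not_lt.2 ?_)
    simp only [Function.comp]
    have mS : MeasurableSet ((fun x => x + v) '' K ∩ {x | u (x + (w - v)) ≠ u x}) :=
      (hK.image (by fun_prop)).measurableSet.inter
        (measurableSet_eq_fun (hu.comp (measurable_add_const (w - v))) hu).compl
    rw [← (measurePreserving_add_right μ v).measure_preimage mS.nullMeasurableSet]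
    refine measure_mono_ae ?_
    filter_upwards [hw] with x hx hxK
    refine ⟨⟨x, hxK.1, rfl⟩, ?_⟩
    have e : x + v + (w - v) = x + w := by abel
    show u (x + v + (w - v)) ≠ u (x + v)
    rw [e]
    rw [show u (x + w) = u x from hx]
    exact fun h => hxK.2 h.symm
  show μ {x | ¬ u (x + v) = u x} = 0
  rw [← Set.univ_inter {x | ¬ u (x + v) = u x}, ← iUnion_compactCovering, Set.iUnion_inter]
  exact measure_iUnion_null fun k => key _ (isCompact_compactCovering X k)

theorem LL {n : ℕ} {Λ : Type*} [MeasurableSpace Λ] [DiscreteMeasurableSpace Λ] [Countable Λ]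
    {u : (Fin n → ℝ) → Λ} (hu : Measurable u) (v : Fin n → ℝ)
    (hinv : ∀ s r : ℝ, ∀ᵐ x, u (x + s • v) = u x → u (x + r • v + s • v) = u (x + r • v)) (s : ℝ) :
    ∀ᵐ x, u (x + s • v) = u x := by
  have h1 : ∀ N : ℕ, ∀ᵐ x, u (x + (s / (N + 1)) • v) = u x → u (x + s • v) = u x := by
    intro N
    have : ∀ᵐ x, ∀ k : ℕ, u (x + (s / (N + 1)) • v) = u x →
      u (x + ((k : ℝ) * (s / (N + 1))) • v + (s / (N + 1)) • v) = u (x + ((k : ℝ) * (s / (N + 1))) • v) :=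
      ae_all_iff.2 fun k => hinv _ _
    filter_upwards [this] with x hx h
    have ind : ∀ k : ℕ, u (x + ((k : ℝ) * (s / (N + 1))) • v) = u x := by
      intro k
      induction k with
      | zero => simp
      | succ k ih =>
        rw [← ih, ← hx k h]
        congr 1
        push_cast
        rw [add_assoc, ← add_smul]
        congr 2
        ring
    have := ind (N + 1)
    have e : ((N + 1 : ℕ) : ℝ) * (s / (N + 1)) = s := by push_cast; field_simp
    rwa [e] at this
  have key : ∀ K : Set (Fin n → ℝ), IsCompact K → volume (K ∩ {x | u (x + s • v) ≠ u x}) = 0 := by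
    intro K hK
    have hc := cont_meas volume (fun (p : Fin n → ℝ) x => x + p) (by fun_prop)
      (fun p => measurePreserving_add_right volume p)
      0 (by simp) hu (K := K) hK.measurableSet hK.measure_lt_top.ne
    have h2 : Tendsto (fun N : ℕ => (s / (N + 1)) • v) atTop (𝓝 0) := by
      have : Tendsto (fun N : ℕ => (s / ((N : ℝ) + 1))) atTop (𝓝 0) :=
        tendsto_const_div_atTop_nhds_zero_nat s |>.comp (tendsto_add_atTop_nat 1) |>.congr (by intro N; simp)
      simpa using this.smul_const v
    refine le_antisymm (ge_of_tendsto' (hc.comp h2) fun N => ?_) zero_le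
    refine measure_mono_ae ?_
    filter_upwards [h1 N] with x hx hxK
    exact ⟨hxK.1, fun h => hxK.2 (hx h)⟩
  show volume {x | ¬ u (x + s • v) = u x} = 0
  rw [← Set.univ_inter {x | ¬ u (x + s • v) = u x}, ← iUnion_compactCovering, Set.iUnion_inter]
  exact measure_iUnion_null fun k => key _ (isCompact_compactCovering _ k)

theorem H1 {Z Λ : Type*} [MeasurableSpace Z] [MeasurableSpace Λ] [DiscreteMeasurableSpace Λ] [Countable Λ] [Nonempty Λ]
    (A : Λ → Set Z) (hA : ∀ l, MeasurableSet (A l)) :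
    ∃ F : Z → Λ, Measurable F ∧ ∀ z l, (∀ l', z ∈ A l' ↔ l' = l) → F z = l := by
  classical
  let U : Λ → Set Z := fun l => {z | ∀ l', z ∈ A l' ↔ l' = l}
  have mU : ∀ l, MeasurableSet (U l) := by
    intro l
    have : U l = ⋂ l', {z | z ∈ A l' ↔ l' = l} := by ext z; simp [U]
    rw [this]
    refine MeasurableSet.iInter fun l' => ?_
    by_cases h : l' = l
    · simpa [h] using hA l
    · simp only [h, iff_false]; exact (hA l').compl
  let o : Λ := Classical.arbitrary Λ
  let F : Z → Λ := fun z => if h : ∃ l, z ∈ U l then h.choose else o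
  have hF : ∀ z l, z ∈ U l → F z = l := by
    intro z l hz
    have h : ∃ l, z ∈ U l := ⟨l, hz⟩
    have e : F z = h.choose := dif_pos h
    rw [e]
    exact (hz _).1 ((h.choose_spec _).2 rfl)
  refine ⟨F, ?_, hF⟩
  refine measurable_to_countable' fun l => ?_
  have : F ⁻¹' {l} = U l ∪ ((⋃ l, U l)ᶜ ∩ {z | o = l}) := by
    ext z
    by_cases h : ∃ l, z ∈ U l
    · obtain ⟨l', h'⟩ := h
      constructor
      · intro hz
        left
        have : F z = l := hz
        rw [hF z l' h'] at this
        exact this ▸ h'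
      · rintro (h1 | h1)
        · exact hF z l h1
        · exact absurd (Set.mem_iUnion.2 ⟨l', h'⟩) h1.1
    · have e : F z = o := dif_neg h
      constructor
      · intro hz
        right
        exact ⟨fun hh => h (Set.mem_iUnion.1 hh), e ▸ hz⟩
      · rintro (h1 | h1)
        · exact absurd ⟨l, h1⟩ h
        · exact e.trans h1.2
  rw [this]
  exact (mU l).union ((MeasurableSet.iUnion mU).compl.inter (MeasurableSet.const _))

end B1

section D1
open Filter Topology
open scoped symmDiff ENNReal

section Kop
variable {Z : Type*} [MeasurableSpace Z] {m : Measure Z}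

/-- Koopman isometry. -/
noncomputable def Kop (f : Z → Z) (hf : MeasurePreserving f m m) : Lp ℂ 2 m →ₗᵢ[ℂ] Lp ℂ 2 m :=
  Lp.compMeasurePreservingₗᵢ ℂ f hf

theorem Kop_ae (f : Z → Z) (hf : MeasurePreserving f m m) (F : Lp ℂ 2 m) : Kop f hf F =ᵐ[m] F ∘ f :=
  Lp.coeFn_compMeasurePreserving F hf

theorem Kop_mul {f g : Z → Z} (hf : MeasurePreserving f m m) (hg : MeasurePreserving g m m) :
    Kop f hf * Kop g hg = Kop (g ∘ f) (hg.comp hf) := by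
  ext1 F
  apply Lp.ext
  show Kop f hf (Kop g hg F) =ᵐ[m] _
  refine (Kop_ae f hf _).trans ?_
  refine EventuallyEq.trans ?_ (Kop_ae _ _ F).symm
  exact hf.quasiMeasurePreserving.ae_eq_comp (Kop_ae g hg F)

theorem Kop_congr {f g : Z → Z} (hf : MeasurePreserving f m m) (hg : MeasurePreserving g m m)
    (h : f =ᵐ[m] g) : Kop f hf = Kop g hg := by
  ext1 F
  apply Lp.ext
  refine (Kop_ae f hf _).trans ?_
  refine EventuallyEq.trans ?_ (Kop_ae _ _ F).symm
  filter_upwards [h] with z hz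
  simp [hz]

theorem Kop_ind {f : Z → Z} (hf : MeasurePreserving f m m) {S : Set Z} (hS : MeasurableSet S) (hSf : m S ≠ ∞) :
    ‖Kop f hf (indicatorConstLp 2 hS hSf 1) - indicatorConstLp 2 hS hSf 1‖ ^ 2 = m.real ((f ⁻¹' S) ∆ S) := by
  have e : Kop f hf (indicatorConstLp 2 hS hSf 1) = indicatorConstLp 2 (hf.measurable hS)
      (by rwa [hf.measure_preimage hS.nullMeasurableSet]) (1 : ℂ) :=
    Lp.indicatorConstLp_compMeasurePreserving hS hSf 1 hf
  rw [e, ← dist_eq_norm, dist_indicatorConstLp_eq_norm, norm_indicatorConstLp (by norm_num) (by norm_num)]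
  simp only [norm_one, one_mul, ENNReal.toReal_ofNat]
  rw [← Real.sqrt_eq_rpow, Real.sq_sqrt measureReal_nonneg]
end Kop

variable {X Λ : Type*} [MeasurableSpace X] {μ : Measure X} [IsProbabilityMeasure μ]
  [Group Λ] [MeasurableSpace Λ] [DiscreteMeasurableSpace Λ] [Countable Λ]

/-- skew product map -/
def tl (fl : ℝ → X → X) (T : X → X) (c : X → Λ) : (X × ℝ) × Λ → (X × ℝ) × Λ :=
  fun z => ((T z.1.1, z.1.2), c z.1.1 * z.2 * (c (fl z.1.2 z.1.1))⁻¹)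

/-- measure -/
noncomputable def mz (μ : Measure X) (Λ : Type*) [MeasurableSpace Λ] : Measure ((X × ℝ) × Λ) :=
  (μ.prod volume).prod Measure.count

variable {fl : ℝ → X → X}

theorem tl_mp (hfl : Measurable (Function.uncurry fl)) {T : X → X} (hT : MeasurePreserving T μ μ)
    {c : X → Λ} (hc : Measurable c) : MeasurePreserving (tl fl T c) (mz μ Λ) (mz μ Λ) := by
  have h1 : MeasurePreserving (fun p : X × ℝ => (T p.1, p.2)) (μ.prod volume) (μ.prod volume) :=
    hT.prod (MeasurePreserving.id _)
  have hfl' : Measurable fun p : X × ℝ => fl p.2 p.1 := hfl.comp measurable_swap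
  refine MeasurePreserving.skew_product (g := fun p l => c p.1 * l * (c (fl p.2 p.1))⁻¹) h1 ?_ ?_
  · show Measurable fun z : (X × ℝ) × Λ => c z.1.1 * z.2 * (c (fl z.1.2 z.1.1))⁻¹
    have h3 : Measurable fun z : (X × ℝ) × Λ => c (fl z.1.2 z.1.1) := hc.comp (hfl'.comp measurable_fst)
    fun_prop
  · refine ae_of_all _ fun p => ?_
    have hb : Function.Bijective (fun l : Λ => c p.1 * l * (c (fl p.2 p.1))⁻¹) :=
      ((Equiv.mulLeft (c p.1)).trans (Equiv.mulRight (c (fl p.2 p.1))⁻¹)).bijective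
    let e : Λ ≃ᵐ Λ := ⟨Equiv.ofBijective _ hb, Measurable.of_discrete, Measurable.of_discrete⟩
    refine Measure.ext fun s hs => ?_
    rw [Measure.map_apply Measurable.of_discrete hs]
    rw [Measure.count_apply hs, Measure.count_apply (Set.to_countable _).measurableSet, Set.encard_preimage_of_bijective hb]

theorem tl_comp {T₁ T₂ : X → X} {c₁ c₂ : X → Λ} (h2 : ∀ s x, T₂ (fl s x) = fl s (T₂ x)) :
    tl fl T₁ c₁ ∘ tl fl T₂ c₂ = tl fl (T₁ ∘ T₂) (fun x => c₁ (T₂ x) * c₂ x) := by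
  funext z
  simp only [tl, Function.comp, h2, mul_inv_rev, mul_assoc]

theorem tl_ae (hfl : Measurable (Function.uncurry fl)) (hmp : ∀ s, MeasurePreserving (fl s) μ μ)
    {T T' : X → X} (hT : ∀ x, T x = T' x) {c c' : X → Λ} (h : c =ᵐ[μ] c') :
    tl fl T c =ᵐ[mz μ Λ] tl fl T' c' := by
  have h1 : ∀ᵐ p : X × ℝ ∂(μ.prod volume), c p.1 = c' p.1 :=
    Measure.quasiMeasurePreserving_fst.ae h
  have hq : Measure.QuasiMeasurePreserving (fun p : X × ℝ => fl p.2 p.1) (μ.prod volume) μ := by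
    exact QuasiMeasurePreserving.prod_of_left (hfl.comp measurable_swap)
      (ae_of_all _ fun s => (hmp s).quasiMeasurePreserving)
  have h2 : ∀ᵐ p : X × ℝ ∂(μ.prod volume), c (fl p.2 p.1) = c' (fl p.2 p.1) := hq.ae h
  have h3 : ∀ᵐ z : (X × ℝ) × Λ ∂(mz μ Λ), c z.1.1 = c' z.1.1 ∧ c (fl z.1.2 z.1.1) = c' (fl z.1.2 z.1.1) :=
    Measure.quasiMeasurePreserving_fst.ae (h1.and h2)
  filter_upwards [h3] with z hz
  simp only [tl, hz.1, hz.2, hT]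


/-- target set -/
def SS (X Λ : Type*) [Group Λ] (ε : ℝ) : Set ((X × ℝ) × Λ) := {z | |z.1.2| < ε ∧ z.2 = 1}

theorem mSS (ε : ℝ) : MeasurableSet (SS X Λ ε) := by
  have h1 : MeasurableSet {z : (X × ℝ) × Λ | |z.1.2| < ε} := measurableSet_lt (by fun_prop) measurable_const
  exact h1.inter (measurable_snd (measurableSet_singleton (1 : Λ)))

theorem SS_fin (ε : ℝ) : mz μ Λ (SS X Λ ε) ≠ ∞ := by
  have : SS X Λ ε = (Set.univ ×ˢ {s : ℝ | |s| < ε}) ×ˢ {1} := by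
    ext z; simp [SS]
  have e : {s : ℝ | |s| < ε} = Set.Ioo (-ε) ε := by ext s; simp [abs_lt]
  rw [this, mz, Measure.prod_prod, Measure.prod_prod, e, Real.volume_Ioo]
  simp

theorem tl_est (hfl : Measurable (Function.uncurry fl)) {T : X → X} 
    {c : X → Λ} (hc : Measurable c) {ε η : ℝ} (hε : 0 ≤ ε) (hη : 0 ≤ η)
    (h : ∀ s, |s| < ε → μ {x | c (fl s x) ≠ c x} ≤ ENNReal.ofReal η) :
    (mz μ Λ).real ((tl fl T c ⁻¹' (SS X Λ ε)) ∆ (SS X Λ ε)) ≤ 4 * ε * η := by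
  classical
  have hfl' : Measurable fun p : X × ℝ => fl p.2 p.1 := hfl.comp measurable_swap
  let D : Set (X × ℝ) := {p | |p.2| < ε ∧ c (fl p.2 p.1) ≠ c p.1}
  have mD : MeasurableSet D := by
    have h1 : MeasurableSet {z : X × ℝ | |z.2| < ε} := measurableSet_lt (by fun_prop) measurable_const
    exact h1.inter (measurableSet_eq_fun (hc.comp hfl') (hc.comp measurable_fst)).compl
  have b1 : (μ.prod volume) D ≤ ENNReal.ofReal (2 * ε * η) := by
    rw [Measure.prod_apply_symm mD]
    have : ∀ s : ℝ, μ ((fun x => (x, s)) ⁻¹' D) ≤ (Set.Ioo (-ε) ε).indicator (fun _ => ENNReal.ofReal η) s := by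
      intro s
      by_cases hs : |s| < ε
      · rw [Set.indicator_of_mem (show s ∈ Set.Ioo (-ε) ε from abs_lt.1 hs)]
        exact (measure_mono fun x hx => hx.2).trans (h s hs)
      · have : ((fun x => (x, s)) ⁻¹' D) = ∅ := by
          ext x; simp [D, hs]
        rw [this]; simp
    refine (lintegral_mono this).trans ?_
    rw [lintegral_indicator_const measurableSet_Ioo, Real.volume_Ioo, ← ENNReal.ofReal_mul hη]
    refine ENNReal.ofReal_le_ofReal (by linarith)
  let g : (X × ℝ) → Λ := fun p => (c p.1)⁻¹ * c (fl p.2 p.1)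
  have mg : Measurable g := by
    have := hc.comp hfl'
    have h2 : Measurable fun p : X × ℝ => c p.1 := hc.comp measurable_fst
    exact (h2.inv).mul this
  have sub : (tl fl T c ⁻¹' (SS X Λ ε)) ∆ (SS X Λ ε) ⊆
      (Prod.fst ⁻¹' D ∩ {z | z.2 = 1}) ∪ (Prod.fst ⁻¹' D ∩ {z | z.2 = g z.1}) := by
    have key : ∀ z : (X × ℝ) × Λ, c z.1.1 * z.2 * (c (fl z.1.2 z.1.1))⁻¹ = 1 ↔ z.2 = g z.1 := by
      intro z
      simp only [g]
      rw [mul_inv_eq_one, eq_inv_mul_iff_mul_eq]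
    rintro z (⟨h1, h2⟩ | ⟨h1, h2⟩)
    · have e1 : |z.1.2| < ε := h1.1
      have e2 : z.2 = g z.1 := (key z).1 h1.2
      refine Or.inr ⟨⟨e1, fun h => h2 ⟨e1, ?_⟩⟩, e2⟩
      rw [e2]; simp only [g, h, inv_mul_cancel]
    · have e1 : |z.1.2| < ε := h1.1
      have e2 : z.2 = 1 := h1.2
      refine Or.inl ⟨⟨e1, fun h => h2 ⟨e1, (key z).2 ?_⟩⟩, e2⟩
      rw [e2]; simp only [g, h, inv_mul_cancel]
  have graph : ∀ g : (X × ℝ) → Λ, Measurable g →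
      mz μ Λ (Prod.fst ⁻¹' D ∩ {z | z.2 = g z.1}) ≤ ENNReal.ofReal (2 * ε * η) := by
    intro g mg
    have mS : MeasurableSet (Prod.fst ⁻¹' D ∩ {z : (X × ℝ) × Λ | z.2 = g z.1}) :=
      (measurable_fst mD).inter (measurableSet_eq_fun measurable_snd (mg.comp measurable_fst))
    rw [mz, Measure.prod_apply mS]
    refine le_trans ?_ b1
    rw [← lintegral_indicator_one mD]
    refine lintegral_mono fun p => ?_
    by_cases hp : p ∈ D
    · rw [Set.indicator_of_mem hp]
      refine (measure_mono (t := {g p}) ?_).trans ?_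
      · intro l hl; exact hl.2
      · simp
    · have : Prod.mk p ⁻¹' (Prod.fst ⁻¹' D ∩ {z : (X × ℝ) × Λ | z.2 = g z.1}) = ∅ := by
        ext l; simp [hp]
      rw [this]; simp
  have tot : mz μ Λ ((tl fl T c ⁻¹' (SS X Λ ε)) ∆ (SS X Λ ε)) ≤ ENNReal.ofReal (4 * ε * η) := by
    refine (measure_mono sub).trans ((measure_union_le _ _).trans ?_)
    refine (add_le_add (graph (fun _ => 1) measurable_const) (graph g mg)).trans ?_
    rw [← ENNReal.ofReal_add (by positivity) (by positivity)]
    exact ENNReal.ofReal_le_ofReal (by linarith)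
  exact ENNReal.toReal_le_of_le_ofReal (by positivity) tot

end D1

section D2
open Filter Topology
open scoped symmDiff ENNReal

theorem avg_lemma {Z : Type*} [MeasurableSpace Z] {m : Measure Z} {f : Z → Z} (hf : MeasurePreserving f m m)
    (ξ : Lp ℂ 2 m) : ∃ M : Lp ℂ 2 m, (M ∘ f =ᵐ[m] M) ∧ ∀ V : Set Z, MeasurableSet V → (∀ z, f z ∈ V ↔ z ∈ V) →
      ∀ ξ' : Lp ℂ 2 m, (∀ᵐ z ∂m, z ∈ V → ξ' z = ξ z) → ∀ e : ℝ, (∀ k : ℕ, ‖(Kop f hf ^ k) ξ' - ξ'‖ ^ 2 ≤ e) →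
      m {z | z ∈ V ∧ 1/2 ≤ ‖M z - ξ z‖} ≤ ENNReal.ofReal (4 * e) := by
  let K : Lp ℂ 2 m →L[ℂ] Lp ℂ 2 m := (Kop f hf).toContinuousLinearMap
  have hK1 : ‖K‖ ≤ 1 := (Kop f hf).norm_toContinuousLinearMap_le
  have hlim := K.tendsto_birkhoffAverage_orthogonalProjection hK1 ξ
  let M0 := (K.eqLocus (1 : Lp ℂ 2 m →L[ℂ] Lp ℂ 2 m)).orthogonalProjectionOnto ξ
  let M : Lp ℂ 2 m := M0
  have hM : Kop f hf M = M := M0.2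
  refine ⟨M, ?_, ?_⟩
  · have := Kop_ae f hf M
    rw [hM] at this
    exact this.symm
  intro V mV hV ξ' hξ e he
  let R := LpToLpRestrictCLM Z ℂ ℂ m 2 V
  have inv : ∀ k : ℕ, ∀ F : Lp ℂ 2 m, (∀ᵐ z ∂m, z ∈ V → F z = 0) → ∀ᵐ z ∂m, z ∈ V → (Kop f hf ^ k) F z = 0 := by
    intro k F hF
    induction k with
    | zero => simpa using hF
    | succ k ih =>
      rw [pow_succ']
      show ∀ᵐ z ∂m, z ∈ V → (Kop f hf ((Kop f hf ^ k) F)) z = 0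
      filter_upwards [Kop_ae f hf ((Kop f hf ^ k) F), hf.quasiMeasurePreserving.ae ih] with z h1 h2 hz
      rw [h1]
      exact h2 ((hV z).2 hz)
  have R0 : ∀ F : Lp ℂ 2 m, (∀ᵐ z ∂m, z ∈ V → F z = 0) → R F = 0 := by
    intro F hF
    apply Lp.ext
    filter_upwards [LpToLpRestrictCLM_coeFn (p := 2) ℂ V F, (ae_restrict_iff' mV).2 hF, Lp.coeFn_zero ℂ 2 (m.restrict V)] with z h1 h2 h3
    rw [h1, h2, h3]; rfl
  have hd : ∀ᵐ z ∂m, z ∈ V → (ξ' - ξ : Lp ℂ 2 m) z = 0 := by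
    filter_upwards [hξ, Lp.coeFn_sub ξ' ξ] with z h1 h2 hz
    rw [h2]; simp [h1 hz]
  have Req : ∀ k : ℕ, R ((Kop f hf ^ k) ξ) = R ((Kop f hf ^ k) ξ') := by
    intro k
    have := R0 _ (inv k _ hd)
    rw [map_sub, map_sub, sub_eq_zero] at this
    exact this.symm
  have Rle : ∀ F, ‖R F‖ ≤ ‖F‖ := by
    intro F
    exact norm_Lp_toLp_restrict_le V F
  have e0 : 0 ≤ e := (sq_nonneg _).trans (he 0)
  have b1 : ∀ k : ℕ, ‖R ((Kop f hf ^ k) ξ) - R ξ‖ ≤ Real.sqrt e := by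
    intro k
    have h0 := Req 0
    simp only [pow_zero] at h0
    have h0' : R ξ = R ξ' := h0
    rw [Req k, h0', ← map_sub]
    exact (Rle _).trans (Real.le_sqrt_of_sq_le (he k))
  have itr : ∀ k : ℕ, (K^[k]) ξ = (Kop f hf ^ k) ξ := by
    intro k
    induction k with
    | zero => rfl
    | succ k ih =>
      rw [Function.iterate_succ_apply', ih, pow_succ']; rfl
  have b2 : ∀ N : ℕ, N ≠ 0 → ‖R (birkhoffAverage ℂ K _root_.id N ξ) - R ξ‖ ≤ Real.sqrt e := by
    intro N hN
    have hN' : (N : ℂ) ≠ 0 := by exact_mod_cast hN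
    have : R (birkhoffAverage ℂ K _root_.id N ξ) - R ξ =
        (N : ℂ)⁻¹ • ∑ k ∈ Finset.range N, (R ((Kop f hf ^ k) ξ) - R ξ) := by
      rw [birkhoffAverage, birkhoffSum, map_smul, map_sum, Finset.sum_sub_distrib, smul_sub]
      simp only [id, itr, Finset.sum_const, Finset.card_range]
      congr 1
      rw [← Nat.cast_smul_eq_nsmul ℂ, smul_smul, inv_mul_cancel₀ hN', one_smul]
    rw [this, norm_smul, norm_inv, Complex.norm_natCast, inv_mul_le_iff₀ (by positivity)]
    refine (norm_sum_le _ _).trans ((Finset.sum_le_sum fun k _ => b1 k).trans ?_)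
    simp
  have b3 : ‖R M - R ξ‖ ≤ Real.sqrt e := by
    have h1 : Tendsto (fun N => ‖R (birkhoffAverage ℂ K _root_.id N ξ) - R ξ‖) atTop (𝓝 ‖R M - R ξ‖) :=
      (((R.continuous.tendsto M).comp hlim).sub_const (R ξ)).norm
    exact le_of_tendsto h1 ((eventually_ne_atTop 0).mono b2)
  rw [← map_sub] at b3
  have ch := mul_meas_ge_le_pow_eLpNorm' (m.restrict V) (p := 2) (by norm_num) (by norm_num)
    (Lp.aestronglyMeasurable (R (M - ξ))) (ENNReal.ofReal (1/2))
  have nb : eLpNorm (R (M - ξ)) 2 (m.restrict V) ≤ ENNReal.ofReal (Real.sqrt e) := by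
    rw [Lp.norm_def] at b3
    exact (ENNReal.le_ofReal_iff_toReal_le (Lp.eLpNorm_ne_top _) (Real.sqrt_nonneg _)).2 b3
  have ms : m {z | z ∈ V ∧ 1/2 ≤ ‖M z - ξ z‖} ≤ (m.restrict V) {z | ENNReal.ofReal (1/2) ≤ ‖R (M - ξ) z‖ₑ} := by
    have : m {z | z ∈ V ∧ 1/2 ≤ ‖M z - ξ z‖} = (m.restrict V) {z | 1/2 ≤ ‖M z - ξ z‖} := by
      rw [Measure.restrict_apply' mV, Set.inter_comm]; rfl
    rw [this]
    refine measure_mono_ae ?_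
    filter_upwards [LpToLpRestrictCLM_coeFn (p := 2) ℂ V (M - ξ), ae_restrict_of_ae (Lp.coeFn_sub M ξ)] with z h1 h2 hz
    show ENNReal.ofReal (1/2) ≤ ‖R (M - ξ) z‖ₑ
    rw [h1, h2, ← ofReal_norm_eq_enorm]
    exact ENNReal.ofReal_le_ofReal hz
  refine ms.trans ?_
  set Q := (m.restrict V) {z | ENNReal.ofReal (1/2) ≤ ‖R (M - ξ) z‖ₑ}
  simp only [ENNReal.toReal_ofNat, ENNReal.rpow_ofNat] at ch
  have ch2 : ENNReal.ofReal (1/4) * Q ≤ ENNReal.ofReal e := by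
    have l : ENNReal.ofReal (1/2) ^ 2 = ENNReal.ofReal (1/4) := by
      rw [← ENNReal.ofReal_pow (by norm_num)]; norm_num
    rw [l] at ch
    refine ch.trans ((pow_le_pow_left₀ zero_le nb 2).trans ?_)
    rw [← ENNReal.ofReal_pow (Real.sqrt_nonneg _), Real.sq_sqrt e0]
  calc Q = ENNReal.ofReal 4 * (ENNReal.ofReal (1/4) * Q) := by
        rw [← mul_assoc, ← ENNReal.ofReal_mul (by norm_num)]; norm_num
    _ ≤ ENNReal.ofReal 4 * ENNReal.ofReal e := by gcongr
    _ = _ := by rw [← ENNReal.ofReal_mul (by norm_num)]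

end D2

section D3
open Filter Topology
open scoped symmDiff ENNReal

variable {X Λ : Type*} [MeasurableSpace X] {μ : Measure X} [IsProbabilityMeasure μ]
  [Group Λ] [MeasurableSpace Λ] [DiscreteMeasurableSpace Λ] [Countable Λ]

theorem proj_count {Z : Type*} [MeasurableSpace Z] {m : Measure Z} [SFinite m] {P : Set (Z × Λ)} (hP : MeasurableSet P) :
    m {p | ∃ l, (p, l) ∈ P} ≤ (m.prod Measure.count) P := by
  have e : {p | ∃ l, (p, l) ∈ P} = ⋃ l, {p | (p, l) ∈ P} := by ext p; simp
  have mB : MeasurableSet {p | ∃ l, (p, l) ∈ P} := by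
    rw [e]
    exact MeasurableSet.iUnion fun l => measurable_prodMk_right hP
  rw [Measure.prod_apply hP, ← lintegral_indicator_one mB]
  refine lintegral_mono fun p => ?_
  by_cases h : ∃ l, (p, l) ∈ P
  · obtain ⟨l, hl⟩ := h
    rw [Set.indicator_of_mem (show p ∈ {p | ∃ l, (p, l) ∈ P} from ⟨l, hl⟩)]
    calc (1 : ℝ≥0∞) = Measure.count ({l} : Set Λ) := by rw [Measure.count_singleton]
      _ ≤ _ := measure_mono (by rintro _ rfl; exact hl)
  · rw [Set.indicator_of_notMem (show p ∉ {p | ∃ l, (p, l) ∈ P} from h)]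
    exact zero_le

theorem thmD {fl : ℝ → X → X} (hfl : Measurable (Function.uncurry fl)) (hmp : ∀ s, MeasurePreserving (fl s) μ μ)
    (hcont : ∀ u : X → Λ, Measurable u → Tendsto (fun s => μ {x | u (fl s x) ≠ u x}) (𝓝 0) (𝓝 0))
    {a b u w : X → X} (ha : MeasurePreserving a μ μ) (hb : MeasurePreserving b μ μ)
    (hu : MeasurePreserving u μ μ) (hw : MeasurePreserving w μ μ)
    (fa : ∀ s x, a (fl s x) = fl s (a x)) (fb : ∀ s x, b (fl s x) = fl s (b x))
    (fu : ∀ s x, u (fl s x) = fl s (u x)) (fw : ∀ s x, w (fl s x) = fl s (w x))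
    {ca cb cu cw : X → Λ} (mca : Measurable ca) (mcb : Measurable cb) (mcu : Measurable cu) (mcw : Measurable cw)
    (rab : ∀ x, b (a x) = a (b x)) (cab : ∀ᵐ x ∂μ, cb (a x) * ca x = ca (b x) * cb x)
    (rua : ∀ x, u (a x) = b (a (u x))) (cua : ∀ᵐ x ∂μ, cu (a x) * ca x = cb (a (u x)) * ca (u x) * cu x)
    (rub : ∀ x, u (b x) = b (u x)) (cub : ∀ᵐ x ∂μ, cu (b x) * cb x = cb (u x) * cu x)
    (rwb : ∀ x, w (b x) = b (a (w x))) (cwb : ∀ᵐ x ∂μ, cw (b x) * cb x = cb (a (w x)) * ca (w x) * cw x)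
    (rwa : ∀ x, w (a x) = a (w x)) (cwa : ∀ᵐ x ∂μ, cw (a x) * ca x = ca (w x) * cw x) :
    ∃ (Φ : X × ℝ → Λ) (W : Set (X × ℝ)), Measurable Φ ∧ MeasurableSet W ∧
      (∀ᵐ p ∂μ.prod volume, (((a p.1, p.2) : X × ℝ) ∈ W ↔ p ∈ W) ∧
        (p ∈ W → Φ (a p.1, p.2) = ca p.1 * Φ p * (ca (fl p.2 p.1))⁻¹)) ∧
      ∀ κ : ℝ, 0 < κ → ∃ ε₀ : ℝ, 0 < ε₀ ∧ ∀ ε : ℝ, 0 < ε → ε < ε₀ →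
        (μ.prod volume) {p | |p.2| < ε ∧ ¬ (p ∈ W ∧ Φ p = 1)} ≤ ENNReal.ofReal (κ * ε) := by
  have hA := tl_mp (μ := μ) hfl ha mca
  have hB := tl_mp (μ := μ) hfl hb mcb
  have hU := tl_mp (μ := μ) hfl hu mcu
  have hW := tl_mp (μ := μ) hfl hw mcw
  have R1 : Kop _ hA * Kop _ hB = Kop _ hB * Kop _ hA := by
    rw [Kop_mul, Kop_mul]
    apply Kop_congr
    rw [tl_comp fa, tl_comp fb]
    exact tl_ae hfl hmp rab cab
  have R2 : Kop _ hA * Kop _ hU = Kop _ hU * (Kop _ hA * Kop _ hB) := by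
    rw [Kop_mul, Kop_mul, Kop_mul]
    apply Kop_congr
    rw [tl_comp fa, tl_comp fa, tl_comp fu]
    exact tl_ae hfl hmp rua cua
  have R3 : Kop _ hB * Kop _ hU = Kop _ hU * Kop _ hB := by
    rw [Kop_mul, Kop_mul]
    apply Kop_congr
    rw [tl_comp fb, tl_comp fu]
    exact tl_ae hfl hmp rub cub
  have R4 : Kop _ hB * Kop _ hW = Kop _ hW * (Kop _ hA * Kop _ hB) := by
    rw [Kop_mul, Kop_mul, Kop_mul]
    apply Kop_congr
    rw [tl_comp fb, tl_comp fa, tl_comp fw]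
    exact tl_ae hfl hmp rwb cwb
  have R5 : Kop _ hA * Kop _ hW = Kop _ hW * Kop _ hA := by
    rw [Kop_mul, Kop_mul]
    apply Kop_congr
    rw [tl_comp fa, tl_comp fw]
    exact tl_ae hfl hmp rwa cwa
  let ξ : ℝ → Lp ℂ 2 (mz μ Λ) := fun ε => indicatorConstLp 2 (mSS ε) (SS_fin (μ := μ) (Λ := Λ) ε) 1
  obtain ⟨M, hM, hM2⟩ := avg_lemma hA (ξ 1)
  have est : ∀ κ : ℝ, 0 < κ → ∃ ε₀ : ℝ, 0 < ε₀ ∧ ∀ ε : ℝ, 0 < ε → ε < ε₀ →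
      (mz μ Λ) {z | |z.1.2| < ε ∧ 1/2 ≤ ‖M z - ξ 1 z‖} ≤ ENNReal.ofReal (κ * ε) := by
    intro κ hκ
    let η := κ / 1984
    have hη : 0 < η := by positivity
    have hη' : 0 < ENNReal.ofReal η := ENNReal.ofReal_pos.2 hη
    have ev := (((hcont ca mca).eventually (ge_mem_nhds hη')).and ((hcont cb mcb).eventually (ge_mem_nhds hη'))).and
      (((hcont cu mcu).eventually (ge_mem_nhds hη')).and ((hcont cw mcw).eventually (ge_mem_nhds hη')))
    obtain ⟨δ, hδ, hb⟩ := Metric.eventually_nhds_iff.1 ev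
    refine ⟨min δ 1, by positivity, fun ε h0 h1 => ?_⟩
    have hεδ : ε < δ := h1.trans_le (min_le_left _ _)
    have hε1 : ε < 1 := h1.trans_le (min_le_right _ _)
    have hb' : ∀ s : ℝ, |s| < ε → _ := fun s hs => hb (y := s) (by rw [Real.dist_eq, sub_zero]; exact hs.trans hεδ)
    have eA := (Kop_ind hA (mSS ε) (SS_fin (μ := μ) (Λ := Λ) ε)).le.trans
      (tl_est hfl (T := a) mca h0.le hη.le fun s hs => (hb' s hs).1.1)
    have eB := (Kop_ind hB (mSS ε) (SS_fin (μ := μ) (Λ := Λ) ε)).le.trans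
      (tl_est hfl (T := b) mcb h0.le hη.le fun s hs => (hb' s hs).1.2)
    have eU := (Kop_ind hU (mSS ε) (SS_fin (μ := μ) (Λ := Λ) ε)).le.trans
      (tl_est hfl (T := u) mcu h0.le hη.le fun s hs => (hb' s hs).2.1)
    have eW := (Kop_ind hW (mSS ε) (SS_fin (μ := μ) (Λ := Λ) ε)).le.trans
      (tl_est hfl (T := w) mcw h0.le hη.le fun s hs => (hb' s hs).2.2)
    have rel := relT R1 R2 R3 R4 R5 eA eB eU eW
    have := hM2 {z | |z.1.2| < ε} (measurableSet_lt (by fun_prop) measurable_const) (fun z => Iff.rfl) (ξ ε) ?_ _ rel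
    · refine this.trans (ENNReal.ofReal_le_ofReal ?_)
      simp only [η]
      apply le_of_eq
      ring
    · filter_upwards [indicatorConstLp_coeFn (p := 2) (hs := mSS ε) (hμs := SS_fin (μ := μ) (Λ := Λ) ε) (c := (1 : ℂ)),
        indicatorConstLp_coeFn (p := 2) (hs := mSS 1) (hμs := SS_fin (μ := μ) (Λ := Λ) 1) (c := (1 : ℂ))] with z h1 h2 hz
      show ξ ε z = ξ 1 z
      rw [h1, h2]
      have hz : |z.1.2| < ε := hz
      by_cases hl : z.2 = 1
      · rw [Set.indicator_of_mem (show z ∈ SS X Λ ε from ⟨hz, hl⟩), Set.indicator_of_mem (show z ∈ SS X Λ 1 from ⟨hz.trans hε1, hl⟩)]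
      · rw [Set.indicator_of_notMem (fun h : z ∈ SS X Λ ε => hl h.2), Set.indicator_of_notMem (fun h : z ∈ SS X Λ 1 => hl h.2)]
  have mM : Measurable M := (Lp.stronglyMeasurable M).measurable
  let Bs : Λ → Set (X × ℝ) := fun l => {p | ‖M (p, l) - 1‖ < 1/2}
  have mBs : ∀ l, MeasurableSet (Bs l) := fun l => measurableSet_lt (by fun_prop) measurable_const
  obtain ⟨Φ, mΦ, hΦ⟩ := H1 Bs mBs
  let U : Λ → Set (X × ℝ) := fun l => {z | ∀ l', z ∈ Bs l' ↔ l' = l}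
  have mU : ∀ l, MeasurableSet (U l) := by
    intro l
    have : U l = ⋂ l', {z | z ∈ Bs l' ↔ l' = l} := by ext z; simp [U]
    rw [this]
    refine MeasurableSet.iInter fun l' => ?_
    by_cases h : l' = l
    · simp only [h, iff_true]; exact mBs l
    · simp only [h, iff_false]; exact (mBs l').compl
  refine ⟨Φ, ⋃ l, U l, mΦ, MeasurableSet.iUnion mU, ?_, ?_⟩
  · have h1 : ∀ᵐ p ∂μ.prod volume, ∀ᵐ l ∂(Measure.count : Measure Λ), (M ∘ tl fl a ca) (p, l) = M (p, l) :=
      Measure.ae_ae_of_ae_prod hM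
    filter_upwards [h1] with p hp
    have hp' : ∀ l, M ((a p.1, p.2), ca p.1 * l * (ca (fl p.2 p.1))⁻¹) = M (p, l) := by
      rw [Measure.ae_count_iff] at hp
      exact hp
    have key : ∀ l, p ∈ U l → ((a p.1, p.2) : X × ℝ) ∈ U (ca p.1 * l * (ca (fl p.2 p.1))⁻¹) := by
      intro l hl l'
      have e : l' = ca p.1 * ((ca p.1)⁻¹ * l' * ca (fl p.2 p.1)) * (ca (fl p.2 p.1))⁻¹ := by group
      have h2 : ((a p.1, p.2) : X × ℝ) ∈ Bs l' ↔ p ∈ Bs ((ca p.1)⁻¹ * l' * ca (fl p.2 p.1)) := by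
        show ‖M ((a p.1, p.2), l') - 1‖ < 1/2 ↔ ‖M (p, _) - 1‖ < 1/2
        rw [← hp', ← e]
      rw [h2, hl]
      constructor
      · intro h; rw [← h]; exact e
      · intro h; rw [h]; group
    have key2 : ∀ l, ((a p.1, p.2) : X × ℝ) ∈ U l → p ∈ U ((ca p.1)⁻¹ * l * ca (fl p.2 p.1)) := by
      intro l hl l'
      have h2 : p ∈ Bs l' ↔ ((a p.1, p.2) : X × ℝ) ∈ Bs (ca p.1 * l' * (ca (fl p.2 p.1))⁻¹) := by
        show ‖M (p, _) - 1‖ < 1/2 ↔ ‖M ((a p.1, p.2), _) - 1‖ < 1/2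
        rw [hp']
      rw [h2, hl]
      constructor
      · intro h; rw [← h]; group
      · intro h; rw [h]; group
    refine ⟨⟨fun h => ?_, fun h => ?_⟩, fun h => ?_⟩
    · obtain ⟨l, hl⟩ := Set.mem_iUnion.1 h
      exact Set.mem_iUnion.2 ⟨_, key2 l hl⟩
    · obtain ⟨l, hl⟩ := Set.mem_iUnion.1 h
      exact Set.mem_iUnion.2 ⟨_, key l hl⟩
    · obtain ⟨l, hl⟩ := Set.mem_iUnion.1 h
      rw [hΦ p l hl, hΦ _ _ (key l hl)]
  · intro κ hκ
    obtain ⟨ε₀, h0, h⟩ := est κ hκ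
    refine ⟨min ε₀ 1, by positivity, fun ε he hlt => le_trans ?_ (h ε he (hlt.trans_le (min_le_left _ _)))⟩
    have hε1 : ε < 1 := hlt.trans_le (min_le_right _ _)
    let ξ1 : (X × ℝ) × Λ → ℂ := (SS X Λ 1).indicator fun _ => 1
    have mξ1 : Measurable ξ1 := measurable_const.indicator (mSS 1)
    have hae : ∀ᵐ z ∂(mz μ Λ), ξ 1 z = ξ1 z := indicatorConstLp_coeFn
    have mP : MeasurableSet {z : (X × ℝ) × Λ | |z.1.2| < ε ∧ 1/2 ≤ ‖M z - ξ1 z‖} := by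
      have p1 : MeasurableSet {z : (X × ℝ) × Λ | |z.1.2| < ε} := measurableSet_lt (by fun_prop) measurable_const
      have p2 : MeasurableSet {z : (X × ℝ) × Λ | 1/2 ≤ ‖M z - ξ1 z‖} := measurableSet_le measurable_const (by fun_prop)
      exact p1.inter p2
    have e1 : mz μ Λ {z | |z.1.2| < ε ∧ 1/2 ≤ ‖M z - ξ1 z‖} = mz μ Λ {z | |z.1.2| < ε ∧ 1/2 ≤ ‖M z - ξ 1 z‖} := by
      apply measure_congr
      filter_upwards [hae] with z hz
      apply propext
      show (|z.1.2| < ε ∧ 1/2 ≤ ‖M z - ξ1 z‖) ↔ (|z.1.2| < ε ∧ 1/2 ≤ ‖M z - ξ 1 z‖)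
      rw [hz]
    rw [← e1]
    refine le_trans (measure_mono ?_) (proj_count mP)
    rintro p ⟨hp1, hp2⟩
    by_contra hcon
    have hall : ∀ l, ‖M (p, l) - ξ1 (p, l)‖ < 1/2 := by
      intro l
      by_contra hl
      exact hcon ⟨l, hp1, not_lt.1 hl⟩
    have i1 : ξ1 (p, 1) = 1 := Set.indicator_of_mem (show (p, (1 : Λ)) ∈ SS X Λ 1 from ⟨hp1.trans hε1, rfl⟩) _
    have i2 : ∀ l, l ≠ 1 → ξ1 (p, l) = 0 := fun l hl =>
      Set.indicator_of_notMem (fun h : (p, l) ∈ SS X Λ 1 => hl h.2) _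
    have hU1 : p ∈ U 1 := by
      intro l
      constructor
      · intro hl
        by_contra hne
        have a1 := hall l
        rw [i2 l hne, sub_zero] at a1
        have a2 : ‖M (p, l) - 1‖ < 1/2 := hl
        have : ‖(1 : ℂ)‖ ≤ ‖M (p, l)‖ + ‖M (p, l) - 1‖ := by
          have := norm_sub_le (M (p, l)) (M (p, l) - 1)
          simpa using this
        rw [norm_one] at this
        linarith
      · rintro rfl
        have := hall 1
        rw [i1] at this
        exact this
    exact hp2 ⟨Set.mem_iUnion.2 ⟨1, hU1⟩, hΦ p 1 hU1⟩

end D3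

section C1
open Filter Topology
open scoped ENNReal

variable {Λ : Type*} [Group Λ] [MeasurableSpace Λ] [DiscreteMeasurableSpace Λ] [Countable Λ]

/-- intertwiner condition -/
def Intw (ρ : UnitAddCircle) (c : UnitAddCircle → Λ) (s : ℝ) (θ : UnitAddCircle → Λ) : Prop :=
  Measurable θ ∧ ∀ᵐ t, θ (t + ρ) = c t * θ t * (c (t + (s : UnitAddCircle)))⁻¹

variable {ρ : UnitAddCircle} {c : UnitAddCircle → Λ}

theorem ae_tr (s : UnitAddCircle) {p : UnitAddCircle → Prop} (h : ∀ᵐ t, p t) : ∀ᵐ t, p (t + s) :=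
  (measurePreserving_add_right volume s).quasiMeasurePreserving.ae h

theorem erg_set (hρ : addOrderOf ρ = 0) {S : Set UnitAddCircle} (mS : MeasurableSet S)
    (hS : ∀ᵐ t, t + ρ ∈ S ↔ t ∈ S) (h0 : volume S ≠ 0) : ∀ᵐ t, t ∈ S := by
  have he : Ergodic (· + ρ) (volume : Measure UnitAddCircle) := AddCircle.ergodic_add_right.2 hρ
  rcases he.quasiErgodic.ae_empty_or_univ₀ mS.nullMeasurableSet (by
    filter_upwards [hS] with t ht
    exact propext ht) with h | h
  · exact absurd (by rw [measure_congr h]; simp) h0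
  · filter_upwards [h] with t ht
    have : S t = True := by rw [show S t = _ from ht]; rfl
    exact of_eq_true this

theorem Intw.unique (hρ : addOrderOf ρ = 0) {s : ℝ} {θ θ' : UnitAddCircle → Λ}
    (h : Intw ρ c s θ) (h' : Intw ρ c s θ') (h0 : volume {t | θ t = θ' t} ≠ 0) : ∀ᵐ t, θ t = θ' t := by
  refine erg_set hρ (S := {t | θ t = θ' t}) (measurableSet_eq_fun h.1 h'.1) ?_ h0
  filter_upwards [h.2, h'.2] with t h1 h2
  show θ (t + ρ) = θ' (t + ρ) ↔ θ t = θ' t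
  rw [h1, h2]
  simp

theorem Intw.mul {s s' : ℝ} {θ θ' : UnitAddCircle → Λ}
    (h : Intw ρ c s θ) (h' : Intw ρ c s' θ') : Intw ρ c (s + s') (fun t => θ t * θ' (t + (s : UnitAddCircle))) := by
  refine ⟨h.1.mul (h'.1.comp (measurable_id.add_const _)), ?_⟩
  filter_upwards [h.2, ae_tr (s : UnitAddCircle) h'.2] with t h1 h2
  rw [h1, show t + ρ + (s : UnitAddCircle) = t + s + ρ by abel, h2, AddCircle.coe_add, ← add_assoc]
  group

theorem Intw.congr {s : ℝ} {θ θ' : UnitAddCircle → Λ} (h : Intw ρ c s θ) (m : Measurable θ')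
    (e : ∀ᵐ t, θ' t = θ t) : Intw ρ c s θ' := by
  refine ⟨m, ?_⟩
  filter_upwards [h.2, e, ae_tr ρ e] with t h1 h2 h3
  rw [h2, h3, h1]

/-- good local cocycle -/
def Good (ρ : UnitAddCircle) (c : UnitAddCircle → Λ) (ε : ℝ) (F : UnitAddCircle → ℝ → Λ) : Prop :=
  (∀ s, |s| < ε → Intw ρ c s (fun t => F t s)) ∧
  ∀ s s', |s| < ε → |s'| < ε → |s + s'| < ε →
    ∀ᵐ t, F t s * F (t + (s : UnitAddCircle)) s' = F t (s + s')

/-- doubling -/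
noncomputable def Dbl (F : UnitAddCircle → ℝ → Λ) : UnitAddCircle → ℝ → Λ :=
  fun t s => F t (s/2) * F (t + ((s/2 : ℝ) : UnitAddCircle)) (s/2)

theorem Good.dbl {ε : ℝ} {F : UnitAddCircle → ℝ → Λ} (h : Good ρ c ε F) :
    Good ρ c (2*ε) (Dbl F) ∧ ∀ s, |s| < ε → ∀ᵐ t, Dbl F t s = F t s := by
  refine ⟨⟨fun s hs => ?_, fun s s' hs hs' hss => ?_⟩, fun s hs => ?_⟩
  · have hs2 : |s/2| < ε := by rw [abs_div, abs_two]; linarith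
    have := (h.1 _ hs2).mul (h.1 _ hs2)
    rw [add_halves] at this
    exact this
  · have hs2 : |s/2| < ε := by rw [abs_div, abs_two]; linarith
    have hs2' : |s'/2| < ε := by rw [abs_div, abs_two]; linarith
    have hss2 : |s/2 + s'/2| < ε := by rw [← add_div, abs_div, abs_two]; linarith
    have hss2' : |s'/2 + s/2| < ε := by rwa [add_comm]
    have e1 := h.2 _ _ hs2 hs2' hss2
    have e2 := h.2 _ _ hs2' hs2 hss2'
    filter_upwards [e1, ae_tr ((s/2 : ℝ) : UnitAddCircle) e1, ae_tr ((s/2 : ℝ) : UnitAddCircle) e2,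
      ae_tr (((s/2 + s'/2 : ℝ)) : UnitAddCircle) e1] with t a1 a2 a3 a4
    simp only [Dbl]
    have i1 : t + (s : UnitAddCircle) = t + ((s/2 : ℝ) : UnitAddCircle) + ((s/2 : ℝ) : UnitAddCircle) := by
      rw [add_assoc, ← AddCircle.coe_add, add_halves]
    rw [i1]
    have i2 : (s + s')/2 = s/2 + s'/2 := by ring
    rw [i2]
    simp only [AddCircle.coe_add] at a4 ⊢
    rw [← a1]
    rw [← add_assoc] at a4 ⊢
    rw [← a4]
    rw [add_comm (s'/2)] at a3
    have a5 := a2.trans a3.symm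
    have i3 : t + ((s/2 : ℝ) : UnitAddCircle) + ((s'/2 : ℝ) : UnitAddCircle) + ((s/2 : ℝ) : UnitAddCircle)
      = t + ((s/2 : ℝ) : UnitAddCircle) + ((s/2 : ℝ) : UnitAddCircle) + ((s'/2 : ℝ) : UnitAddCircle) := by abel
    rw [i3]
    simp only [mul_assoc] at a5 ⊢
    rw [← mul_assoc (F (t + _) (s/2)), a5, mul_assoc]
  · have hs2 : |s/2| < ε := by rw [abs_div, abs_two]; linarith [abs_nonneg s]
    have := h.2 _ _ hs2 hs2 (by rwa [add_halves])
    rw [add_halves] at this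
    exact this

theorem Good.lim {ε : ℝ} (hε : 0 < ε) {F Fi : UnitAddCircle → ℝ → Λ} (h : Good ρ c ε F)
    (mFi : ∀ s, Measurable fun t => Fi t s)
    (hFi : ∀ t s l, (∀ l', (∀ᶠ m : ℕ in atTop, (Dbl^[m] F) t s = l') ↔ l' = l) → Fi t s = l) :
    (∀ s, Intw ρ c s (fun t => Fi t s)) ∧
    ∀ s s', ∀ᵐ t, Fi t s * Fi (t + (s : UnitAddCircle)) s' = Fi t (s + s') := by
  have hg : ∀ m : ℕ, Good ρ c (2^m*ε) (Dbl^[m] F) := by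
    intro m
    induction m with
    | zero => simpa using h
    | succ k ih =>
      rw [Function.iterate_succ_apply']
      have := ih.dbl.1
      rwa [← mul_assoc, ← pow_succ'] at this
  have hst : ∀ s, ∀ m : ℕ, |s| < 2^m*ε → ∀ᵐ t, Fi t s = (Dbl^[m] F) t s := by
    intro s m hm
    have : ∀ᵐ t, ∀ k : ℕ, (Dbl^[m+k+1] F) t s = (Dbl^[m+k] F) t s := by
      rw [ae_all_iff]
      intro k
      rw [Function.iterate_succ_apply']
      refine (hg (m+k)).dbl.2 s (hm.trans_le ?_)
      gcongr
      · norm_num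
      · omega
    filter_upwards [this] with t ht
    have h2 : ∀ k, (Dbl^[m+k] F) t s = (Dbl^[m] F) t s := by
      intro k
      induction k with
      | zero => rfl
      | succ k ih => rw [← ih, ← ht k]; rfl
    have ev : ∀ᶠ k : ℕ in atTop, (Dbl^[k] F) t s = (Dbl^[m] F) t s := by
      filter_upwards [eventually_ge_atTop m] with k hk
      obtain ⟨j, rfl⟩ := Nat.exists_eq_add_of_le hk
      exact h2 j
    apply hFi
    intro l'
    constructor
    · intro h'
      obtain ⟨k, hk1, hk2⟩ := (ev.and h').exists
      rw [← hk2, hk1]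
    · rintro rfl; exact ev
  have big : ∀ r : ℝ, ∃ m : ℕ, ∀ k ≥ m, r < 2^k*ε := by
    intro r
    have : Tendsto (fun k : ℕ => (2:ℝ)^k*ε) atTop atTop :=
      (tendsto_pow_atTop_atTop_of_one_lt (by norm_num)).atTop_mul_const hε
    exact eventually_atTop.1 (this.eventually_gt_atTop r)
  refine ⟨fun s => ?_, fun s s' => ?_⟩
  · obtain ⟨m, hm⟩ := big |s|
    exact ((hg m).1 s (hm m le_rfl)).congr (mFi s) (hst s m (hm m le_rfl))
  · obtain ⟨m, hm⟩ := big (|s| + |s'|)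
    have hm := hm m le_rfl
    have h1 : |s| < 2^m*ε := by linarith [abs_nonneg s']
    have h2 : |s'| < 2^m*ε := by linarith [abs_nonneg s]
    have h3 : |s+s'| < 2^m*ε := (abs_add_le s s').trans_lt hm
    filter_upwards [hst s m h1, ae_tr (s : UnitAddCircle) (hst s' m h2), hst _ m h3, (hg m).2 s s' h1 h2 h3]
      with t a1 a2 a3 a4
    rw [a1, a2, a3, a4]

end C1

section C2
open Filter Topology
open scoped ENNReal

variable {Λ : Type*} [Group Λ] [MeasurableSpace Λ] [DiscreteMeasurableSpace Λ] [Countable Λ]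
variable {ρ : UnitAddCircle} {c : UnitAddCircle → Λ}

theorem near_mul {θ θ' : UnitAddCircle → Λ} {s : UnitAddCircle} {a b : ℝ≥0∞} 
    (h : volume {t | θ t ≠ 1} ≤ a) (h' : volume {t | θ' t ≠ 1} ≤ b) :
    volume {t | θ t * θ' (t + s) ≠ 1} ≤ a + b := by
  have e : volume {t | θ' (t + s) ≠ 1} = volume {t | θ' t ≠ 1} :=
    measure_preimage_add_right volume s {t | θ' t ≠ 1}
  refine (measure_mono (t := {t | θ t ≠ 1} ∪ {t | θ' (t + s) ≠ 1}) ?_).trans ((measure_union_le _ _).trans ?_)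
  · intro t ht
    by_contra hc
    simp only [Set.mem_union, not_or] at hc
    have h1 : θ t = 1 := not_not.1 hc.1
    have h2 : θ' (t + s) = 1 := not_not.1 hc.2
    exact ht (by rw [h1, h2, mul_one])
  · rw [e]; gcongr

theorem near_eq {θ θ' : UnitAddCircle → Λ} {a b : ℝ≥0∞} (hab : a + b < 1)
    (h : volume {t | θ t ≠ 1} ≤ a) (h' : volume {t | θ' t ≠ 1} ≤ b) :
    volume {t | θ t = θ' t} ≠ 0 := by
  intro h0
  have : volume (Set.univ : Set UnitAddCircle) ≤ a + b := by
    calc volume (Set.univ : Set UnitAddCircle) ≤ volume (({t | θ t ≠ 1} ∪ {t | θ' t ≠ 1}) ∪ {t | θ t = θ' t}) := by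
          apply measure_mono
          intro t _
          by_cases h1 : θ t = 1
          · by_cases h2 : θ' t = 1
            · right; show θ t = θ' t; rw [h1, h2]
            · left; right; exact h2
          · left; left; exact h1
      _ ≤ _ := (measure_union_le _ _).trans (add_le_add (measure_union_le _ _) le_rfl)
      _ ≤ a + b := by rw [h0, add_zero]; gcongr
  rw [UnitAddCircle.measure_univ] at this
  exact absurd hab (not_lt.2 this)

theorem ofReal_lt_one_sum : ENNReal.ofReal (1/6) + ENNReal.ofReal (1/6) + ENNReal.ofReal (1/6) < 1 := by
  rw [← ENNReal.ofReal_add (by norm_num) (by norm_num), ← ENNReal.ofReal_add (by norm_num) (by norm_num),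
    ← ENNReal.ofReal_one]
  exact (ENNReal.ofReal_lt_ofReal_iff (by norm_num)).2 (by norm_num)

theorem sub_pre (s : ℝ) {S : Set ℝ} (mS : MeasurableSet S) : volume {r | s - r ∈ S} = volume S := by
  have := (Measure.measurePreserving_sub_left volume s).measure_preimage mS.nullMeasurableSet
  exact this

theorem local_good (hρ : addOrderOf ρ = 0) {Φ : UnitAddCircle → ℝ → Λ} (mΦ : Measurable (Function.uncurry Φ))
    {G : Set ℝ} (mG : MeasurableSet G) (hG1 : ∀ s ∈ G, Intw ρ c s (fun t => Φ t s))
    (hG2 : ∀ s ∈ G, volume {t | Φ t s ≠ 1} ≤ ENNReal.ofReal (1/12)) {ε : ℝ} (hε : 0 < ε)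
    (hG3 : volume {s | |s| < ε ∧ s ∉ G} < ENNReal.ofReal (ε/4))
    {F : UnitAddCircle → ℝ → Λ} (mF : ∀ s, Measurable fun t => F t s)
    (hF : ∀ t s l, (∀ l', 0 < volume {r : ℝ | r ∈ G ∧ s - r ∈ G ∧
      Φ t r * Φ (t + (r : UnitAddCircle)) (s - r) = l'} ↔ l' = l) → F t s = l) : Good ρ c (ε/2) F := by
  have key : ∀ s, |s| < ε/2 → Intw ρ c s (fun t => F t s) ∧ volume {t | F t s ≠ 1} ≤ ENNReal.ofReal (1/6) := by
    intro s hs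
    let R : Set ℝ := {r | r ∈ G ∧ s - r ∈ G}
    have mR : MeasurableSet R := mG.inter ((measurable_const.sub measurable_id) mG)
    have mbad : MeasurableSet {r : ℝ | |r| < ε ∧ r ∉ G} :=
      MeasurableSet.inter (measurableSet_lt (by fun_prop) measurable_const : MeasurableSet {r : ℝ | |r| < ε}) mG.compl
    have hR : volume R ≠ 0 := by
      intro h0
      have e : volume {r | |s - r| < ε ∧ s - r ∉ G} = volume {s | |s| < ε ∧ s ∉ G} :=
        sub_pre s mbad
      have : volume (Set.Ioo (-(ε/2)) (ε/2)) < ENNReal.ofReal (ε/4) + ENNReal.ofReal (ε/4) := by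
        calc volume (Set.Ioo (-(ε/2)) (ε/2)) ≤ volume (({s | |s| < ε ∧ s ∉ G} ∪ {r | |s - r| < ε ∧ s - r ∉ G}) ∪ R) := by
              apply measure_mono
              intro r hr
              have hr' : |r| < ε/2 := abs_lt.2 hr
              by_cases h1 : r ∈ G
              · by_cases h2 : s - r ∈ G
                · exact Or.inr ⟨h1, h2⟩
                · refine Or.inl (Or.inr ⟨?_, h2⟩)
                  calc |s - r| ≤ |s| + |r| := abs_sub s r
                    _ < ε := by linarith
              · exact Or.inl (Or.inl ⟨by linarith, h1⟩)
          _ ≤ _ := (measure_union_le _ _).trans (add_le_add (measure_union_le _ _) le_rfl)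
          _ < _ := by rw [h0, add_zero, e]; exact ENNReal.add_lt_add hG3 hG3
      rw [Real.volume_Ioo, ← ENNReal.ofReal_add (by positivity) (by positivity)] at this
      have := (ENNReal.ofReal_lt_ofReal_iff (by positivity)).1 this
      linarith
    let θ : ℝ → UnitAddCircle → Λ := fun r t => Φ t r * Φ (t + (r : UnitAddCircle)) (s - r)
    have hθ : ∀ r ∈ R, Intw ρ c s (θ r) := by
      intro r hr
      have := (hG1 r hr.1).mul (hG1 _ hr.2)
      rw [add_sub_cancel] at this
      exact this
    have hθn : ∀ r ∈ R, volume {t | θ r t ≠ 1} ≤ ENNReal.ofReal (1/6) := by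
      intro r hr
      refine (near_mul (s := (r : UnitAddCircle)) (hG2 r hr.1) (hG2 _ hr.2)).trans ?_
      rw [← ENNReal.ofReal_add (by norm_num) (by norm_num)]
      norm_num
    obtain ⟨r0, hr0⟩ : R.Nonempty := nonempty_of_measure_ne_zero hR
    have mθ : Measurable (fun p : UnitAddCircle × ℝ => θ p.2 p.1) := by
      have c1 : Measurable (fun r : ℝ => (r : UnitAddCircle)) := AddCircle.measurable_mk'
      have h1 : Measurable (fun p : UnitAddCircle × ℝ => Φ p.1 p.2) := mΦ
      have h2 : Measurable (fun p : UnitAddCircle × ℝ => Φ (p.1 + (p.2 : UnitAddCircle)) (s - p.2)) := by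
        refine mΦ.comp (f := fun p : UnitAddCircle × ℝ => (p.1 + (p.2 : UnitAddCircle), s - p.2)) ?_
        fun_prop
      exact h1.mul h2
    have hall : ∀ᵐ t : UnitAddCircle, ∀ᵐ r : ℝ, r ∈ R → θ r t = θ r0 t := by
      rw [Measure.ae_ae_comm]
      · refine ae_of_all _ fun r => ?_
        by_cases hr : r ∈ R
        · refine ((hθ r hr).unique hρ (hθ r0 hr0) (near_eq ?_ (hθn r hr) (hθn r0 hr0))).mono fun t h _ => h
          exact lt_of_le_of_lt (by simp) ofReal_lt_one_sum
        · exact ae_of_all _ fun t h => absurd h hr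
      · have : {p : UnitAddCircle × ℝ | p.2 ∈ R → θ p.2 p.1 = θ r0 p.1} =
          (Prod.snd ⁻¹' R)ᶜ ∪ {p | θ p.2 p.1 = θ r0 p.1} := by
          ext p
          simp [imp_iff_not_or]
        rw [this]
        exact (measurable_snd mR).compl.union (measurableSet_eq_fun mθ ((hθ r0 hr0).1.comp measurable_fst))
    have hFθ : ∀ᵐ t, F t s = θ r0 t := by
      filter_upwards [hall] with t ht
      apply hF
      intro l'
      have e1 : volume {r : ℝ | r ∈ G ∧ s - r ∈ G ∧ Φ t r * Φ (t + (r : UnitAddCircle)) (s - r) = l'}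
          = volume {r | r ∈ R ∧ θ r0 t = l'} := by
        apply measure_congr
        filter_upwards [ht] with r hr
        apply propext
        constructor
        · rintro ⟨h1, h2, h3⟩
          exact ⟨⟨h1, h2⟩, by rw [← hr ⟨h1, h2⟩]; exact h3⟩
        · rintro ⟨h1, h2⟩
          exact ⟨h1.1, h1.2, by rw [← h2, ← hr h1]⟩
      rw [e1]
      by_cases hl : l' = θ r0 t
      · subst hl
        simp only [and_true, iff_true]
        exact pos_iff_ne_zero.2 hR
      · have : {r | r ∈ R ∧ θ r0 t = l'} = ∅ := by
          ext r; simp only [Set.mem_ofPred_eq, Set.mem_empty_iff_false, iff_false]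
          exact fun h => hl h.2.symm
        rw [this]
        simp [hl]
    refine ⟨(hθ r0 hr0).congr (mF s) hFθ, ?_⟩
    rw [show volume {t | F t s ≠ 1} = volume {t | θ r0 t ≠ 1} from ?_]
    · exact hθn r0 hr0
    · apply measure_congr
      filter_upwards [hFθ] with t ht
      apply propext
      show F t s ≠ 1 ↔ θ r0 t ≠ 1
      rw [ht]
  refine ⟨fun s hs => (key s hs).1, fun s s' hs hs' hss => ?_⟩
  have k1 := key s hs
  have k2 := key s' hs'
  have k3 := key _ hss
  have k4 : volume {t | F t s * F (t + (s : UnitAddCircle)) s' ≠ 1} ≤ _ :=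
    near_mul (θ := fun t => F t s) (θ' := fun t => F t s') (s := (s : UnitAddCircle)) k1.2 k2.2
  have k5 : volume {t | F t s * F (t + (s : UnitAddCircle)) s' = F t (s + s')} ≠ 0 := 
    near_eq (θ := fun t => F t s * F (t + (s : UnitAddCircle)) s') (θ' := fun t => F t (s+s')) ofReal_lt_one_sum k4 k3.2
  exact (k1.1.mul k2.1).unique hρ k3.1 k5

end C2

section C3
open Filter Topology
open scoped ENNReal

theorem cheb {α β : Type*} [MeasurableSpace α] [MeasurableSpace β] {m1 : Measure α} {m2 : Measure β}
    [SFinite m2] {B : Set (α × β)} (hB : MeasurableSet B) (k : ℝ≥0∞) :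
    k * m1 {x | k ≤ m2 {y | (x, y) ∈ B}} ≤ (m1.prod m2) B := by
  rw [Measure.prod_apply hB]
  exact mul_meas_ge_le_lintegral (measurable_measure_prodMk_left hB) k

variable {Λ : Type*} [Group Λ] [MeasurableSpace Λ] [DiscreteMeasurableSpace Λ] [Countable Λ]
variable {Y : Type*} [MeasurableSpace Y] {ν : Measure Y} [IsProbabilityMeasure ν]

theorem mp13 : MeasurePreserving (fun q : (Y × ℝ) × UnitAddCircle => ((q.2, q.1.1), q.1.2))
    ((ν.prod volume).prod volume) (((volume : Measure UnitAddCircle).prod ν).prod (volume : Measure ℝ)) := by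
  have h1 : MeasurePreserving (Prod.swap : (Y × ℝ) × UnitAddCircle → _) ((ν.prod volume).prod volume)
    ((volume : Measure UnitAddCircle).prod (ν.prod (volume : Measure ℝ))) := Measure.measurePreserving_swap
  have h2 := (measurePreserving_prodAssoc (volume : Measure UnitAddCircle) ν (volume : Measure ℝ)).symm
  exact h2.comp h1

theorem mfib {S : Set ((UnitAddCircle × Y) × ℝ)} (mS : MeasurableSet S) :
    Measurable fun q : Y × ℝ => volume {t : UnitAddCircle | ((t, q.1), q.2) ∈ S} := by
  have m13 : Measurable (fun q : (Y × ℝ) × UnitAddCircle => ((q.2, q.1.1), q.1.2)) := by fun_prop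
  have := measurable_measure_prodMk_left (ν := (volume : Measure UnitAddCircle)) (m13 mS)
  exact this

theorem cheb13 {S : Set ((UnitAddCircle × Y) × ℝ)} (mS : MeasurableSet S) (k : ℝ≥0∞) :
    k * (ν.prod (volume : Measure ℝ)) {q : Y × ℝ | k ≤ volume {t : UnitAddCircle | ((t, q.1), q.2) ∈ S}} ≤
      (((volume : Measure UnitAddCircle).prod ν).prod (volume : Measure ℝ)) S := by
  have m13 : Measurable (fun q : (Y × ℝ) × UnitAddCircle => ((q.2, q.1.1), q.1.2)) := by fun_prop
  have h := cheb (m1 := ν.prod (volume : Measure ℝ)) (m2 := (volume : Measure UnitAddCircle)) (m13 mS) k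
  rw [mp13.measure_preimage mS.nullMeasurableSet] at h
  exact h

theorem mcoe : Measurable (fun r : ℝ => (r : UnitAddCircle)) := AddCircle.measurable_mk'

theorem pi_qmp : Measure.QuasiMeasurePreserving (fun r : ℝ => (r : UnitAddCircle)) volume volume := by
  refine ⟨mcoe, Measure.AbsolutelyContinuous.mk fun S mS h0 => ?_⟩
  rw [Measure.map_apply mcoe mS]
  have : ∀ k : ℤ, volume (((fun r : ℝ => (r : UnitAddCircle)) ⁻¹' S) ∩ Set.Ioc (k : ℝ) (k + 1)) = 0 := by
    intro k
    have := (UnitAddCircle.measurePreserving_mk (k : ℝ)).measure_preimage mS.nullMeasurableSet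
    rw [Measure.restrict_apply (mcoe mS), h0] at this
    exact this
  rw [← measure_iUnion_null_iff, ← Set.inter_iUnion, iUnion_Ioc_intCast, Set.inter_univ] at this
  exact this

/-- F2 -/
theorem exF2 {Φ : (UnitAddCircle × Y) × ℝ → Λ} (mΦ : Measurable Φ) {G : Set (Y × ℝ)} (mG : MeasurableSet G) :
    ∃ F : (UnitAddCircle × Y) × ℝ → Λ, Measurable F ∧ ∀ (y : Y) (t : UnitAddCircle) (s : ℝ) (l : Λ),
      (∀ l', 0 < volume {r : ℝ | (y, r) ∈ G ∧ (y, s - r) ∈ G ∧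
        Φ ((t, y), r) * Φ ((t + (r : UnitAddCircle), y), s - r) = l'} ↔ l' = l) → F ((t, y), s) = l := by
  have c1 := mcoe
  obtain ⟨F, mF, hF⟩ := H1 (Z := (UnitAddCircle × Y) × ℝ) (Λ := Λ)
    (fun l => {z | 0 < volume {r : ℝ | (z.1.2, r) ∈ G ∧ (z.1.2, z.2 - r) ∈ G ∧
        Φ (z.1, r) * Φ ((z.1.1 + (r : UnitAddCircle), z.1.2), z.2 - r) = l}}) (by
      intro l
      have mS : MeasurableSet {q : ((UnitAddCircle × Y) × ℝ) × ℝ | (q.1.1.2, q.2) ∈ G ∧ (q.1.1.2, q.1.2 - q.2) ∈ G ∧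
        Φ (q.1.1, q.2) * Φ ((q.1.1.1 + (q.2 : UnitAddCircle), q.1.1.2), q.1.2 - q.2) = l} := by
        have a1 : MeasurableSet {q : ((UnitAddCircle × Y) × ℝ) × ℝ | (q.1.1.2, q.2) ∈ G} :=
          (show Measurable fun q : ((UnitAddCircle × Y) × ℝ) × ℝ => (q.1.1.2, q.2) by fun_prop) mG
        have a2 : MeasurableSet {q : ((UnitAddCircle × Y) × ℝ) × ℝ | (q.1.1.2, q.1.2 - q.2) ∈ G} :=
          (show Measurable fun q : ((UnitAddCircle × Y) × ℝ) × ℝ => (q.1.1.2, q.1.2 - q.2) by fun_prop) mG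
        have a3 : MeasurableSet {q : ((UnitAddCircle × Y) × ℝ) × ℝ |
          Φ (q.1.1, q.2) * Φ ((q.1.1.1 + (q.2 : UnitAddCircle), q.1.1.2), q.1.2 - q.2) = l} :=
          (show Measurable fun q : ((UnitAddCircle × Y) × ℝ) × ℝ =>
            Φ (q.1.1, q.2) * Φ ((q.1.1.1 + (q.2 : UnitAddCircle), q.1.1.2), q.1.2 - q.2) by fun_prop)
            (measurableSet_singleton l)
        exact a1.inter (a2.inter a3)
      exact measurableSet_lt measurable_const (measurable_measure_prodMk_left (ν := (volume : Measure ℝ)) mS))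
  exact ⟨F, mF, fun y t s l h => hF ((t, y), s) l h⟩

theorem exFi {F : (UnitAddCircle × Y) × ℝ → Λ} (mF : Measurable F) :
    ∃ Fi : (UnitAddCircle × Y) × ℝ → Λ, Measurable Fi ∧ ∀ (y : Y) (t : UnitAddCircle) (s : ℝ) (l : Λ),
      (∀ l', (∀ᶠ m : ℕ in atTop, (Dbl^[m] (fun t s => F ((t, y), s))) t s = l') ↔ l' = l) → Fi ((t, y), s) = l := by
  have c1 := mcoe
  have mm : ∀ m : ℕ, Measurable fun z : (UnitAddCircle × Y) × ℝ => (Dbl^[m] (fun t s => F ((t, z.1.2), s))) z.1.1 z.2 := by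
    intro m
    induction m with
    | zero => exact mF
    | succ m ih =>
      simp only [Function.iterate_succ_apply', Dbl]
      refine Measurable.mul ?_ ?_
      · exact ih.comp (show Measurable fun z : (UnitAddCircle × Y) × ℝ => (z.1, z.2/2) by fun_prop)
      · exact ih.comp (show Measurable fun z : (UnitAddCircle × Y) × ℝ =>
          ((z.1.1 + ((z.2/2 : ℝ) : UnitAddCircle), z.1.2), z.2/2) by fun_prop)
  obtain ⟨Fi, mFi, hFi⟩ := H1 (Z := (UnitAddCircle × Y) × ℝ) (Λ := Λ)
    (fun l => {z | ∀ᶠ m : ℕ in atTop, (Dbl^[m] (fun t s => F ((t, z.1.2), s))) z.1.1 z.2 = l}) (by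
      intro l
      have : {z : (UnitAddCircle × Y) × ℝ | ∀ᶠ m : ℕ in atTop, (Dbl^[m] (fun t s => F ((t, z.1.2), s))) z.1.1 z.2 = l}
        = ⋃ N : ℕ, ⋂ m : ℕ, ⋂ _ : N ≤ m, {z | (Dbl^[m] (fun t s => F ((t, z.1.2), s))) z.1.1 z.2 = l} := by
        ext z
        simp [eventually_atTop]
      rw [this]
      exact MeasurableSet.iUnion fun N => MeasurableSet.iInter fun m => MeasurableSet.iInter fun _ =>
        mm m (measurableSet_singleton l))
  exact ⟨Fi, mFi, fun y t s l h => hFi ((t, y), s) l h⟩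

theorem thmC {ρ : Y → UnitAddCircle} (mρ : Measurable ρ) (hρ : ∀ᵐ y ∂ν, addOrderOf (ρ y) = 0)
    {c : UnitAddCircle × Y → Λ} (mc : Measurable c)
    {Φ : (UnitAddCircle × Y) × ℝ → Λ} {W : Set ((UnitAddCircle × Y) × ℝ)} (mΦ : Measurable Φ) (mW : MeasurableSet W)
    (hrel : ∀ᵐ p ∂((volume : Measure UnitAddCircle).prod ν).prod (volume : Measure ℝ),
      (((p.1.1 + ρ p.1.2, p.1.2), p.2) ∈ W ↔ p ∈ W) ∧ (p ∈ W →
        Φ ((p.1.1 + ρ p.1.2, p.1.2), p.2) = c p.1 * Φ p * (c (p.1.1 + (p.2 : UnitAddCircle), p.1.2))⁻¹))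
    (hest : ∀ κ : ℝ, 0 < κ → ∃ ε₀ : ℝ, 0 < ε₀ ∧ ∀ ε : ℝ, 0 < ε → ε < ε₀ →
        (((volume : Measure UnitAddCircle).prod ν).prod (volume : Measure ℝ))
          {p | |p.2| < ε ∧ ¬ (p ∈ W ∧ Φ p = 1)} ≤ ENNReal.ofReal (κ * ε)) :
    ∃ (f : ℝ × Y → Λ) (F : (UnitAddCircle × Y) × ℝ → Λ), Measurable f ∧ Measurable F ∧
      (∀ᵐ s : ℝ, ∀ᵐ y ∂ν, ∀ᵐ t : ℝ, (f (t, y))⁻¹ * f (t + s, y) = F (((t : UnitAddCircle), y), s)) ∧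
      (∀ s : ℝ, ∀ᵐ y ∂ν, ∀ᵐ t : UnitAddCircle,
        F ((t + ρ y, y), s) = c (t, y) * F ((t, y), s) * (c (t + (s : UnitAddCircle), y))⁻¹) := by
  have c1 := mcoe
  let rel : (UnitAddCircle × Y) × ℝ → Prop := fun p => (((p.1.1 + ρ p.1.2, p.1.2), p.2) ∈ W ↔ p ∈ W) ∧ (p ∈ W →
        Φ ((p.1.1 + ρ p.1.2, p.1.2), p.2) = c p.1 * Φ p * (c (p.1.1 + (p.2 : UnitAddCircle), p.1.2))⁻¹)
  have mrel : MeasurableSet {p | rel p} := by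
    have b1 : MeasurableSet {p : (UnitAddCircle × Y) × ℝ | ((p.1.1 + ρ p.1.2, p.1.2), p.2) ∈ W} :=
      (show Measurable fun p : (UnitAddCircle × Y) × ℝ => ((p.1.1 + ρ p.1.2, p.1.2), p.2) by fun_prop) mW
    have b2 : MeasurableSet {p : (UnitAddCircle × Y) × ℝ | 
        Φ ((p.1.1 + ρ p.1.2, p.1.2), p.2) = c p.1 * Φ p * (c (p.1.1 + (p.2 : UnitAddCircle), p.1.2))⁻¹} :=
      measurableSet_eq_fun (by fun_prop) (by fun_prop)
    have : {p | rel p} = (({p : (UnitAddCircle × Y) × ℝ | ((p.1.1 + ρ p.1.2, p.1.2), p.2) ∈ W} ∩ W) ∪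
      ({p : (UnitAddCircle × Y) × ℝ | ((p.1.1 + ρ p.1.2, p.1.2), p.2) ∈ W}ᶜ ∩ Wᶜ)) ∩ (Wᶜ ∪ {p : (UnitAddCircle × Y) × ℝ | 
        Φ ((p.1.1 + ρ p.1.2, p.1.2), p.2) = c p.1 * Φ p * (c (p.1.1 + (p.2 : UnitAddCircle), p.1.2))⁻¹}) := by
      ext p
      simp only [rel, Set.mem_ofPred_eq, Set.mem_inter_iff, Set.mem_union, Set.mem_compl_iff]
      tauto
    rw [this]
    exact ((b1.inter mW).union (b1.compl.inter mW.compl)).inter (mW.compl.union b2)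
  have mgood : MeasurableSet {p | p ∈ W ∧ Φ p = 1} := mW.inter (mΦ (measurableSet_singleton 1))
  have m13 : Measurable (fun q : (Y × ℝ) × UnitAddCircle => ((q.2, q.1.1), q.1.2)) := by fun_prop
  let G1 : Set (Y × ℝ) := {q | volume {t : UnitAddCircle | ((t, q.1), q.2) ∈ {p | rel p}ᶜ} = 0}
  let G2 : Set (Y × ℝ) := {q | volume {t : UnitAddCircle | ((t, q.1), q.2) ∈ {p | p ∈ W ∧ Φ p = 1}ᶜ} < ENNReal.ofReal (1/12)}
  have mG1 : MeasurableSet G1 :=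
    (mfib mrel.compl) (measurableSet_singleton 0)
  have mG2 : MeasurableSet G2 :=
    measurableSet_lt (mfib mgood.compl) measurable_const
  let G := G1 ∩ G2
  have mG : MeasurableSet G := mG1.inter mG2
  have aeG1 : ∀ᵐ q ∂(ν.prod (volume : Measure ℝ)), q ∈ G1 := by
    have := Measure.ae_ae_of_ae_prod (mp13.quasiMeasurePreserving.ae hrel)
    filter_upwards [this] with q hq
    exact hq
  have est : ∀ κ : ℝ, 0 < κ → ∃ ε : ℝ, 0 < ε ∧
      ν {y | ENNReal.ofReal (ε/4) ≤ volume {s : ℝ | |s| < ε ∧ (y, s) ∉ G}} ≤ ENNReal.ofReal κ := by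
    intro κ hκ
    obtain ⟨ε₀, h0, h⟩ := hest (κ/48) (by positivity)
    refine ⟨ε₀/2, by positivity, ?_⟩
    set ε := ε₀/2 with hε
    have hε0 : 0 < ε := by positivity
    have h := h ε hε0 (by linarith)
    have mlt : MeasurableSet {q : Y × ℝ | |q.2| < ε} := measurableSet_lt (by fun_prop) measurable_const
    have mltp : MeasurableSet {q : (UnitAddCircle × Y) × ℝ | |q.2| < ε} := measurableSet_lt (by fun_prop) measurable_const
    have mB : MeasurableSet {p : (UnitAddCircle × Y) × ℝ | |p.2| < ε ∧ ¬ (p ∈ W ∧ Φ p = 1)} := mltp.inter mgood.compl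
    have h2 := (cheb13 mB (ENNReal.ofReal (1/12))).trans h
    have h3 : (ν.prod (volume : Measure ℝ)) {q | |q.2| < ε ∧ q ∉ G} ≤ (ν.prod (volume : Measure ℝ)) 
      {q : Y × ℝ | ENNReal.ofReal (1/12) ≤ volume {t : UnitAddCircle | ((t, q.1), q.2) ∈
        {p : (UnitAddCircle × Y) × ℝ  | |p.2| < ε ∧ ¬ (p ∈ W ∧ Φ p = 1)}}} := by
      apply measure_mono_ae
      filter_upwards [aeG1] with q hq hh
      obtain ⟨ha, hb⟩ : |q.2| < ε ∧ q ∉ G := hh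
      have hb : q ∉ G2 := fun h' => hb ⟨hq, h'⟩
      refine (not_lt.1 hb).trans (measure_mono ?_)
      intro t ht
      exact ⟨ha, ht⟩
    have mB2 : MeasurableSet {q : Y × ℝ | |q.2| < ε ∧ q ∉ G} := mlt.inter mG.compl
    have h4 := cheb (m1 := ν) (m2 := (volume : Measure ℝ)) mB2 (ENNReal.ofReal (ε/4))
    have h5 : ENNReal.ofReal (1/12) * (ENNReal.ofReal (ε/4) * ν {y | ENNReal.ofReal (ε/4) ≤ volume {s : ℝ | |s| < ε ∧ (y, s) ∉ G}})
      ≤ ENNReal.ofReal (κ/48*ε) := (mul_le_mul_right (h4.trans h3) _).trans h2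
    rw [← mul_assoc, ← ENNReal.ofReal_mul (by norm_num), show κ/48*ε = (1/12*(ε/4)) * κ by ring,
      ENNReal.ofReal_mul (by positivity) (q := κ)] at h5
    exact (ENNReal.mul_le_mul_iff_right (by simpa using hε0) ENNReal.ofReal_ne_top).1 h5
  have hyε : ∀ᵐ y ∂ν, ∃ ε : ℝ, 0 < ε ∧ volume {s : ℝ | |s| < ε ∧ (y, s) ∉ G} < ENNReal.ofReal (ε/4) := by
    rw [ae_iff]
    apply le_antisymm _ zero_le
    apply ENNReal.le_of_forall_pos_le_add
    intro κ hκ _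
    obtain ⟨ε, hε, h⟩ := est κ (by exact_mod_cast hκ)
    rw [zero_add]
    rw [ENNReal.ofReal_coe_nnreal] at h
    refine le_trans (measure_mono ?_) h
    intro y hy
    by_contra hcon
    exact hy ⟨ε, hε, not_le.1 hcon⟩
  obtain ⟨F2, mF2, hF2⟩ := exF2 mΦ mG
  obtain ⟨F, mF, hF⟩ := exFi mF2
  have main : ∀ᵐ y ∂ν, (∀ s, Intw (ρ y) (fun t => c (t, y)) s (fun t => F ((t, y), s))) ∧
      ∀ s s' : ℝ, ∀ᵐ t : UnitAddCircle, F ((t, y), s) * F ((t + (s : UnitAddCircle), y), s') = F ((t, y), s + s') := by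
    filter_upwards [hρ, hyε] with y hy1 ⟨ε, hε, hy2⟩
    have mGy : MeasurableSet {s : ℝ | (y, s) ∈ G} := measurable_prodMk_left mG
    have lg := local_good (ρ := ρ y) (c := fun t => c (t, y)) hy1 (Φ := fun t s => Φ ((t, y), s)) (by
      show Measurable fun p : UnitAddCircle × ℝ => Φ ((p.1, y), p.2)
      fun_prop) mGy ?_ ?_ hε hy2 (F := fun t s => F2 ((t, y), s)) (by fun_prop) (hF2 y)
    · exact lg.lim (by positivity) (by fun_prop) (hF y)
    · rintro s ⟨hs1, hs2⟩
      have hs1 : ∀ᵐ t : UnitAddCircle, rel ((t, y), s) := hs1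
      have hs2 : volume {t : UnitAddCircle | ((t, y), s) ∈ {p | p ∈ W ∧ Φ p = 1}ᶜ} < ENNReal.ofReal (1/12) := hs2
      have hWy : ∀ᵐ t : UnitAddCircle, t ∈ {t | ((t, y), s) ∈ W} := by
        apply erg_set hy1 ((show Measurable fun t : UnitAddCircle => ((t, y), s) by fun_prop) mW)
        · filter_upwards [hs1] with t ht
          exact ht.1
        · intro h0
          have : volume (Set.univ : Set UnitAddCircle) ≤ ENNReal.ofReal (1/12) := by
            calc volume (Set.univ : Set UnitAddCircle) ≤ volume ({t | ((t, y), s) ∈ W} ∪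
                {t : UnitAddCircle | ((t, y), s) ∈ {p | p ∈ W ∧ Φ p = 1}ᶜ}) := by
                  apply measure_mono
                  intro t _
                  by_cases h : ((t, y), s) ∈ W
                  · exact Or.inl h
                  · exact Or.inr fun h' => h h'.1
              _ ≤ _ := measure_union_le _ _
              _ ≤ _ := by rw [show volume {t : UnitAddCircle | ((t, y), s) ∈ W} = 0 from h0, zero_add]; exact hs2.le
          rw [UnitAddCircle.measure_univ, ← ENNReal.ofReal_one] at this
          have := (ENNReal.ofReal_le_ofReal_iff (by norm_num)).1 this
          norm_num at this
      refine ⟨by fun_prop, ?_⟩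
      filter_upwards [hs1, hWy] with t h1 h2
      exact h1.2 h2
    · rintro s ⟨hs1, hs2⟩
      refine le_trans (measure_mono ?_) (le_of_lt hs2)
      intro t ht h'
      exact ht h'.2
  have hπ : Measure.QuasiMeasurePreserving (fun r : ℝ => (r : UnitAddCircle)) volume volume := pi_qmp
  have hτ : ∀ᵐ τ : ℝ, ∀ᵐ t : ℝ, ∀ᵐ q : ℝ × Y ∂((volume : Measure ℝ).prod ν),
      F (((τ : UnitAddCircle), q.2), t - τ) * F (((t : UnitAddCircle), q.2), q.1) = F (((τ : UnitAddCircle), q.2), t - τ + q.1) := by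
    have mS : MeasurableSet {z : (ℝ × ℝ) × (ℝ × Y) | 
      F (((z.1.1 : UnitAddCircle), z.2.2), z.1.2 - z.1.1) * F (((z.1.2 : UnitAddCircle), z.2.2), z.2.1) =
        F (((z.1.1 : UnitAddCircle), z.2.2), z.1.2 - z.1.1 + z.2.1)} := measurableSet_eq_fun (by fun_prop) (by fun_prop)
    apply Measure.ae_ae_of_ae_prod (p := fun z : ℝ × ℝ => ∀ᵐ q : ℝ × Y ∂((volume : Measure ℝ).prod ν), 
      F (((z.1 : UnitAddCircle), q.2), z.2 - z.1) * F (((z.2 : UnitAddCircle), q.2), q.1) =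
        F (((z.1 : UnitAddCircle), q.2), z.2 - z.1 + q.1))
    rw [Measure.ae_ae_comm mS]
    filter_upwards [Measure.quasiMeasurePreserving_snd.ae main] with q hq
    have h1 : ∀ᵐ z : ℝ × ℝ ∂((volume : Measure ℝ).prod (volume : Measure ℝ)), F (((z.1 : UnitAddCircle), q.2), z.2) *
        F (((z.1 : UnitAddCircle) + (z.2 : UnitAddCircle), q.2), q.1) = F (((z.1 : UnitAddCircle), q.2), z.2 + q.1) := by
      rw [Measure.ae_prod_iff_ae_ae (measurableSet_eq_fun (by fun_prop) (by fun_prop)), Measure.ae_ae_comm]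
      · exact ae_of_all _ fun s' => hπ.ae (hq.2 s' q.1)
      · exact measurableSet_eq_fun (by fun_prop) (by fun_prop)
    have h2 := (measurePreserving_prod_neg_add (volume : Measure ℝ) (volume : Measure ℝ)).quasiMeasurePreserving.ae h1
    filter_upwards [h2] with z hz
    simp only [← AddCircle.coe_add, add_neg_cancel_left] at hz
    rw [sub_eq_neg_add]
    exact hz
  obtain ⟨τ, hτ⟩ := hτ.exists
  refine ⟨fun p => F (((τ : UnitAddCircle), p.2), p.1 - τ), F, by fun_prop, mF, ?_, ?_⟩
  · apply Measure.ae_ae_of_ae_prod (p := fun q : ℝ × Y => ∀ᵐ t : ℝ,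
      (F (((τ : UnitAddCircle), q.2), t - τ))⁻¹ * F (((τ : UnitAddCircle), q.2), t + q.1 - τ) = F (((t : UnitAddCircle), q.2), q.1))
    rw [Measure.ae_ae_comm]
    · filter_upwards [hτ] with t ht
      filter_upwards [ht] with q hq
      rw [show t + q.1 - τ = t - τ + q.1 by ring, ← hq]
      group
    · exact measurableSet_eq_fun (by fun_prop) (by fun_prop)
  · intro s
    filter_upwards [main] with y hy
    exact (hy.1 s).2

end C3

section E1
open Filter Topology
open scoped ENNReal

instance uac_prob : IsProbabilityMeasure (volume : Measure UnitAddCircle) := ⟨UnitAddCircle.measure_univ⟩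
instance uac_haar : (volume : Measure UnitAddCircle).IsAddHaarMeasure :=
  inferInstanceAs (Measure.IsAddHaarMeasure (volume : Measure (AddCircle (1:ℝ))))
instance uacm_haar {m : ℕ} : (volume : Measure (Fin m → UnitAddCircle)).IsAddHaarMeasure :=
  inferInstanceAs (Measure.IsAddHaarMeasure (Measure.pi fun _ : Fin m => (volume : Measure UnitAddCircle)))
instance uacp_haar {m : ℕ} : (volume : Measure (UnitAddCircle × (Fin m → UnitAddCircle))).IsAddHaarMeasure :=
  inferInstanceAs (Measure.IsAddHaarMeasure ((volume : Measure UnitAddCircle).prod (volume : Measure (Fin m → UnitAddCircle))))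

/-- representative -/
noncomputable def rep1 (t : UnitAddCircle) : ℝ := (AddCircle.equivIoc 1 0 t : ℝ)

theorem rep1_coe (t : UnitAddCircle) : (rep1 t : UnitAddCircle) = t := AddCircle.coe_equivIoc

theorem mrep1 : Measurable rep1 := measurable_subtype_coe.comp (AddCircle.measurableEquivIoc 1 0).measurable

theorem rep1_mp : MeasurePreserving rep1 volume (volume.restrict (Set.Ioc 0 1)) := by
  refine ⟨mrep1, ?_⟩
  have h := UnitAddCircle.measurePreserving_mk 0
  rw [zero_add] at h
  rw [← h.map_eq, Measure.map_map mrep1 h.measurable]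
  conv_rhs => rw [← Measure.map_id (μ := volume.restrict (Set.Ioc (0:ℝ) 1))]
  apply Measure.map_congr
  filter_upwards [ae_restrict_mem measurableSet_Ioc] with r hr
  have hr : r ∈ Set.Ioc (0:ℝ) (0 + 1) := by rwa [zero_add]
  show ((AddCircle.equivIoc 1 0 (r : UnitAddCircle)) : ℝ) = r
  rw [AddCircle.equivIoc_coe_eq hr]

variable {m : ℕ}

theorem repm_qmp : Measure.QuasiMeasurePreserving (fun (y : Fin m → UnitAddCircle) i => rep1 (y i)) volume volume := by
  have h := measurePreserving_pi (fun _ : Fin m => (volume : Measure UnitAddCircle))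
    (fun _ => (volume : Measure ℝ).restrict (Set.Ioc 0 1)) (f := fun _ => rep1) (fun _ => rep1_mp)
  rw [← Measure.restrict_pi_pi] at h
  exact h.quasiMeasurePreserving.mono_right Measure.restrict_le_self.absolutelyContinuous

theorem pim_qmp : Measure.QuasiMeasurePreserving (fun (y : Fin m → ℝ) i => (y i : UnitAddCircle)) volume volume := by
  have mp : Measurable (fun (y : Fin m → ℝ) i => (y i : UnitAddCircle)) :=
    measurable_pi_lambda _ fun i => mcoe.comp (measurable_pi_apply i)
  refine ⟨mp, Measure.AbsolutelyContinuous.mk fun S mS h0 => ?_⟩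
  rw [Measure.map_apply mp mS]
  have : ∀ k : Fin m → ℤ, volume (((fun (y : Fin m → ℝ) i => (y i : UnitAddCircle)) ⁻¹' S) ∩
      (Set.univ.pi fun i => Set.Ioc (k i : ℝ) (k i + 1))) = 0 := by
    intro k
    have h := measurePreserving_pi  (fun i : Fin m => (volume : Measure ℝ).restrict (Set.Ioc (k i : ℝ) (k i + 1)))
      (fun _ : Fin m => (volume : Measure UnitAddCircle))
      (f := fun _ r => (r : UnitAddCircle)) (fun i => UnitAddCircle.measurePreserving_mk (k i : ℝ))
    have h := h.measure_preimage mS.nullMeasurableSet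
    rw [← Measure.restrict_pi_pi, Measure.restrict_apply (mp mS)] at h
    exact h.trans h0
  rw [← measure_iUnion_null_iff, ← Set.inter_iUnion] at this
  rw [show (⋃ k : Fin m → ℤ, Set.univ.pi fun i => Set.Ioc (k i : ℝ) (k i + 1)) = Set.univ from ?_, Set.inter_univ] at this
  · exact this
  · ext y
    simp only [Set.mem_iUnion, Set.mem_univ, iff_true]
    refine ⟨fun i => ⌈y i⌉ - 1, fun i _ => ⟨?_, ?_⟩⟩
    · push_cast; linarith [Int.ceil_lt_add_one (y i)]
    · push_cast; linarith [Int.le_ceil (y i)]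

/-- projection -/
def prT (x : ℝ × (Fin m → ℝ)) : UnitAddCircle × (Fin m → UnitAddCircle) := ((x.1 : UnitAddCircle), fun i => (x.2 i : UnitAddCircle))
/-- section -/
noncomputable def rpT (x : UnitAddCircle × (Fin m → UnitAddCircle)) : ℝ × (Fin m → ℝ) := (rep1 x.1, fun i => rep1 (x.2 i))

theorem pr_rp (z : UnitAddCircle × (Fin m → UnitAddCircle)) : prT (rpT z) = z := by
  simp only [prT, rpT, rep1_coe]

theorem pr_qmp : Measure.QuasiMeasurePreserving (prT (m := m)) volume volume :=
  QuasiMeasurePreserving.prodMap pi_qmp pim_qmp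

theorem rp_qmp : Measure.QuasiMeasurePreserving (rpT (m := m)) volume volume := by
  refine QuasiMeasurePreserving.prodMap (f := rep1) ?_ repm_qmp
  exact rep1_mp.quasiMeasurePreserving.mono_right Measure.restrict_le_self.absolutelyContinuous

variable {M : Type*} [AddCommGroup M]
/-- shear into first coordinate -/
def sheA (j : Fin m) (x : M × (Fin m → M)) : M × (Fin m → M) := (x.1 + x.2 j, x.2)
/-- shear in the other coordinates -/
def sheU (j l : Fin m) (x : M × (Fin m → M)) : M × (Fin m → M) := (x.1, x.2 - Pi.single j (x.2 l))

theorem pr_sheA (j : Fin m) (x) : prT (sheA j x) = sheA j (prT x) := by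
  simp [prT, sheA]

theorem pr_sheU (j l : Fin m) (x) : prT (sheU j l x) = sheU j l (prT x) := by
  simp only [prT, sheU, Prod.mk.injEq, true_and]
  funext i
  by_cases h : i = j
  · subst h; simp
  · simp [h]

theorem sheA_mp (j : Fin m) : MeasurePreserving (sheA j) (volume : Measure (UnitAddCircle × (Fin m → UnitAddCircle))) volume := by
  let f : UnitAddCircle × (Fin m → UnitAddCircle) →+ UnitAddCircle × (Fin m → UnitAddCircle) :=
    { toFun := sheA j, map_zero' := by simp [sheA], map_add' := fun x y => by
        simp only [sheA, Prod.fst_add, Prod.snd_add, Pi.add_apply, Prod.mk_add_mk, Prod.mk.injEq, and_true]; abel }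
  refine AddMonoidHom.measurePreserving (f := f) (μ := volume) (ν := volume) ?_ ?_ rfl
  · show Continuous (sheA j); unfold sheA; fun_prop
  · intro x
    refine ⟨(x.1 - x.2 j, x.2), ?_⟩
    show sheA j _ = x
    simp [sheA]

theorem sheU_mp {j l : Fin m} (h : j ≠ l) : MeasurePreserving (sheU j l) (volume : Measure (UnitAddCircle × (Fin m → UnitAddCircle))) volume := by
  let f : UnitAddCircle × (Fin m → UnitAddCircle) →+ UnitAddCircle × (Fin m → UnitAddCircle) :=
    { toFun := sheU j l, map_zero' := by simp [sheU], map_add' := fun x y => by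
        simp only [sheU, Prod.fst_add, Prod.snd_add, Pi.add_apply, Pi.single_add, Prod.mk_add_mk, Prod.mk.injEq, true_and]; abel }
  refine AddMonoidHom.measurePreserving (f := f) (μ := volume) (ν := volume) ?_ ?_ rfl
  · show Continuous (sheU j l)
    unfold sheU
    refine continuous_fst.prodMk (continuous_snd.sub ?_)
    exact (continuous_single j).comp (by fun_prop)
  · intro x
    refine ⟨(x.1, x.2 + Pi.single j (x.2 l)), ?_⟩
    show sheU j l _ = x
    simp [sheU, h.symm]

theorem ord_ae (j : Fin m) : ∀ᵐ y : Fin m → UnitAddCircle, addOrderOf (y j) = 0 := by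
  have h1 : ∀ᵐ t : UnitAddCircle, addOrderOf t = 0 := by
    have : {t : UnitAddCircle | ¬ addOrderOf t = 0} ⊆ ⋃ k : ℕ, {t : UnitAddCircle | (k+1) • t = 0} := by
      intro t ht
      refine Set.mem_iUnion.2 ⟨addOrderOf t - 1, ?_⟩
      show (addOrderOf t - 1 + 1) • t = 0
      rw [Nat.sub_add_cancel (Nat.pos_of_ne_zero ht)]
      exact addOrderOf_nsmul_eq_zero t
    rw [ae_iff]
    suffices hC : (⋃ k : ℕ, {t : UnitAddCircle | (k+1) • t = 0}).Countable by
      have hC' := hC.image rep1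
      have h0 : volume.restrict (Set.Ioc (0:ℝ) 1) (rep1 '' ⋃ k : ℕ, {t : UnitAddCircle | (k+1) • t = 0}) = 0 :=
        hC'.measure_zero _
      rw [← rep1_mp.measure_preimage hC'.measurableSet.nullMeasurableSet] at h0
      exact measure_mono_null (this.trans (Set.subset_preimage_image _ _)) h0
    refine Set.countable_iUnion fun k => Set.Finite.countable ?_
    exact AddCircle.finite_torsion (1:ℝ) (Nat.succ_pos k)
  exact (measurePreserving_eval (fun _ : Fin m => (volume : Measure UnitAddCircle)) j).quasiMeasurePreserving.ae h1

end E1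

section E2
open Filter Topology
open scoped ENNReal
variable {Λ : Type*} [Group Λ] [MeasurableSpace Λ] [DiscreteMeasurableSpace Λ] [Countable Λ]

theorem ae_swap_prod {X Y : Type*} [MeasurableSpace X] [MeasurableSpace Y] {μ : Measure X} {ν : Measure Y} [SFinite μ] [SFinite ν]
    {p : X × Y → Prop} (mp : MeasurableSet {x | p x}) (h : ∀ᵐ y ∂ν, ∀ᵐ t ∂μ, p (t, y)) : ∀ᵐ x ∂(μ.prod ν), p x := by
  rw [Measure.ae_prod_iff_ae_ae mp]
  exact (Measure.ae_ae_comm (p := fun a b => p (a, b)) mp).2 h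

variable {m : ℕ}

/-- periodicity -/
def PerT (ω : ℝ × (Fin m → ℝ) → Λ) : Prop := ∀ᵐ x, ∀ x', prT x' = prT x → ω x' = ω x

theorem PerT.cpr {ω : ℝ × (Fin m → ℝ) → Λ} (h : PerT ω) : ∀ᵐ x, ω (rpT (prT x)) = ω x := by
  filter_upwards [h] with x hx
  exact hx _ (pr_rp _)

theorem PerT.tr {ω : ℝ × (Fin m → ℝ) → Λ} (h : PerT ω) {S : ℝ × (Fin m → ℝ) → ℝ × (Fin m → ℝ)}
    {S' : UnitAddCircle × (Fin m → UnitAddCircle) → UnitAddCircle × (Fin m → UnitAddCircle)}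
    (hS : Measure.QuasiMeasurePreserving S volume volume) (hS' : ∀ x, prT (S x) = S' (prT x)) :
    ∀ᵐ z, ω (rpT (S' z)) = ω (S (rpT z)) := by
  filter_upwards [rp_qmp.ae (hS.ae h)] with z hz
  apply hz
  rw [pr_rp, hS', pr_rp]

theorem shift_mp {X : Type*} [MeasurableSpace X] {ν : Measure X} [SFinite ν] (s : ℝ) :
    MeasurePreserving (fun x : ℝ × X => (x.1 + s, x.2)) ((volume : Measure ℝ).prod ν) ((volume : Measure ℝ).prod ν) :=
  (measurePreserving_add_right volume s).prod (MeasurePreserving.id ν)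

theorem shiftT_mp (s : ℝ) :
    MeasurePreserving (fun x : UnitAddCircle × (Fin m → UnitAddCircle) => (x.1 + (s : UnitAddCircle), x.2)) volume volume :=
  (measurePreserving_add_right (volume : Measure UnitAddCircle) (s : UnitAddCircle)).prod (MeasurePreserving.id _)

instance uacp_reg : Measure.Regular (volume : Measure (UnitAddCircle × (Fin m → UnitAddCircle))) :=
  Measure.Regular.of_sigmaCompactSpace_of_isLocallyFiniteMeasure _

theorem flow_cont (u : UnitAddCircle × (Fin m → UnitAddCircle) → Λ) (hu : Measurable u) :
    Tendsto (fun s : ℝ => (volume : Measure (UnitAddCircle × (Fin m → UnitAddCircle)))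
      {x | u (x.1 + (s : UnitAddCircle), x.2) ≠ u x}) (𝓝 0) (𝓝 0) := by
  have := cont_meas (volume : Measure (UnitAddCircle × (Fin m → UnitAddCircle)))
    (fun (s : ℝ) x => (x.1 + (s : UnitAddCircle), x.2)) (by
      have : Continuous (fun r : ℝ => (r : UnitAddCircle)) := AddCircle.continuous_mk' 1
      unfold Function.uncurry
      fun_prop) (fun s => shiftT_mp s) 0 (by intro x; simp) hu
      (K := Set.univ) MeasurableSet.univ (measure_ne_top _ _)
  simpa only [Set.univ_inter] using this

theorem thmDC {j l : Fin m} (hjl : j ≠ l)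
    {ωa ωb ωu ωw : ℝ × (Fin m → ℝ) → Λ} (ma : Measurable ωa) (mb : Measurable ωb) (mu : Measurable ωu) (mw : Measurable ωw)
    (qa : Measure.QuasiMeasurePreserving (sheA (M := ℝ) j) volume volume)
    (qb : Measure.QuasiMeasurePreserving (sheA (M := ℝ) l) volume volume)
    (qu : Measure.QuasiMeasurePreserving (sheU (M := ℝ) j l) volume volume)
    (qw : Measure.QuasiMeasurePreserving (sheU (M := ℝ) l j) volume volume)
    (pa : PerT ωa) (pb : PerT ωb) (pu : PerT ωu) (pw : PerT ωw)
    (cab : ∀ᵐ x, ωb (sheA j x) * ωa x = ωa (sheA l x) * ωb x)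
    (cua : ∀ᵐ x, ωu (sheA j x) * ωa x = ωb (sheA j (sheU j l x)) * ωa (sheU j l x) * ωu x)
    (cub : ∀ᵐ x, ωu (sheA l x) * ωb x = ωb (sheU j l x) * ωu x)
    (cwb : ∀ᵐ x, ωw (sheA l x) * ωb x = ωb (sheA j (sheU l j x)) * ωa (sheU l j x) * ωw x)
    (cwa : ∀ᵐ x, ωw (sheA j x) * ωa x = ωa (sheU l j x) * ωw x) :
    ∃ (f : ℝ × (Fin m → UnitAddCircle) → Λ) (F : (UnitAddCircle × (Fin m → UnitAddCircle)) × ℝ → Λ), Measurable f ∧ Measurable F ∧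
      (∀ᵐ s : ℝ, ∀ᵐ y, ∀ᵐ t : ℝ, (f (t, y))⁻¹ * f (t + s, y) = F (((t : UnitAddCircle), y), s)) ∧
      (∀ s : ℝ, ∀ᵐ y, ∀ᵐ t : UnitAddCircle,
        F ((t + y j, y), s) = ωa (rpT (t, y)) * F ((t, y), s) * (ωa (rpT (t + (s : UnitAddCircle), y)))⁻¹) := by
  have mrp : Measurable (rpT (m := m)) := rp_qmp.measurable
  obtain ⟨Φ, W, mΦ, mW, hrel, hest⟩ := thmD (μ := (volume : Measure (UnitAddCircle × (Fin m → UnitAddCircle))))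
    (fl := fun (s : ℝ) x => (x.1 + (s : UnitAddCircle), x.2))
    (by
      have := mcoe
      refine Measurable.prodMk (Measurable.add (measurable_fst.comp measurable_snd) (mcoe.comp measurable_fst)) (measurable_snd.comp measurable_snd))
    (fun s => shiftT_mp s) flow_cont
    (a := sheA j) (b := sheA l) (u := sheU j l) (w := sheU l j) (sheA_mp j) (sheA_mp l) (sheU_mp hjl) (sheU_mp hjl.symm)
    (fun s x => by simp only [sheA]; congr 1; abel) (fun s x => by simp only [sheA]; congr 1; abel)
    (fun s x => rfl) (fun s x => rfl)
    (ca := ωa ∘ rpT) (cb := ωb ∘ rpT) (cu := ωu ∘ rpT) (cw := ωw ∘ rpT)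
    (ma.comp mrp) (mb.comp mrp) (mu.comp mrp) (mw.comp mrp)
    (fun x => by simp only [sheA]; congr 1; abel)
    (by
      filter_upwards [rp_qmp.ae cab, pb.tr qa (pr_sheA j), pa.tr qb (pr_sheA l)] with z h1 h2 h3
      simp only [Function.comp]
      rw [h2, h3, h1])
    (fun x => by simp [sheA, sheU, hjl.symm]; abel)
    (by
      filter_upwards [rp_qmp.ae cua, pu.tr qa (pr_sheA j), pa.tr qu (pr_sheU j l),
        pb.tr (S := sheA j ∘ sheU j l) (S' := sheA j ∘ sheU j l) (qa.comp qu)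
          (fun x => by simp only [Function.comp, pr_sheA, pr_sheU])] with z h1 h2 h3 h4
      simp only [Function.comp] at h4 ⊢
      rw [h2, h3, h4, h1])
    (fun x => by simp [sheA, sheU, hjl, hjl.symm])
    (by
      filter_upwards [rp_qmp.ae cub, pu.tr qb (pr_sheA l), pb.tr qu (pr_sheU j l)] with z h1 h2 h3
      simp only [Function.comp]
      rw [h2, h3, h1])
    (fun x => by simp [sheA, sheU, hjl, hjl.symm])
    (by
      filter_upwards [rp_qmp.ae cwb, pw.tr qb (pr_sheA l), pa.tr qw (pr_sheU l j),
        pb.tr (S := sheA j ∘ sheU l j) (S' := sheA j ∘ sheU l j) (qa.comp qw)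
          (fun x => by simp only [Function.comp, pr_sheA, pr_sheU])] with z h1 h2 h3 h4
      simp only [Function.comp] at h4 ⊢
      rw [h2, h3, h4, h1])
    (fun x => by simp [sheA, sheU, hjl, hjl.symm])
    (by
      filter_upwards [rp_qmp.ae cwa, pw.tr qa (pr_sheA j), pa.tr qw (pr_sheU l j)] with z h1 h2 h3
      simp only [Function.comp]
      rw [h2, h3, h1])
  exact thmC (ν := (volume : Measure (Fin m → UnitAddCircle))) (ρ := fun y => y j) (measurable_pi_apply j) (ord_ae j)
    (c := ωa ∘ rpT) (ma.comp mrp) mΦ mW hrel hest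

theorem thmE0 {j l : Fin m} (hjl : j ≠ l)
    {ωa ωb ωu ωw : ℝ × (Fin m → ℝ) → Λ} (ma : Measurable ωa) (mb : Measurable ωb) (mu : Measurable ωu) (mw : Measurable ωw)
    (qa : Measure.QuasiMeasurePreserving (sheA (M := ℝ) j) volume volume)
    (qb : Measure.QuasiMeasurePreserving (sheA (M := ℝ) l) volume volume)
    (qu : Measure.QuasiMeasurePreserving (sheU (M := ℝ) j l) volume volume)
    (qw : Measure.QuasiMeasurePreserving (sheU (M := ℝ) l j) volume volume)
    (pa : PerT ωa) (pb : PerT ωb) (pu : PerT ωu) (pw : PerT ωw)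
    (cab : ∀ᵐ x, ωb (sheA j x) * ωa x = ωa (sheA l x) * ωb x)
    (cua : ∀ᵐ x, ωu (sheA j x) * ωa x = ωb (sheA j (sheU j l x)) * ωa (sheU j l x) * ωu x)
    (cub : ∀ᵐ x, ωu (sheA l x) * ωb x = ωb (sheU j l x) * ωu x)
    (cwb : ∀ᵐ x, ωw (sheA l x) * ωb x = ωb (sheA j (sheU l j x)) * ωa (sheU l j x) * ωw x)
    (cwa : ∀ᵐ x, ωw (sheA j x) * ωa x = ωa (sheU l j x) * ωw x) :
    ∃ f : ℝ × (Fin m → ℝ) → Λ, Measurable f ∧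
      (∀ᵐ s : ℝ, ∀ᵐ x : ℝ × (Fin m → ℝ), f (sheA j (x.1 + s, x.2)) * ωa (x.1 + s, x.2) * (f (x.1 + s, x.2))⁻¹ =
        f (sheA j x) * ωa x * (f x)⁻¹) ∧
      (∀ᵐ s : ℝ, ∀ᵐ x : ℝ × (Fin m → ℝ), f (x.1 + s + 1, x.2) * (f (x.1 + s, x.2))⁻¹ = f (x.1 + 1, x.2) * (f x)⁻¹) := by
  obtain ⟨f, F, mf, mF, h1, h2⟩ := thmDC hjl ma mb mu mw qa qb qu qw pa pb pu pw cab cua cub cwb cwa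
  have mrp : Measurable (rpT (m := m)) := rp_qmp.measurable
  let e : ℝ × (Fin m → ℝ) → ℝ × (Fin m → UnitAddCircle) := fun x => (x.1, fun i => (x.2 i : UnitAddCircle))
  have qe : Measure.QuasiMeasurePreserving e volume volume :=
    QuasiMeasurePreserving.prodMap (Measure.QuasiMeasurePreserving.id _) pim_qmp
  have h1' : ∀ᵐ s : ℝ, ∀ᵐ x : ℝ × (Fin m → ℝ), (f (e x))⁻¹ * f (e (x.1 + s, x.2)) = F (prT x, s) := by
    filter_upwards [h1] with s hs
    have := ae_swap_prod (p := fun z : ℝ × (Fin m → UnitAddCircle) => (f z)⁻¹ * f (z.1 + s, z.2) = F (((z.1 : UnitAddCircle), z.2), s)) ?_ hs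
    · exact qe.ae this
    · refine measurableSet_eq_fun ?_ ?_
      · exact mf.inv.mul (mf.comp (by fun_prop))
      · exact mF.comp (((mcoe.comp measurable_fst).prodMk measurable_snd).prodMk measurable_const)
  have h2' : ∀ s : ℝ, ∀ᵐ x : ℝ × (Fin m → ℝ), F (prT (sheA j x), s) = ωa x * F (prT x, s) * (ωa (x.1 + s, x.2))⁻¹ := by
    intro s
    have := ae_swap_prod (p := fun z : UnitAddCircle × (Fin m → UnitAddCircle) => F (sheA j z, s) = ωa (rpT z) * F (z, s) * (ωa (rpT (z.1 + (s : UnitAddCircle), z.2)))⁻¹) ?_ (h2 s)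
    · filter_upwards [pr_qmp.ae this, pa.cpr, (shift_mp (ν := (volume : Measure (Fin m → ℝ))) s).quasiMeasurePreserving.ae pa.cpr] with x hx c1 c2
      rw [pr_sheA, hx, c1, ← c2]
      rfl
    · refine measurableSet_eq_fun ?_ ?_
      · exact mF.comp ((sheA_mp j).measurable.prodMk measurable_const)
      · refine ((ma.comp mrp).mul (mF.comp (measurable_id.prodMk measurable_const))).mul ?_
        exact ((ma.comp mrp).comp (shiftT_mp s).measurable).inv
  refine ⟨f ∘ e, mf.comp qe.measurable, ?_, ?_⟩
  · filter_upwards [h1'] with s hs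
    filter_upwards [hs, qa.ae hs, h2' s] with x g1 g2 g3
    simp only [Function.comp]
    have e1 : sheA j (x.1 + s, x.2) = ((sheA j x).1 + s, (sheA j x).2) := by simp only [sheA]; congr 1; abel
    rw [e1, eq_mul_of_inv_mul_eq g1, eq_mul_of_inv_mul_eq g2, g3]
    group
  · filter_upwards [h1'] with s hs
    filter_upwards [hs, (shift_mp (ν := (volume : Measure (Fin m → ℝ))) 1).quasiMeasurePreserving.ae hs] with x g1 g2
    simp only [Function.comp]
    have e1 : prT (x.1 + 1, x.2) = prT x := by simp [prT]
    have g2' := eq_mul_of_inv_mul_eq g2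
    rw [e1] at g2'
    rw [show x.1 + s + 1 = x.1 + 1 + s by ring]
    rw [g2', eq_mul_of_inv_mul_eq g1]
    group

end E2

section S1
open Filter Topology
open scoped ENNReal
variable {Λ : Type*} [MeasurableSpace Λ] [DiscreteMeasurableSpace Λ] [Countable Λ]

/-- invariance subgroup -/
def InvG {X : Type*} [AddCommGroup X] [MeasurableSpace X] [MeasurableAdd X] (μ : Measure X) [μ.IsAddLeftInvariant] (u : X → Λ) :
    AddSubgroup X where
  carrier := {v | ∀ᵐ x ∂μ, u (x + v) = u x}
  zero_mem' := by
    show ∀ᵐ x ∂μ, u (x + 0) = u x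
    simp
  add_mem' := by
    intro a b ha hb
    have ha : ∀ᵐ x ∂μ, u (x + a) = u x := ha
    have hb : ∀ᵐ x ∂μ, u (x + b) = u x := hb
    show ∀ᵐ x ∂μ, u (x + (a + b)) = u x
    filter_upwards [ha, (measurePreserving_add_right μ a).quasiMeasurePreserving.ae hb] with x h1 h2
    rw [← add_assoc, h2, h1]
  neg_mem' := by
    intro a ha
    have ha : ∀ᵐ x ∂μ, u (x + a) = u x := ha
    show ∀ᵐ x ∂μ, u (x + -a) = u x
    filter_upwards [(measurePreserving_add_right μ (-a)).quasiMeasurePreserving.ae ha] with x h2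
    rw [← h2]; congr 1; abel

variable {n : ℕ}

/-- independence of coordinate i -/
def Indep (i : Fin n) (u : (Fin n → ℝ) → Λ) : Prop := ∀ s : ℝ, ∀ᵐ x, u (x + Pi.single i s) = u x

theorem single_qmp (v : Fin n → ℝ) : Measure.QuasiMeasurePreserving (fun x : Fin n → ℝ => x + v) volume volume :=
  (measurePreserving_add_right volume v).quasiMeasurePreserving

/-- dense set of s suffices -/
theorem indep_of_dense {i : Fin n} {u : (Fin n → ℝ) → Λ} (hu : Measurable u) {D : Set ℝ} (hD : Dense D)
    (h : ∀ s ∈ D, ∀ᵐ x, u (x + Pi.single i s) = u x) : Indep i u := by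
  have hc := (CL (volume : Measure (Fin n → ℝ)) hu).preimage (continuous_single (A := fun _ : Fin n => ℝ) i)
  intro s
  have : closure D ⊆ _ := hc.closure_subset_iff.2 (fun s hs => h s hs)
  exact this (hD s)

theorem indep_of_ae {i : Fin n} {u : (Fin n → ℝ) → Λ} (hu : Measurable u)
    (h : ∀ᵐ s : ℝ, ∀ᵐ x, u (x + Pi.single i s) = u x) : Indep i u :=
  indep_of_dense hu (Measure.dense_of_ae h) fun _ hs => hs

theorem LLs {i : Fin n} {u : (Fin n → ℝ) → Λ} (hu : Measurable u)
    (h : ∀ s, Indep i (fun x => (u (x + Pi.single i s) = u x : Prop))) : Indep i u := by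
  intro s
  have e : ∀ r : ℝ, r • (Pi.single i 1 : Fin n → ℝ) = Pi.single i r := fun r => by
    rw [← Pi.single_smul]; simp
  have := LL hu (Pi.single i 1) (fun s r => ?_) s
  · simpa only [e] using this
  · simp only [e]
    filter_upwards [h s r] with x hx
    exact fun h => hx.mpr h

variable [Group Λ]

theorem chi {i : Fin n} {v c d : (Fin n → ℝ) → Λ} {S : (Fin n → ℝ) → (Fin n → ℝ)}
    (hS : ∀ x s, S (x + Pi.single i s) = S x + Pi.single i s) (h : ∀ᵐ x, v (S x) = c x * v x * d x)
    (hc : Indep i c) (hd : Indep i d) (s : ℝ) :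
    ∀ᵐ x, (v (S x + Pi.single i s) = v (S x)) = (v (x + Pi.single i s) = v x) := by
  filter_upwards [h, (single_qmp (Pi.single i s)).ae h, hc s, hd s] with x h1 h2 h3 h4
  rw [← hS, h2, h1, h3, h4]
  simp

theorem mchi {i : Fin n} {v : (Fin n → ℝ) → Λ} (hv : Measurable v) (s : ℝ) :
    Measurable (fun x => (v (x + Pi.single i s) = v x : Prop)) :=
  measurableSet_setOfPred.1 (measurableSet_eq_fun (hv.comp (measurable_add_const _)) hv)

theorem LA {A : Set ℝ} (hA : Dense A) {i : Fin n} {v : (Fin n → ℝ) → Λ} (hv : Measurable v)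
    (h : ∀ α ∈ A, ∃ c d, Indep i c ∧ Indep i d ∧ ∀ᵐ x, v (x + Pi.single i α) = c x * v x * d x) : Indep i v := by
  refine LLs hv fun s => ?_
  refine indep_of_dense (mchi hv s) hA fun α hα => ?_
  obtain ⟨c, d, hc, hd, h⟩ := h α hα
  exact chi (S := fun x => x + Pi.single i α) (fun x s => by abel) h hc hd s

theorem const_of_indep {u : (Fin n → ℝ) → Λ} (hu : Measurable u) (h : ∀ i, Indep i u) : ∃ c, ∀ᵐ x, u x = c := by
  have h1 : ∀ v : Fin n → ℝ, v ∈ InvG volume u := by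
    intro v
    rw [← Finset.univ_sum_single v]
    exact AddSubgroup.sum_mem _ fun i _ => h i (v i)
  have h2 : ∀ᵐ v : Fin n → ℝ, ∀ᵐ x : Fin n → ℝ, u (x + v) = u x := ae_of_all _ h1
  rw [Measure.ae_ae_comm] at h2
  · obtain ⟨x, hx⟩ := h2.exists
    refine ⟨u x, ?_⟩
    filter_upwards [(single_qmp (-x)).ae hx] with v hv
    rw [← hv]; congr 1; abel
  · exact measurableSet_eq_fun (hu.comp (measurable_snd.add measurable_fst)) (hu.comp measurable_snd)

theorem dense_one_irr {y : ℝ} (hy : Irrational y) : Dense ((AddSubgroup.closure {y, 1} : AddSubgroup ℝ) : Set ℝ) := by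
  rw [dense_addSubgroupClosure_pair_iff]; simpa using hy

/-- lemma G -/
theorem lemG {Λ' : Type*} [MeasurableSpace Λ'] [DiscreteMeasurableSpace Λ'] [Countable Λ'] {m : ℕ} {u : (Fin (m+1) → ℝ) → Λ'} (hu : Measurable u) (i : Fin (m+1)) (j : Fin m) (α : ℝ)
    (h1 : ∀ᵐ x, u (x + Pi.single i 1) = u x)
    (h2 : ∀ᵐ x, u (x + Pi.single i (x (i.succAbove j) + α)) = u x) : Indep i u := by
  let e := MeasurableEquiv.piFinSuccAbove (fun _ : Fin (m+1) => ℝ) i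
  have he : MeasurePreserving e volume volume := volume_preserving_piFinSuccAbove (fun _ => ℝ) i
  have hes : MeasurePreserving e.symm volume volume := he.symm
  have key : ∀ (z : ℝ × (Fin m → ℝ)) s, e.symm z + Pi.single i s = e.symm (z.1 + s, z.2) := by
    intro z s
    apply e.injective
    rw [e.apply_symm_apply]
    have hz : e (e.symm z) = z := e.apply_symm_apply z
    refine Prod.ext ?_ ?_
    · have : (e (e.symm z)).1 = z.1 := by rw [hz]
      rw [← this]
      show (e.symm z + Pi.single i s : Fin (m+1) → ℝ) i = e.symm z i + s
      simp
    · have : (e (e.symm z)).2 = z.2 := by rw [hz]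
      show _ = z.2
      rw [← this]
      funext k
      show (e.symm z + Pi.single i s : Fin (m+1) → ℝ) (i.succAbove k) = e.symm z (i.succAbove k)
      simp
  have keyj : ∀ (z : ℝ × (Fin m → ℝ)), e.symm z (i.succAbove j) = z.2 j := by
    intro z
    have : (e (e.symm z)).2 j = z.2 j := by rw [e.apply_symm_apply]
    exact this
  have mw : Measurable (u ∘ e.symm) := hu.comp e.symm.measurable
  have g1 : ∀ᵐ z : ℝ × (Fin m → ℝ), (u ∘ e.symm) (z.1 + 1, z.2) = (u ∘ e.symm) z := by
    filter_upwards [hes.quasiMeasurePreserving.ae h1] with z hz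
    rw [key] at hz; exact hz
  have g2 : ∀ᵐ z : ℝ × (Fin m → ℝ), (u ∘ e.symm) (z.1 + (z.2 j + α), z.2) = (u ∘ e.symm) z := by
    filter_upwards [hes.quasiMeasurePreserving.ae h2] with z hz
    rw [key, keyj] at hz; exact hz
  have sw : ∀ {p : ℝ × (Fin m → ℝ) → Prop}, (∀ᵐ z, p z) → ∀ᵐ y, ∀ᵐ t, p (t, y) := by
    intro p h
    have := (Measure.measurePreserving_swap (μ := (volume : Measure (Fin m → ℝ))) (ν := (volume : Measure ℝ))).quasiMeasurePreserving.ae h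
    exact Measure.ae_ae_of_ae_prod this
  have hirr : ∀ᵐ y : Fin m → ℝ, Irrational (y j + α) := by
    have h0 : ∀ᵐ r : ℝ, Irrational (r + α) := by
      have : ∀ᵐ r : ℝ, Irrational r := by
        rw [ae_iff]
        have : {a : ℝ | ¬ Irrational a} = Set.range ((↑) : ℚ → ℝ) := by ext a; simp [Irrational]
        rw [this]
        exact (Set.countable_range _).measure_zero _
      exact (measurePreserving_add_right volume α).quasiMeasurePreserving.ae this
    exact (Measure.quasiMeasurePreserving_eval (fun _ : Fin m => (volume : Measure ℝ)) j).ae h0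
  intro s
  have fin : ∀ᵐ z : ℝ × (Fin m → ℝ), (u ∘ e.symm) (z.1 + s, z.2) = (u ∘ e.symm) z := by
    refine ae_swap_prod ?_ ?_
    · exact measurableSet_eq_fun (mw.comp (shift_mp (ν := (volume : Measure (Fin m → ℝ))) s).measurable) mw
    · filter_upwards [sw g1, sw g2, hirr] with y y1 y2 y3
      have my : Measurable (fun t => (u ∘ e.symm) (t, y)) := mw.comp measurable_prodMk_right
      have hc := CL (volume : Measure ℝ) my
      have hle : AddSubgroup.closure {y j + α, 1} ≤ InvG volume (fun t => (u ∘ e.symm) (t, y)) := by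
        rw [AddSubgroup.closure_le]
        rintro a (rfl | rfl)
        · exact y2
        · exact y1
      have : closure _ ⊆ _ := hc.closure_subset_iff.2 hle
      exact this (dense_one_irr y3 s)
  filter_upwards [he.quasiMeasurePreserving.ae fin] with x hx
  have hx : u (e.symm ((e x).1 + s, (e x).2)) = u (e.symm (e x)) := hx
  rw [← key, e.symm_apply_apply] at hx
  exact hx

end S1

section S2
open Filter Topology
open scoped ENNReal
variable {Λ : Type*} [Group Λ] [MeasurableSpace Λ] [DiscreteMeasurableSpace Λ] [Countable Λ]
variable {n : ℕ} {A : Subring ℝ} {G : Type*} [Group G] {act : G → (Fin n → ℝ) → (Fin n → ℝ)}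

/-- abstract setup -/
structure Setup (A : Subring ℝ) (act : G → (Fin n → ℝ) → (Fin n → ℝ)) : Prop where
  one : ∀ x, act 1 x = x
  mul : ∀ g h x, act (g * h) x = act g (act h x)
  qmp : ∀ g, Measure.QuasiMeasurePreserving (act g) volume volume
  inj : ∀ g h, (∀ x, act g x = act h x) → g = h
  tr : ∀ a : Fin n → A, ∃ g, ∀ x, act g x = x + fun i => (a i : ℝ)
  el : ∀ i j, i ≠ j → ∃ g, ∀ x, act g x = x + Pi.single i (x j)
  nrm : ∀ g (a : Fin n → A), ∃ b : Fin n → A, ∀ x, act g (x + fun i => (a i : ℝ)) = act g x + fun i => (b i : ℝ)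
  dense : Dense (A : Set ℝ)

/-- cocycle -/
structure Coc (act : G → (Fin n → ℝ) → (Fin n → ℝ)) (Ω : G → (Fin n → ℝ) → Λ) : Prop where
  meas : ∀ g, Measurable (Ω g)
  mul : ∀ g h, ∀ᵐ x, Ω (g * h) x = Ω g (act h x) * Ω h x

/-- coboundary change -/
def cob (act : G → (Fin n → ℝ) → (Fin n → ℝ)) (Ω : G → (Fin n → ℝ) → Λ) (φ : (Fin n → ℝ) → Λ) : G → (Fin n → ℝ) → Λ :=
  fun g x => φ (act g x) * Ω g x * (φ x)⁻¹

theorem Coc.cob {Ω : G → (Fin n → ℝ) → Λ} (S : Setup A act) (h : Coc act Ω) {φ} (mφ : Measurable φ) : Coc act (cob act Ω φ) where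
  meas g := ((mφ.comp (S.qmp g).measurable).mul (h.meas g)).mul mφ.inv
  mul g k := by
    filter_upwards [h.mul g k] with x hx
    simp only [OESuperrigidity.cob, S.mul, hx]
    group

theorem cob_cob (Ω : G → (Fin n → ℝ) → Λ) (φ ψ : (Fin n → ℝ) → Λ) :
    cob act (cob act Ω φ) ψ = cob act Ω (fun x => ψ x * φ x) := by
  funext g x
  simp only [cob]; group

/-- relation of length 2+2 -/
theorem Coc.rel {Ω : G → (Fin n → ℝ) → Λ} (S : Setup A act) (h : Coc act Ω) {g k g' k' : G}
    (e : ∀ x, act g (act k x) = act g' (act k' x)) : ∀ᵐ x, Ω g (act k x) * Ω k x = Ω g' (act k' x) * Ω k' x := by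
  have : g * k = g' * k' := S.inj _ _ fun x => by rw [S.mul, S.mul, e]
  filter_upwards [h.mul g k, h.mul g' k'] with x h1 h2
  rw [← h1, ← h2, this]

theorem Coc.rel3 {Ω : G → (Fin n → ℝ) → Λ} (S : Setup A act) (h : Coc act Ω) {g k g' k' l' : G}
    (e : ∀ x, act g (act k x) = act g' (act k' (act l' x))) :
    ∀ᵐ x, Ω g (act k x) * Ω k x = Ω g' (act k' (act l' x)) * Ω k' (act l' x) * Ω l' x := by
  have : g * k = (g' * k') * l' := S.inj _ _ fun x => by rw [S.mul, S.mul, S.mul, e]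
  filter_upwards [h.mul g k, h.mul (g' * k') l', (S.qmp l').ae (h.mul g' k')] with x h1 h2 h3
  rw [← h1, this, h2, h3]

theorem Setup.inv_eq (S : Setup A act) {g : G} {x y} (h : act g x = y) : act g⁻¹ y = x := by
  rw [← h, ← S.mul, inv_mul_cancel, S.one]

theorem Setup.eln (S : Setup A act) (i j : Fin n) (h : i ≠ j) : ∃ g, ∀ x, act g x = x - Pi.single i (x j) := by
  obtain ⟨g, hg⟩ := S.el i j h
  refine ⟨g⁻¹, fun x => S.inv_eq ?_⟩
  rw [hg]
  simp [h.symm]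

theorem Setup.trs (S : Setup A act) (i : Fin n) (α : A) : ∃ g, ∀ x, act g x = x + Pi.single i (α : ℝ) := by
  obtain ⟨g, hg⟩ := S.tr (Pi.single i α)
  refine ⟨g, fun x => ?_⟩
  rw [hg]; congr 1
  funext k
  by_cases hk : k = i
  · subst hk; simp
  · simp [hk]

theorem Setup.trz (S : Setup A act) (k : Fin n → ℤ) : ∃ g, ∀ x, act g x = x + fun i => (k i : ℝ) := by
  obtain ⟨g, hg⟩ := S.tr (fun i => (k i : A))
  refine ⟨g, fun x => ?_⟩
  rw [hg]; congr 1

theorem step0 {Ω : G → (Fin n → ℝ) → Λ} (S : Setup A act) (h : Coc act Ω) :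
    ∃ φ, Measurable φ ∧ ∀ (g : G) (k : Fin n → ℤ), (∀ x, act g x = x + fun i => (k i : ℝ)) → ∀ᵐ x, cob act Ω φ g x = 1 := by
  choose t ht using S.trz
  let fl : (Fin n → ℝ) → (Fin n → ℤ) := fun x i => - ⌊x i⌋
  have mfl : Measurable fl := measurable_pi_lambda _ fun i => (Int.measurable_floor.comp (measurable_pi_apply i)).neg
  refine ⟨fun x => Ω (t (fl x)) x, ?_, ?_⟩
  · have : Measurable (fun p : (Fin n → ℤ) × (Fin n → ℝ) => Ω (t p.1) p.2) :=
      measurable_from_prod_countable_right fun k => h.meas (t k)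
    exact this.comp (mfl.prodMk measurable_id)
  · intro g k hg
    have hall : ∀ᵐ x, ∀ l, Ω (t (l - k) * g) x = Ω (t (l - k)) (act g x) * Ω g x := ae_all_iff.2 fun l => h.mul _ _
    filter_upwards [hall] with x hx
    have e : t (fl x - k) * g = t (fl x) := S.inj _ _ fun y => by
      rw [S.mul, hg, ht, ht]
      funext i; simp
    have e2 : fl (act g x) = fl x - k := by
      funext i
      simp only [fl, hg, Pi.add_apply, Pi.sub_apply, Int.floor_add_intCast]; ring
    have := hx (fl x)
    rw [e] at this
    simp only [cob]
    rw [e2, this]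
    group

theorem per_of {Ω : G → (Fin n → ℝ) → Λ} (S : Setup A act) (h : Coc act Ω)
    (h0 : ∀ (g : G) (k : Fin n → ℤ), (∀ x, act g x = x + fun i => (k i : ℝ)) → ∀ᵐ x, Ω g x = 1)
    {T : G} (hT : ∀ k : Fin n → ℤ, ∃ k' : Fin n → ℤ, ∀ x, act T (x + fun i => (k i : ℝ)) = act T x + fun i => (k' i : ℝ)) :
    ∀ᵐ x, ∀ k : Fin n → ℤ, Ω T (x + fun i => (k i : ℝ)) = Ω T x := by
  choose t ht using S.trz
  refine ae_all_iff.2 fun k => ?_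
  obtain ⟨k', hk'⟩ := hT k
  have := h.rel S (g := T) (k := t k) (g' := t k') (k' := T) (fun x => by rw [ht, ht, hk'])
  filter_upwards [this, h0 (t k) k (ht k), (S.qmp T).ae (h0 (t k') k' (ht k'))] with x h1 h2 h3
  rw [h2, h3, ht] at h1
  simpa using h1

end S2

section S3
open Filter Topology
open scoped ENNReal
variable {Λ : Type*} [Group Λ] [MeasurableSpace Λ] [DiscreteMeasurableSpace Λ] [Countable Λ]
variable {m : ℕ} {A : Subring ℝ} {G : Type*} [Group G] {act : G → (Fin (m+1) → ℝ) → (Fin (m+1) → ℝ)}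

/-- coordinates -/
def eqv (i : Fin (m+1)) : (Fin (m+1) → ℝ) ≃ᵐ ℝ × (Fin m → ℝ) := MeasurableEquiv.piFinSuccAbove (fun _ : Fin (m+1) => ℝ) i

theorem eqv_mp (i : Fin (m+1)) : MeasurePreserving (eqv i) volume volume := volume_preserving_piFinSuccAbove (fun _ => ℝ) i

theorem eqv_fst (i : Fin (m+1)) (x) : (eqv i x).1 = x i := rfl
theorem eqv_snd (i : Fin (m+1)) (x) (k) : (eqv i x).2 k = x (i.succAbove k) := rfl

theorem eqv_ext {i : Fin (m+1)} {x : Fin (m+1) → ℝ} {z : ℝ × (Fin m → ℝ)} (h1 : x i = z.1) (h2 : ∀ k, x (i.succAbove k) = z.2 k) :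
    eqv i x = z := Prod.ext h1 (funext h2)

theorem eqv_shift (i : Fin (m+1)) (x : Fin (m+1) → ℝ) (s : ℝ) : eqv i (x + Pi.single i s) = ((eqv i x).1 + s, (eqv i x).2) := by
  refine eqv_ext ?_ ?_
  · simp [eqv_fst]
  · intro k; simp [eqv_snd]

theorem eqv_A (i : Fin (m+1)) (j : Fin m) (x : Fin (m+1) → ℝ) :
    eqv i (x + Pi.single i (x (i.succAbove j))) = sheA j (eqv i x) := by
  rw [eqv_shift]; rfl

theorem eqv_U (i : Fin (m+1)) (j l : Fin m) (x : Fin (m+1) → ℝ) :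
    eqv i (x - Pi.single (i.succAbove j) (x (i.succAbove l))) = sheU j l (eqv i x) := by
  refine eqv_ext ?_ ?_
  · simp [eqv_fst, sheU]
  · intro k
    simp only [sheU, eqv_snd, Pi.sub_apply]
    congr 1
    by_cases hk : k = j
    · subst hk; simp
    · simp [hk]

theorem prT_eqv {i : Fin (m+1)} {x x' : Fin (m+1) → ℝ} (h : prT (eqv i x') = prT (eqv i x)) :
    ∃ k : Fin (m+1) → ℤ, x' = x + fun q => (k q : ℝ) := by
  have : ∀ q, ∃ k : ℤ, x' q = x q + k := by
    intro q
    have hq : ((x' q : ℝ) : UnitAddCircle) = (x q : UnitAddCircle) := by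
      rcases Fin.eq_self_or_eq_succAbove i q with rfl | ⟨k, rfl⟩
      · exact congrArg Prod.fst h
      · exact congrFun (congrArg Prod.snd h) k
    rw [← sub_eq_zero, ← AddCircle.coe_sub, AddCircle.coe_eq_zero_iff] at hq
    obtain ⟨k, hk⟩ := hq
    refine ⟨k, ?_⟩
    have : (k : ℝ) = x' q - x q := by simpa using hk
    linarith
  choose k hk using this
  exact ⟨k, funext hk⟩

theorem perT_of {i : Fin (m+1)} {w : (Fin (m+1) → ℝ) → Λ} (h : ∀ᵐ x, ∀ k : Fin (m+1) → ℤ, w (x + fun q => (k q : ℝ)) = w x) :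
    PerT (w ∘ (eqv i).symm) := by
  have hs : MeasurePreserving (eqv i).symm volume volume := (eqv_mp i).symm
  filter_upwards [hs.quasiMeasurePreserving.ae h] with z hz z' hz'
  have : prT (eqv i ((eqv i).symm z')) = prT (eqv i ((eqv i).symm z)) := by
    rw [MeasurableEquiv.apply_symm_apply, MeasurableEquiv.apply_symm_apply, hz']
  obtain ⟨k, hk⟩ := prT_eqv this
  simp only [Function.comp]
  rw [hk, hz k]

theorem stepE1 {Ω : G → (Fin (m+1) → ℝ) → Λ} (S : Setup A act) (h : Coc act Ω)
    (h0 : ∀ (g : G) (k : Fin (m+1) → ℤ), (∀ x, act g x = x + fun i => (k i : ℝ)) → ∀ᵐ x, Ω g x = 1)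
    (i : Fin (m+1)) {j l : Fin m} (hjl : j ≠ l) {T : G} (hT : ∀ x, act T x = x + Pi.single i (x (i.succAbove j)))
    {E : G} (hE : ∀ x, act E x = x + Pi.single i 1) :
    ∃ f, Measurable f ∧ Indep i (cob act Ω f T) ∧ Indep i (cob act Ω f E) := by
  obtain ⟨B, hB⟩ := S.el i (i.succAbove l) (Fin.ne_succAbove i l)
  have hne : i.succAbove j ≠ i.succAbove l := fun hh => hjl (Fin.succAbove_right_injective hh)
  obtain ⟨U, hU⟩ := S.eln (i.succAbove j) (i.succAbove l) hne
  obtain ⟨W, hW⟩ := S.eln (i.succAbove l) (i.succAbove j) hne.symm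
  have es : ∀ z, eqv i ((eqv i).symm z) = z := fun z => (eqv i).apply_symm_apply z
  have eT : ∀ z, act T ((eqv i).symm z) = (eqv i).symm (sheA j z) := fun z => by
    apply (eqv i).injective; rw [hT, eqv_A, es, es]
  have eB : ∀ z, act B ((eqv i).symm z) = (eqv i).symm (sheA l z) := fun z => by
    apply (eqv i).injective; rw [hB, eqv_A, es, es]
  have eU : ∀ z, act U ((eqv i).symm z) = (eqv i).symm (sheU j l z) := fun z => by
    apply (eqv i).injective; rw [hU, eqv_U, es, es]
  have eW : ∀ z, act W ((eqv i).symm z) = (eqv i).symm (sheU l j z) := fun z => by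
    apply (eqv i).injective; rw [hW, eqv_U, es, es]
  have hs : MeasurePreserving (eqv i).symm volume volume := (eqv_mp i).symm
  have q : ∀ {g : G} {σ : ℝ × (Fin m → ℝ) → ℝ × (Fin m → ℝ)}, (∀ z, act g ((eqv i).symm z) = (eqv i).symm (σ z)) →
      Measure.QuasiMeasurePreserving σ volume volume := by
    intro g σ hσ
    have : σ = eqv i ∘ act g ∘ (eqv i).symm := by
      funext z; simp only [Function.comp]; rw [hσ, es]
    rw [this]
    exact (eqv_mp i).quasiMeasurePreserving.comp ((S.qmp g).comp hs.quasiMeasurePreserving)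
  have mo : ∀ g, Measurable (Ω g ∘ (eqv i).symm) := fun g => (h.meas g).comp (eqv i).symm.measurable
  have perA : ∀ {g : G} {p p' : Fin (m+1)} , (∀ x, act g x = x + Pi.single p (x p')) → PerT (Ω g ∘ (eqv i).symm) := by
    intro g p p' hg
    refine perT_of (per_of S h h0 fun k => ⟨k + Pi.single p (k p'), fun x => ?_⟩)
    rw [hg, hg]
    funext r
    by_cases hr : r = p
    · subst hr; simp; ring
    · simp [hr]
  have perU : ∀ {g : G} {p p' : Fin (m+1)} , (∀ x, act g x = x - Pi.single p (x p')) → PerT (Ω g ∘ (eqv i).symm) := by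
    intro g p p' hg
    refine perT_of (per_of S h h0 fun k => ⟨k - Pi.single p (k p'), fun x => ?_⟩)
    rw [hg, hg]
    funext r
    by_cases hr : r = p
    · subst hr; simp; ring
    · simp [hr]
  have inj := (eqv i).injective
  obtain ⟨f, mf, f1, f2⟩ := thmE0 hjl (mo T) (mo B) (mo U) (mo W) (q eT) (q eB) (q eU) (q eW)
    (perA hT) (perA hB) (perU hU) (perU hW)
    (by
      have := h.rel S (g := B) (k := T) (g' := T) (k' := B) (fun x => inj (by
        simp only [hT, hB, eqv_A]; simp only [sheA]; congr 1; ring))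
      filter_upwards [hs.quasiMeasurePreserving.ae this] with z hz
      simpa only [eT, eB, eU, eW, Function.comp] using hz)
    (by
      have := h.rel3 S (g := U) (k := T) (g' := B) (k' := T) (l' := U) (fun x => inj (by
        simp only [hT, hB, hU, eqv_A, eqv_U]; simp [sheA, sheU, hjl.symm]; ring))
      filter_upwards [hs.quasiMeasurePreserving.ae this] with z hz
      simpa only [eT, eB, eU, eW, Function.comp] using hz)
    (by
      have := h.rel S (g := U) (k := B) (g' := B) (k' := U) (fun x => inj (by
        simp only [hT, hB, hU, eqv_A, eqv_U]; simp [sheA, sheU, hjl.symm]))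
      filter_upwards [hs.quasiMeasurePreserving.ae this] with z hz
      simpa only [eT, eB, eU, eW, Function.comp] using hz)
    (by
      have := h.rel3 S (g := W) (k := B) (g' := B) (k' := T) (l' := W) (fun x => inj (by
        simp only [hT, hB, hW, eqv_A, eqv_U]; simp [sheA, sheU, hjl]))
      filter_upwards [hs.quasiMeasurePreserving.ae this] with z hz
      simpa only [eT, eB, eU, eW, Function.comp] using hz)
    (by
      have := h.rel S (g := W) (k := T) (g' := T) (k' := W) (fun x => inj (by
        simp only [hT, hB, hW, eqv_A, eqv_U]; simp [sheA, sheU, hjl]))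
      filter_upwards [hs.quasiMeasurePreserving.ae this] with z hz
      simpa only [eT, eB, eU, eW, Function.comp] using hz)
  have mfe : Measurable (f ∘ eqv i) := mf.comp (eqv i).measurable
  have hc := h.cob S mfe
  refine ⟨f ∘ eqv i, mfe, indep_of_ae (hc.meas T) ?_, indep_of_ae (hc.meas E) ?_⟩
  · filter_upwards [f1] with s hs1
    filter_upwards [(eqv_mp i).quasiMeasurePreserving.ae hs1] with x hx
    simp only [← eqv_shift, Function.comp, MeasurableEquiv.symm_apply_apply] at hx
    simp only [cob, Function.comp, hT, eqv_A]
    exact hx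
  · have hE1 : ∀ᵐ x, Ω E x = 1 := h0 E (Pi.single i 1) (fun x => by
      rw [hE]; congr 1
      funext r
      by_cases hr : r = i
      · subst hr; simp
      · simp [hr])
    filter_upwards [f2] with s hs1
    filter_upwards [(eqv_mp i).quasiMeasurePreserving.ae hs1, hE1, (single_qmp (Pi.single i s)).ae hE1] with x hx x1 x2
    simp only [cob, Function.comp, hE, x1, x2, mul_one]
    simp only [eqv_shift]
    exact hx

theorem Indep.shift {n : ℕ} {i : Fin n} {c : (Fin n → ℝ) → Λ} (h : Indep i c) (v : Fin n → ℝ) : Indep i (fun x => c (x + v)) := by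
  intro s
  filter_upwards [(single_qmp v).ae (h s)] with x hx
  rw [← hx]; congr 1; abel

theorem Indep.mul' {n : ℕ} {i : Fin n} {c d : (Fin n → ℝ) → Λ} (h : Indep i c) (h' : Indep i d) : Indep i (fun x => c x * d x) := by
  intro s
  filter_upwards [h s, h' s] with x h1 h2
  rw [h1, h2]

theorem Indep.inv' {n : ℕ} {i : Fin n} {c : (Fin n → ℝ) → Λ} (h : Indep i c) : Indep i (fun x => (c x)⁻¹) := by
  intro s
  filter_upwards [h s] with x h1
  rw [h1]

theorem stepGen {Ω : G → (Fin (m+1) → ℝ) → Λ} (S : Setup A act) (h : Coc act Ω)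
    (i : Fin (m+1)) {j : Fin m} {T : G} (hT : ∀ x, act T x = x + Pi.single i (x (i.succAbove j)))
    {E : G} (hE : ∀ x, act E x = x + Pi.single i 1) (iT : Indep i (Ω T)) (iE : Indep i (Ω E))
    {g k : G} {a : Fin (m+1) → ℝ} (hg : ∀ x, act g x = x + a)
    (hk : ∀ x, act k x = x + Pi.single i (a (i.succAbove j))) (ik : Indep i (Ω k)) : Indep i (Ω g) := by
  have r1 := h.rel S (g := g) (k := E) (g' := E) (k' := g) (fun x => by simp only [hg, hE]; abel)
  have kT : ∀ x, act (k * T) x = x + Pi.single i (x (i.succAbove j) + a (i.succAbove j)) := fun x => by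
    rw [S.mul, hT, hk, Pi.single_add]; abel
  have r2 := h.rel S (g := g) (k := k * T) (g' := T) (k' := g) (fun x => by
    simp only [kT, hg, hT, Pi.add_apply]; abel)
  have ikT : Indep i (Ω (k * T)) := by
    intro s
    have e := h.mul k T
    filter_upwards [e, (single_qmp (Pi.single i s)).ae e, iT s, (S.qmp T).ae (ik s)] with x h1 h2 h3 h4
    rw [h1, h2, h3]
    rw [show act T (x + Pi.single i s) = act T x + Pi.single i s by
      simp only [hT, Pi.add_apply, Pi.single_apply, Fin.succAbove_ne, if_false, add_zero]; abel]
    rw [h4]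
  refine LLs (h.meas g) fun s => lemG (mchi (h.meas g) s) i j (a (i.succAbove j)) ?_ ?_
  · refine chi (S := fun x => x + Pi.single i 1) (fun x s => by abel) (c := fun x => Ω E (x + a)) (d := fun x => (Ω E x)⁻¹) ?_
      (iE.shift a) iE.inv' s
    filter_upwards [r1] with x hx
    rw [hE, hg] at hx
    rw [← hx]; group
  · refine chi (S := fun x => x + Pi.single i (x (i.succAbove j) + a (i.succAbove j))) (fun x s => ?_) (c := fun x => Ω T (x + a))
      (d := fun x => (Ω (k * T) x)⁻¹) ?_ (iT.shift a) ikT.inv' s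
    · simp only [Pi.add_apply, Pi.single_apply, Fin.succAbove_ne, if_false, add_zero]; abel
    · filter_upwards [r2] with x hx
      rw [kT, hg] at hx
      rw [← hx]; group

theorem Coc.one {n : ℕ} {act : G → (Fin n → ℝ) → (Fin n → ℝ)} {Ω : G → (Fin n → ℝ) → Λ} (S : Setup A act) (h : Coc act Ω) : ∀ᵐ x, Ω 1 x = 1 := by
  filter_upwards [h.mul 1 1] with x hx
  rw [S.one, mul_one] at hx
  simpa using hx

theorem stepE {Ω : G → (Fin (m+1) → ℝ) → Λ} (S : Setup A act) (h : Coc act Ω) (hm : 2 ≤ m) (i : Fin (m+1)) :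
    ∃ f, Measurable f ∧ ∀ (g : G) (a : Fin (m+1) → A), (∀ x, act g x = x + fun i => (a i : ℝ)) → Indep i (cob act Ω f g) := by
  obtain ⟨φ, mφ, hφ⟩ := step0 S h
  let j : Fin m := ⟨0, by omega⟩
  let l : Fin m := ⟨1, by omega⟩
  have hjl : j ≠ l := by simp [j, l]
  obtain ⟨T, hT⟩ := S.el i (i.succAbove j) (Fin.ne_succAbove i j)
  obtain ⟨E, hE⟩ := S.trs i 1
  have hE : ∀ x, act E x = x + Pi.single i 1 := by simpa using hE
  obtain ⟨f, mf, iT, iE⟩ := stepE1 S (h.cob S mφ) hφ i hjl hT hE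
  rw [cob_cob] at iT iE
  have mF : Measurable (fun x => f x * φ x) := mf.mul mφ
  have hc := h.cob S mF
  have first : ∀ (g : G) (α : A), (∀ x, act g x = x + Pi.single i (α : ℝ)) → Indep i (cob act Ω (fun x => f x * φ x) g) := by
    intro g α hg
    refine stepGen S hc i hT hE iT iE hg (k := 1) (fun x => ?_) ?_
    · rw [S.one]; simp
    · intro s
      filter_upwards [hc.one S, (single_qmp (Pi.single i s)).ae (hc.one S)] with x h1 h2
      rw [h1, h2]
  refine ⟨_, mF, fun g a hg => ?_⟩
  obtain ⟨k, hk⟩ := S.trs i (a (i.succAbove j))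
  exact stepGen S hc i hT hE iT iE hg hk (first k _ hk)

end S3

section S4
open Filter Topology
open scoped ENNReal
variable {Λ : Type*} [Group Λ] [MeasurableSpace Λ] [DiscreteMeasurableSpace Λ] [Countable Λ]

/-- (x,τ) ↦ (x[i:=τ], x i − τ) -/
def swE {n : ℕ} (i : Fin n) : ((Fin n → ℝ) × ℝ) ≃ₗ[ℝ] ((Fin n → ℝ) × ℝ) where
  toFun p := (p.1 + Pi.single i (p.2 - p.1 i), p.1 i - p.2)
  invFun p := (p.1 + Pi.single i p.2, p.1 i)
  map_add' p q := by
    refine Prod.ext ?_ ?_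
    · funext k
      by_cases hk : k = i
      · subst hk; simp
      · simp [hk]
    · simp; ring
  map_smul' c p := by
    refine Prod.ext ?_ ?_
    · funext k
      by_cases hk : k = i
      · subst hk; simp; ring
      · simp [hk]
    · simp; ring
  left_inv p := by
    refine Prod.ext ?_ ?_
    · funext k
      by_cases hk : k = i
      · subst hk; simp
      · simp [hk]
    · simp
  right_inv p := by
    refine Prod.ext ?_ ?_
    · funext k
      by_cases hk : k = i
      · subst hk; simp
      · simp [hk]
    · simp

theorem swE_qmp {n : ℕ} (i : Fin n) : Measure.QuasiMeasurePreserving (swE i)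
    ((volume : Measure (Fin n → ℝ)).prod (volume : Measure ℝ)) ((volume : Measure (Fin n → ℝ)).prod (volume : Measure ℝ)) :=
  Measure.LinearMap.quasiMeasurePreserving _ (swE i : ((Fin n → ℝ) × ℝ) →ₗ[ℝ] ((Fin n → ℝ) × ℝ)) (LinearEquiv.isUnit_det' _).ne_zero

/-- normalised f -/
def ftil {n : ℕ} (i : Fin n) (f : (Fin n → ℝ) → Λ) (τ : ℝ) (x : Fin n → ℝ) : Λ := (f (x + Pi.single i (τ - x i)))⁻¹ * f x

theorem mftil {n : ℕ} (i : Fin n) {f : (Fin n → ℝ) → Λ} (hf : Measurable f) (τ : ℝ) : Measurable (ftil i f τ) := by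
  refine Measurable.mul (Measurable.inv (hf.comp ?_)) hf
  refine measurable_id.add ?_
  exact (continuous_single i).measurable.comp (measurable_const.sub (measurable_pi_apply i))

theorem ftil_indep {n : ℕ} {i : Fin n} {f : (Fin n → ℝ) → Λ} (hf : Measurable f) {I : Finset (Fin n)} (hi : i ∉ I)
    (h : ∀ t : ℝ, ∀ k ∈ I, Indep k (fun x => (f x)⁻¹ * f (x + Pi.single i t))) :
    ∃ τ, ∀ k ∈ I, Indep k (ftil i f τ) := by
  have key : ∀ k ∈ I, ∀ s : ℝ, ∀ᵐ τ : ℝ, ∀ᵐ x, ftil i f τ (x + Pi.single k s) = ftil i f τ x := by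
    intro k hk s
    have hki : i ≠ k := fun hh => hi (hh ▸ hk)
    have ms : Measurable (fun t : ℝ => (Pi.single i t : Fin n → ℝ)) := (continuous_single i).measurable
    have h1 : ∀ᵐ p ∂((volume : Measure (Fin n → ℝ)).prod (volume : Measure ℝ)),
        (f (p.1 + Pi.single k s))⁻¹ * f (p.1 + Pi.single k s + Pi.single i p.2) = (f p.1)⁻¹ * f (p.1 + Pi.single i p.2) := by
      refine ae_swap_prod ?_ (ae_of_all _ fun t => h t k hk s)
      refine measurableSet_eq_fun ?_ ?_
      · exact (hf.comp (measurable_fst.add_const _)).inv.mul (hf.comp ((measurable_fst.add_const _).add (ms.comp measurable_snd)))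
      · exact (hf.comp measurable_fst).inv.mul (hf.comp (measurable_fst.add (ms.comp measurable_snd)))
    have h2 := (swE_qmp i).ae h1
    have h3 := (Measure.measurePreserving_swap (μ := (volume : Measure ℝ)) (ν := (volume : Measure (Fin n → ℝ)))).quasiMeasurePreserving.ae h2
    have h4 := Measure.ae_ae_of_ae_prod h3
    filter_upwards [h4] with τ hτ
    filter_upwards [hτ] with x hx
    have hx : (f (x + Pi.single i (τ - x i) + Pi.single k s))⁻¹ * f (x + Pi.single i (τ - x i) + Pi.single k s + Pi.single i (x i - τ)) =
      (f (x + Pi.single i (τ - x i)))⁻¹ * f (x + Pi.single i (τ - x i) + Pi.single i (x i - τ)) := hx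
    have e1 : x + Pi.single i (τ - x i) + Pi.single i (x i - τ) = x := by
      rw [add_assoc, ← Pi.single_add]; simp
    have e2 : x + Pi.single i (τ - x i) + Pi.single k s + Pi.single i (x i - τ) = x + Pi.single k s := by
      rw [add_right_comm, e1]
    rw [e1, e2] at hx
    simp only [ftil]
    rw [← hx]
    congr 3
    rw [Pi.add_apply, Pi.single_apply, if_neg hki, add_zero]
    abel
  have : ∀ᵐ τ : ℝ, ∀ k ∈ I, ∀ s : ℚ, ∀ᵐ x, ftil i f τ (x + Pi.single k (s : ℝ)) = ftil i f τ x := by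
    rw [ae_all_iff]
    intro k
    by_cases hk : k ∈ I
    · filter_upwards [ae_all_iff.2 fun s : ℚ => key k hk s] with τ hτ _ s
      exact hτ s
    · exact ae_of_all _ fun τ hh => absurd hh hk
  obtain ⟨τ, hτ⟩ := this.exists
  refine ⟨τ, fun k hk => indep_of_dense (mftil i hf τ) (Rat.denseRange_cast (𝕜 := ℝ)) ?_⟩
  rintro _ ⟨s, rfl⟩
  exact hτ k hk s

variable {m : ℕ} {A : Subring ℝ} {G : Type*} [Group G] {act : G → (Fin (m+1) → ℝ) → (Fin (m+1) → ℝ)}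

theorem stepF {Ω : G → (Fin (m+1) → ℝ) → Λ} (S : Setup A act) (h : Coc act Ω) (hm : 2 ≤ m) (I : Finset (Fin (m+1))) :
    ∃ φ, Measurable φ ∧ ∀ i ∈ I, ∀ (g : G) (a : Fin (m+1) → A), (∀ x, act g x = x + fun i => (a i : ℝ)) → Indep i (cob act Ω φ g) := by
  induction I using Finset.induction_on with
  | empty => exact ⟨fun _ => 1, measurable_const, by simp⟩
  | insert i I hi ih =>
    obtain ⟨φ, mφ, hφ⟩ := ih
    have h1 := h.cob S mφ
    obtain ⟨f, mf, hf⟩ := stepE S h1 hm i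
    obtain ⟨τ, hτ⟩ := ftil_indep mf hi (by
      intro t k hk
      refine LA S.dense (mf.inv.mul (mf.comp (measurable_add_const _))) ?_
      intro α hα
      obtain ⟨g, hg⟩ := S.trs k ⟨α, hα⟩
      have hg : ∀ x, act g x = x + Pi.single k α := hg
      have hg' : ∀ x, act g x = x + fun q => ((Pi.single k (⟨α, hα⟩ : A) : Fin (m+1) → A) q : ℝ) := by
        intro x; rw [hg]; congr 1; funext q
        by_cases hq : q = k
        · subst hq; simp
        · simp [hq]
      refine ⟨cob act Ω φ g, fun x => (cob act Ω φ g (x + Pi.single i t))⁻¹, hφ k hk g _ hg', ((hφ k hk g _ hg').shift _).inv', ?_⟩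
      filter_upwards [hf g _ hg' t] with x hx
      have hx : f (act g (x + Pi.single i t)) * cob act Ω φ g (x + Pi.single i t) * (f (x + Pi.single i t))⁻¹ =
        f (act g x) * cob act Ω φ g x * (f x)⁻¹ := hx
      rw [hg, hg] at hx
      rw [add_right_comm] at hx
      have := eq_mul_inv_of_mul_eq (eq_mul_of_mul_inv_eq hx)
      rw [this]
      group)
    refine ⟨fun x => ftil i f τ x * φ x, (mftil i mf τ).mul mφ, ?_⟩
    rw [← cob_cob]
    intro k hk g a hg
    rcases Finset.mem_insert.1 hk with rfl | hk
    · intro s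
      filter_upwards [hf g a hg s] with x hx
      have hx : f (act g (x + Pi.single k s)) * cob act Ω φ g (x + Pi.single k s) * (f (x + Pi.single k s))⁻¹ =
        f (act g x) * cob act Ω φ g x * (f x)⁻¹ := hx
      have ei : ∀ (y : Fin (m+1) → ℝ) (s : ℝ), y + Pi.single k s + Pi.single k (τ - (y + Pi.single k s : Fin (m+1) → ℝ) k) = y + Pi.single k (τ - y k) := by
        intro y s
        rw [add_assoc, ← Pi.single_add]; congr 2
        simp; ring
      have eg : act g (x + Pi.single k s) = act g x + Pi.single k s := by rw [hg, hg]; abel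
      have gen : ∀ y, cob act (cob act Ω φ) (ftil k f τ) g y = (f (act g y + Pi.single k (τ - act g y k)))⁻¹ *
          (f (act g y) * cob act Ω φ g y * (f y)⁻¹) * f (y + Pi.single k (τ - y k)) := by
        intro y
        rw [cob]; simp only [ftil]; group
      rw [gen, gen, hx, eg, ei, ei]
    · have : cob act (cob act Ω φ) (ftil i f τ) g = fun x => ftil i f τ (x + fun i => (a i : ℝ)) * cob act Ω φ g x * (ftil i f τ x)⁻¹ := by
        funext x; rw [← hg]; rfl
      rw [this]
      exact (((hτ k hk).shift _).mul' (hφ k hk g a hg)).mul' (hτ k hk).inv'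

theorem final_abs {Ω : G → (Fin (m+1) → ℝ) → Λ} (S : Setup A act) (h : Coc act Ω) (hm : 2 ≤ m) :
    ∃ δ : G →* Λ, ∃ φ, Measurable φ ∧ ∀ g, ∀ᵐ x, Ω g x = (φ (act g x))⁻¹ * δ g * φ x := by
  obtain ⟨φ, mφ, hφ⟩ := stepF S h hm Finset.univ
  have hc := h.cob S mφ
  have ht : ∀ (g : G) (a : Fin (m+1) → A), (∀ x, act g x = x + fun i => (a i : ℝ)) → ∃ c, ∀ᵐ x, cob act Ω φ g x = c := fun g a hg =>
    const_of_indep (hc.meas g) fun i => hφ i (Finset.mem_univ i) g a hg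
  have hall : ∀ g, ∃ c, ∀ᵐ x, cob act Ω φ g x = c := by
    intro g
    refine const_of_indep (hc.meas g) fun i => LA S.dense (hc.meas g) fun α hα => ?_
    let a : Fin (m+1) → A := Pi.single i ⟨α, hα⟩
    have ha : (fun q => (a q : ℝ)) = Pi.single i α := by
      funext q
      by_cases hq : q = i
      · subst hq; simp [a]
      · simp [a, hq]
    obtain ⟨t, hta⟩ := S.tr a
    obtain ⟨b, hb⟩ := S.nrm g a
    obtain ⟨t', htb⟩ := S.tr b
    obtain ⟨c, hc1⟩ := ht t a hta
    obtain ⟨d, hd1⟩ := ht t' b htb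
    refine ⟨fun _ => d, fun _ => c⁻¹, fun s => ae_of_all _ fun _ => rfl, fun s => ae_of_all _ fun _ => rfl, ?_⟩
    have r := hc.rel S (g := g) (k := t) (g' := t') (k' := g) (fun x => by rw [hta, htb, hb])
    filter_upwards [r, hc1, (S.qmp g).ae hd1] with x h1 h2 h3
    rw [h2, h3, hta, ha] at h1
    exact eq_mul_inv_of_mul_eq h1
  choose δ hδ using hall
  refine ⟨MonoidHom.mk' δ ?_, φ, mφ, ?_⟩
  · intro g k
    obtain ⟨x, h1, h2, h3, h4⟩ := ((hc.mul g k).and ((hδ (g * k)).and ((hδ k).and ((S.qmp k).ae (hδ g))))).exists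
    rw [← h2, h1, h3, h4]
  · intro g
    filter_upwards [hδ g] with x hx
    show Ω g x = (φ (act g x))⁻¹ * δ g * φ x
    rw [← hx, cob]
    group

end S4

section S5
open Filter Topology

theorem map_mulVec_coe {k : ℕ} {B : Subring ℝ} (M : Matrix (Fin k) (Fin k) B) (v : Fin k → B) :
    (M.map (fun r : B => (r : ℝ))).mulVec (fun i => (v i : ℝ)) = fun i => ((M.mulVec v) i : ℝ) := by
  funext i
  simp [Matrix.mulVec, dotProduct]

theorem map_mul_coe {k : ℕ} {B : Subring ℝ} (M N : Matrix (Fin k) (Fin k) B) :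
    (M * N).map (fun r : B => (r : ℝ)) = M.map (fun r : B => (r : ℝ)) * N.map (fun r : B => (r : ℝ)) := by
  ext i j
  simp [Matrix.mul_apply]

theorem dense_subring {B : Subring ℝ} (h : ∃ a : ℝ, a ∈ B ∧ a ∉ Set.range (Int.cast : ℤ → ℝ)) : Dense (B : Set ℝ) := by
  rcases AddSubgroup.dense_or_cyclic B.toAddSubgroup with hd | ⟨c, hc⟩
  · exact hd
  · exfalso
    obtain ⟨a, haB, ha⟩ := h
    have key : ∀ y : ℝ, y ∈ B ↔ ∃ k : ℤ, k • c = y := by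
      intro y
      have : y ∈ B ↔ y ∈ B.toAddSubgroup := Iff.rfl
      rw [this, hc, AddSubgroup.mem_closure_singleton]
    obtain ⟨k, hk⟩ := (key 1).1 B.one_mem
    have hcB : c ∈ B := (key c).2 ⟨1, by simp⟩
    obtain ⟨l, hl⟩ := (key (c * c)).1 (B.mul_mem hcB hcB)
    obtain ⟨p, hp⟩ := (key a).1 haB
    simp only [zsmul_eq_mul] at hk hl hp
    have hc0 : c ≠ 0 := by rintro rfl; simp at hk
    have hcl : c = l := by
      have : (l : ℝ) * c = c * c := hl
      exact (mul_right_cancel₀ hc0 this).symm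
    exact ha ⟨p * l, by rw [← hp, hcl]; push_cast; rfl⟩

theorem act_setup {k : ℕ} {B : Subring ℝ} (hB : Dense (B : Set ℝ)) (F : Subgroup (↥B)ˣ) : Setup B (affAct k B F) where
  one x := by
    simp only [affAct, SemidirectProduct.one_left, SemidirectProduct.one_right]
    have : ((((1 : GammaF k B F) : Matrix.GeneralLinearGroup (Fin k) ↥B) :
        Matrix (Fin k) (Fin k) ↥B).map (fun r : ↥B => (r : ℝ))) = 1 := by
      ext i j; simp [Matrix.one_apply]; split_ifs <;> simp
    rw [this, Matrix.one_mulVec]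
    funext i; simp
  mul g h x := by
    simp only [affAct, SemidirectProduct.mul_left, SemidirectProduct.mul_right]
    rw [Matrix.mulVec_add, map_mulVec_coe, Matrix.mulVec_mulVec, ← map_mul_coe, ← add_assoc]
    rfl
  qmp g := by
    have hdet : (((g.right : Matrix.GeneralLinearGroup (Fin k) ↥B) :
        Matrix (Fin k) (Fin k) ↥B).map (fun r : ↥B => (r : ℝ))).det ≠ 0 := by
      have h1 : IsUnit (((g.right : Matrix.GeneralLinearGroup (Fin k) ↥B) : Matrix (Fin k) (Fin k) ↥B).det) :=
        (Matrix.isUnit_iff_isUnit_det _).1 (Units.isUnit _)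
      have := (h1.map B.subtype)
      rw [RingHom.map_det] at this
      exact this.ne_zero
    have q := Measure.LinearMap.quasiMeasurePreserving (volume : Measure (Fin k → ℝ))
      (Matrix.toLin' (((g.right : Matrix.GeneralLinearGroup (Fin k) ↥B) :
        Matrix (Fin k) (Fin k) ↥B).map (fun r : ↥B => (r : ℝ)))) (by rwa [LinearMap.det_toLin'])
    exact (measurePreserving_add_left volume (fun i => ((Multiplicative.toAdd g.left) i : ℝ))).quasiMeasurePreserving.comp q
  inj g h e := by
    have e0 := e 0
    simp only [affAct, Matrix.mulVec_zero, add_zero] at e0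
    refine SemidirectProduct.ext ?_ ?_
    · refine Multiplicative.toAdd.injective (funext fun i => Subtype.ext ?_)
      exact congrFun e0 i
    · refine Subtype.ext (Units.ext (Matrix.ext fun i j => Subtype.ext ?_))
      have ej := congrFun (e (Pi.single j 1)) i
      simp only [affAct] at ej
      rw [e0] at ej
      simpa using ej
  tr a := ⟨SemidirectProduct.inl (Multiplicative.ofAdd a), fun x => by
    simp only [affAct, SemidirectProduct.left_inl, SemidirectProduct.right_inl]
    have : ((((1 : GammaF k B F) : Matrix.GeneralLinearGroup (Fin k) ↥B) :
        Matrix (Fin k) (Fin k) ↥B).map (fun r : ↥B => (r : ℝ))) = 1 := by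
      ext i j; simp [Matrix.one_apply]; split_ifs <;> simp
    rw [this, Matrix.one_mulVec, add_comm]
    rfl⟩
  el i j hij := by
    let M : Matrix (Fin k) (Fin k) B := Matrix.transvection i j 1
    let U : Matrix.GeneralLinearGroup (Fin k) ↥B := ⟨M, Matrix.transvection i j (-1),
      by simp [M, Matrix.transvection_mul_transvection_same, hij], by simp [M, Matrix.transvection_mul_transvection_same, hij]⟩
    have hU : U ∈ GammaF k B F := by
      show Matrix.GeneralLinearGroup.det U ∈ F
      have : Matrix.GeneralLinearGroup.det U = 1 := Units.ext (Matrix.det_transvection_of_ne i j hij 1)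
      rw [this]; exact F.one_mem
    refine ⟨SemidirectProduct.inr ⟨U, hU⟩, fun x => ?_⟩
    simp only [affAct, SemidirectProduct.left_inr, SemidirectProduct.right_inr]
    have : ((U : Matrix (Fin k) (Fin k) ↥B).map (fun r : ↥B => (r : ℝ))) = Matrix.transvection i j 1 := by
      ext p q
      simp only [U, M, Matrix.transvection, Matrix.map_apply, Matrix.add_apply, Matrix.one_apply, Matrix.single_apply]
      split_ifs <;> simp
    rw [this, Matrix.transvection, Matrix.add_mulVec, Matrix.one_mulVec, Matrix.single_mulVec]
    funext q
    simp [Pi.single_apply, Function.update_apply]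
  nrm g a := ⟨_, fun x => by
    simp only [affAct]
    rw [Matrix.mulVec_add, map_mulVec_coe]
    rw [add_comm (Matrix.mulVec _ x), ← add_assoc, add_right_comm]⟩
  dense := hB

end S5

/-- Let `𝒜 ⊆ ℝ` be a countable subring containing an algebraic number not in
`ℤ`, let `F ⊆ 𝒜ˣ` be a subgroup of the units of `𝒜`, let `n ≥ 3`, and let
`G = Γ ⋉ 𝒜ⁿ` where `Γ = {A ∈ GL(n,𝒜) : det A ∈ F}`, acting on `ℝⁿ` by the affine maps
`(A,a)·x = A(a+x)`. Then this action is cocycle superrigid with countable targets. -/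
theorem affine_action_cocycle_superrigid
    (A : Subring ℝ) (hAcount : Countable A)
    (hAalg : ∃ a : ℝ, a ∈ A ∧ IsAlgebraic ℚ a ∧ a ∉ Set.range (Int.cast : ℤ → ℝ))
    (F : Subgroup (↥A)ˣ) (n : ℕ) (hn : 3 ≤ n) :
    CocycleSuperrigid (volume : Measure (Fin n → ℝ)) (affAct n A F) := by
  intro Λ _ _ Ω hΩ
  obtain ⟨m, rfl⟩ : ∃ m, n = m + 1 := ⟨n - 1, by omega⟩
  letI : MeasurableSpace Λ := ⊤
  have S := act_setup (k := m + 1) (dense_subring (by obtain ⟨a, h1, _, h2⟩ := hAalg; exact ⟨a, h1, h2⟩)) F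
  have hc : Coc (affAct (m+1) A F) Ω := ⟨fun g => measurable_to_countable' fun l => hΩ.1 g l, hΩ.2⟩
  obtain ⟨δ, φ, mφ, h⟩ := final_abs S hc (by omega)
  exact ⟨δ, φ, fun l => mφ (measurableSet_singleton l), h⟩

end OESuperrigidity
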